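/- arXiv:1610.09304 — 3 statements merged into one kernel-verified Lean document; each statement's English description precedes it below -/
import Mathlib

section
/- For every finite R-module M_0 (not necessarily occurring as a cokernel), the sum of #Surj_R(M, M_0)/#Aut_R(M) over all isomorphism classes of finite R-modules M which occur as a cokernel converges and equals c_R^{−1}; equivalently, the expected number of surjections onto M_0 from a module drawn according to the measure μ_R(M) = c_R/#Aut_R(M) is 1. -/
/- STATEMENT 10: For every finite R-module M₀ (not necessarily occurring as a cokernel),
   the sum of #Surj_R(M, M₀)/#Aut_R(M) over all isomorphism classes of finite R-modules
   M which occur as a cokernel converges and equals c_R^{−1}; equivalently, the expected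
   number of surjections onto M₀ from a module drawn according to the measure
   μ_R(M) = c_R/#Aut_R(M) is 1.

   The sum over isomorphism classes is expressed by summing over any complete,
   irredundant family of representatives of the isomorphism classes of finite R-modules
   occurring as cokernels. -/

open IsLocalRing

/-- The number of `R`-module automorphisms of `M`. -/
noncomputable def numAut (R M : Type) [CommRing R] [AddCommGroup M] [Module R M] : ℕ :=
  Nat.card (M ≃ₗ[R] M)

/-- The number of `R`-module surjections from `M` onto `M'`. -/
noncomputable def numSurj (R M M' : Type) [CommRing R] [AddCommGroup M] [Module R M]
    [AddCommGroup M'] [Module R M'] : ℕ :=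
  Nat.card {f : M →ₗ[R] M' // Function.Surjective f}

/-- `M` occurs as the cokernel of an `R`-linear endomorphism of `R^N` for some `N ≥ 1`. -/
def OccursAsCokernel (R M : Type) [CommRing R] [AddCommGroup M] [Module R M] : Prop :=
  ∃ N : ℕ, 0 < N ∧ ∃ G : (Fin N → R) →ₗ[R] (Fin N → R),
    Nonempty (((Fin N → R) ⧸ LinearMap.range G) ≃ₗ[R] M)

/-- `c_R = ∏_{i=1}^∞ (1 - |F_R|^{-i})`. -/
noncomputable def cConst (R : Type) [CommRing R] [IsLocalRing R] : ℝ :=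
  ∏' i : ℕ, (1 - ((Nat.card (ResidueField R) : ℝ))⁻¹ ^ (i + 1))


open TensorProduct

theorem card_preimage_mul {A B : Type*} [AddCommGroup A] [AddCommGroup B] [Finite A] [Finite B]
    (f : A →+ B) (hf : Function.Surjective f) (P : B → Prop) :
    Nat.card {a // P (f a)} * Nat.card B = Nat.card {b // P b} * Nat.card A := by
  let e : A ≃ B × f.ker :=
    { toFun := fun a => (f a, ⟨a - Function.surjInv hf (f a), by
        rw [AddMonoidHom.mem_ker, map_sub, Function.surjInv_eq hf, sub_self]⟩)
      invFun := fun x => x.2 + Function.surjInv hf x.1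
      left_inv := fun a => by simp
      right_inv := fun x => by
        obtain ⟨b, c, hc⟩ := x
        have hc' : f c = 0 := hc
        have : f (c + Function.surjInv hf b) = b := by
          rw [map_add, hc', zero_add, Function.surjInv_eq hf]
        ext <;> simp [this] }
  have e2 : {a // P (f a)} ≃ {b // P b} × f.ker :=
    (e.subtypeEquiv (q := fun x => P x.1) (fun a => Iff.rfl)).trans
      (Equiv.prodSubtypeFstEquivSubtypeProd (p := P))
  rw [Nat.card_congr e2, Nat.card_congr e, Nat.card_prod, Nat.card_prod]
  ring

section local_part

variable {R : Type} [CommRing R] [IsLocalRing R] {K : Type} [AddCommGroup K] [Module R K]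

theorem span_top_iff [Module.Finite R K] {r : ℕ} (g : Fin r → K) :
    Submodule.span R (Set.range g) = ⊤ ↔
      Submodule.span (ResidueField R)
        (Set.range (fun i => (1 : ResidueField R) ⊗ₜ[R] g i)) = ⊤ := by
  rw [← map_tensorProduct_mk_eq_top, Submodule.map_span,
    ← Submodule.restrictScalars_eq_top_iff R (ResidueField R),
    Submodule.restrictScalars_span R (ResidueField R) residue_surjective, ← Set.range_comp]
  rfl

theorem exists_gens [Module.Finite R K] {r : ℕ}
    (h : Module.finrank (ResidueField R) (ResidueField R ⊗[R] K) ≤ r) :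
    ∃ g : Fin r → K, Submodule.span R (Set.range g) = ⊤ := by
  let d := Module.finrank (ResidueField R) (ResidueField R ⊗[R] K)
  let b := Module.finBasis (ResidueField R) (ResidueField R ⊗[R] K)
  have hs : Function.Surjective (TensorProduct.mk R (ResidueField R) K 1) :=
    TensorProduct.mk_surjective R K _ residue_surjective
  let f : Fin d → K := fun i => Function.surjInv hs (b i)
  have hf : Submodule.span R (Set.range f) = ⊤ :=
    span_eq_top_of_tmul_eq_basis f b (fun i => Function.surjInv_eq hs (b i))
  refine ⟨fun i => if hi : (i : ℕ) < d then f ⟨i, hi⟩ else 0, ?_⟩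
  rw [eq_top_iff, ← hf]
  apply Submodule.span_mono
  rintro _ ⟨i, rfl⟩
  exact ⟨⟨i, lt_of_lt_of_le i.2 h⟩, by simp⟩

theorem finrank_le_of_gens [Module.Finite R K] {r : ℕ} (g : Fin r → K)
    (hg : Submodule.span R (Set.range g) = ⊤) :
    Module.finrank (ResidueField R) (ResidueField R ⊗[R] K) ≤ r := by
  rw [span_top_iff] at hg
  simpa using finrank_le_of_span_eq_top hg

theorem card_gens [Finite K] [Finite (ResidueField R)] {N : ℕ}
    (h : Module.finrank (ResidueField R) (ResidueField R ⊗[R] K) = N) :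
    (Nat.card {g : Fin N → K // Submodule.span R (Set.range g) = ⊤} : ℝ) =
      (Nat.card K : ℝ) ^ N *
        ∏ i ∈ Finset.range N, (1 - ((Nat.card (ResidueField R) : ℝ))⁻¹ ^ (i + 1)) := by
  have hfin : Module.Finite R K := Module.Finite.of_finite
  have hs : Function.Surjective (TensorProduct.mk R (ResidueField R) K 1) :=
    TensorProduct.mk_surjective R K _ residue_surjective
  have : Finite (ResidueField R ⊗[R] K) := Finite.of_surjective _ hs
  cases nonempty_fintype (ResidueField R)
  cases nonempty_fintype (ResidueField R ⊗[R] K)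
  let f : (Fin N → K) →+ (Fin N → ResidueField R ⊗[R] K) :=
    (LinearMap.compLeft (TensorProduct.mk R (ResidueField R) K 1) (Fin N)).toAddMonoidHom
  have hf : Function.Surjective f := fun y =>
    ⟨fun i => Function.surjInv hs (y i), funext fun i => Function.surjInv_eq hs (y i)⟩
  have key := card_preimage_mul f hf (fun v => LinearIndependent (ResidueField R) v)
  have e1 : Nat.card {a // LinearIndependent (ResidueField R) (f a)} =
      Nat.card {g : Fin N → K // Submodule.span R (Set.range g) = ⊤} := by
    apply Nat.card_congr
    apply Equiv.subtypeEquivRight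
    intro g
    rw [span_top_iff]
    have hfg : f g = fun i => (1 : ResidueField R) ⊗ₜ[R] g i := rfl
    rw [hfg, linearIndependent_iff_card_eq_finrank_span, Set.finrank]
    constructor
    · intro h1
      apply Submodule.eq_top_of_finrank_eq
      rw [h]; simpa using h1.symm
    · intro h1
      rw [h1, finrank_top, h]; simp
  rw [e1] at key
  have e2 := card_linearIndependent (K := ResidueField R) (V := ResidueField R ⊗[R] K) (k := N) h.ge
  rw [e2] at key
  have hq : Fintype.card (ResidueField R) = Nat.card (ResidueField R) := by simp
  have hW : Nat.card (ResidueField R ⊗[R] K) = Nat.card (ResidueField R) ^ N := by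
    rw [← h]; simpa using Module.card_eq_pow_finrank (K := ResidueField R) (V := ResidueField R ⊗[R] K)
  rw [Nat.card_fun, Nat.card_fun, hW, hq, h] at key
  simp only [Nat.card_eq_fintype_card, Fintype.card_fin] at key
  rw [← Nat.card_eq_fintype_card] at key
  set q := Nat.card (ResidueField R) with hqdef
  have hq1 : 1 < q := Finite.one_lt_card
  have hq0 : (q : ℝ) ≠ 0 := by positivity
  have key' := congrArg (Nat.cast : ℕ → ℝ) key
  push_cast at key'
  have e3 : (∏ i : Fin N, (((q ^ N - q ^ (i : ℕ) : ℕ)) : ℝ)) =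
      ((q : ℝ) ^ N) ^ N * ∏ i ∈ Finset.range N, (1 - ((q : ℝ))⁻¹ ^ (i + 1)) := by
    rw [← Finset.prod_range_reflect]
    rw [Finset.prod_range, ← Fin.prod_const N ((q:ℝ)^N), ← Finset.prod_mul_distrib]
    apply Finset.prod_congr rfl
    intro i _
    have hi : (i : ℕ) ≤ N := i.2.le
    rw [Nat.cast_sub (Nat.pow_le_pow_right hq1.le hi)]
    have : N - 1 - (i : ℕ) + 1 = N - i := by omega
    rw [this, mul_sub, mul_one, inv_pow, Nat.cast_pow, Nat.cast_pow]
    congr 1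
    rw [eq_mul_inv_iff_mul_eq₀ (by positivity), ← pow_add]
    congr 1; omega
  rw [e3] at key'
  have hne : (((q : ℝ) ^ N) ^ N) ≠ 0 := by positivity
  have : ((q : ℝ) ^ N) ^ N * (Nat.card {g : Fin N → K // Submodule.span R (Set.range g) = ⊤} : ℝ) =
    ((q : ℝ) ^ N) ^ N * ((Nat.card K : ℝ) ^ N *
        ∏ i ∈ Finset.range N, (1 - ((q : ℝ))⁻¹ ^ (i + 1))) := by
    rw [mul_comm, key']; ring
  exact mul_left_cancel₀ hne this

end local_part

section padic_part

variable {p : ℕ} [Fact p.Prime]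

theorem padic_dvd_pow {x : ℤ_[p]} {n : ℕ} (h : ¬ (p : ℤ_[p]) ^ (n + 1) ∣ x) :
    x ∣ (p : ℤ_[p]) ^ n := by
  have hx : x ≠ 0 := by rintro rfl; exact h (dvd_zero _)
  have hs := PadicInt.unitCoeff_spec hx
  rw [hs] at h ⊢
  have hv : x.valuation ≤ n := by
    by_contra hc
    exact h (Dvd.dvd.mul_left (pow_dvd_pow _ (by omega)) _)
  exact (Units.mul_left_dvd (u := PadicInt.unitCoeff hx)).2 (pow_dvd_pow _ hv)

theorem natCast_sub_dvd_pow {s t L : ℕ} (hs : s < L) (ht : t < L) (hst : s ≠ t) :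
    ((s : ℤ_[p]) - t) ∣ (p : ℤ_[p]) ^ L := by
  apply padic_dvd_pow
  intro h
  have h1 : ((s : ℤ_[p]) - t) = (((s : ℤ) - t : ℤ) : ℤ_[p]) := by push_cast; rfl
  rw [h1] at h
  have h2 : ((p : ℤ) ^ (L + 1)) ∣ ((s : ℤ) - t) := by
    have := (PadicInt.norm_int_le_pow_iff_dvd (p := p) (k := (s : ℤ) - t) (n := L + 1)).1
      ((PadicInt.norm_le_pow_iff_mem_span_pow _ (L + 1)).2 (Ideal.mem_span_singleton.2 h))
    exact_mod_cast this
  have h3 := Int.le_of_dvd (a := (p : ℤ) ^ (L + 1)) (b := |(s : ℤ) - t|)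
    (abs_pos.2 (sub_ne_zero.2 (by exact_mod_cast hst))) ((dvd_abs _ _).2 h2)
  have h4 : L + 1 < p ^ (L + 1) := Nat.lt_pow_self (Fact.out : p.Prime).one_lt
  have h5 : ((L : ℤ) + 1) < (p : ℤ) ^ (L + 1) := by exact_mod_cast h4
  have h6 : |(s : ℤ) - t| ≤ L := by rw [abs_le]; constructor <;> omega
  omega

open Polynomial in
theorem poly_bad (d : ℕ) : ∀ (L n : ℕ) (F : ℤ_[p][X]) (T : Finset ℕ), F.Monic →
    F.natDegree = d → (∀ t ∈ T, t < L) →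
    (∀ t ∈ T, (p : ℤ_[p]) ^ n ∣ F.eval (t : ℤ_[p])) → d * L < n → T.card ≤ d := by
  induction d with
  | zero =>
    intro L n F T hF hd _ hdiv hn
    have h1 : F = 1 := hF.natDegree_eq_zero.1 hd
    subst h1
    rw [Nat.le_zero, Finset.card_eq_zero, Finset.eq_empty_iff_forall_notMem]
    intro t ht
    have h2 := hdiv t ht
    rw [eval_one, ← isUnit_iff_dvd_one] at h2
    exact PadicInt.prime_p.not_isUnit ((isUnit_pow_iff (by omega)).1 h2)
  | succ d ih =>
    intro L n F T hF hd hL hdiv hn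
    rcases T.eq_empty_or_nonempty with rfl | ⟨t0, ht0⟩
    · simp
    have hmon : (X - C (t0 : ℤ_[p])).Monic := monic_X_sub_C _
    have hdec := modByMonic_add_div F (X - C (t0 : ℤ_[p]))
    rw [modByMonic_X_sub_C_eq_C_eval] at hdec
    set Q := F /ₘ (X - C (t0 : ℤ_[p])) with hQ
    have hQd : Q.natDegree = d := by
      rw [hQ, natDegree_divByMonic _ hmon, hd, natDegree_X_sub_C]; rfl
    have hQm : Q.Monic := by
      rw [Monic, hQ, leadingCoeff_divByMonic_of_monic hmon]
      · exact hF
      · rw [degree_X_sub_C, degree_eq_natDegree hF.ne_zero, hd]; exact_mod_cast by omega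
    have hle : L ≤ n := by nlinarith
    have := ih L (n - L) Q (T.erase t0) hQm hQd (fun t ht => hL t (Finset.mem_of_mem_erase ht)) ?_ ?_
    · rw [Finset.card_erase_of_mem ht0] at this; omega
    · intro t ht
      have hne := Finset.ne_of_mem_erase ht
      have htT := Finset.mem_of_mem_erase ht
      have he : F.eval (t : ℤ_[p]) = F.eval (t0 : ℤ_[p]) + ((t : ℤ_[p]) - t0) * Q.eval (t : ℤ_[p]) := by
        conv_lhs => rw [← hdec]
        simp
      have h1 : (p : ℤ_[p]) ^ n ∣ ((t : ℤ_[p]) - t0) * Q.eval (t : ℤ_[p]) := by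
        have := dvd_sub (hdiv t htT) (hdiv t0 ht0)
        rw [he] at this; simpa using this
      obtain ⟨c, hc⟩ := natCast_sub_dvd_pow (p := p) (hL t htT) (hL t0 ht0) hne
      have h2 : (p : ℤ_[p]) ^ n ∣ (p : ℤ_[p]) ^ L * Q.eval (t : ℤ_[p]) := by
        rw [hc]
        calc _ ∣ _ := h1
          _ ∣ _ := ⟨c, by ring⟩
      have h3 : (p : ℤ_[p]) ^ n = (p : ℤ_[p]) ^ L * (p : ℤ_[p]) ^ (n - L) := by
        rw [← pow_add]; congr 1; omega
      rw [h3] at h2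
      exact (mul_dvd_mul_iff_left (pow_ne_zero _ PadicInt.prime_p.ne_zero)).1 h2
    · rw [Nat.succ_mul] at hn; omega

end padic_part

section ring_part

open scoped Pointwise

set_option linter.unusedSectionVars false

variable {p : ℕ} [Fact p.Prime] {R : Type} [CommRing R] [IsLocalRing R]
    [Algebra ℤ_[p] R] [Module.Finite ℤ_[p] R]

theorem p_pow_ne_zero (hinj : Function.Injective (algebraMap ℤ_[p] R)) (k : ℕ) :
    (p : R) ^ k ≠ 0 := by
  intro h
  have : algebraMap ℤ_[p] R ((p : ℤ_[p]) ^ k) = algebraMap ℤ_[p] R 0 := by simpa using h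
  exact pow_ne_zero _ PadicInt.prime_p.ne_zero (hinj this)

theorem p_mem (hinj : Function.Injective (algebraMap ℤ_[p] R)) : (p : R) ∈ maximalIdeal R := by
  rw [mem_maximalIdeal, mem_nonunits_iff]
  intro hu
  have hint : (algebraMap ℤ_[p] R).IsIntegral := algebraMap_isIntegral_iff.2 inferInstance
  have := hint.isLocalHom hinj
  have h2 : IsUnit (algebraMap ℤ_[p] R (p : ℤ_[p])) := by simpa using hu
  exact PadicInt.prime_p.not_isUnit (isUnit_of_map_unit _ _ h2)

theorem nak {V : Type} [AddCommGroup V] [Module R V] (hp : (p : R) ∈ maximalIdeal R)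
    {A L : Submodule R V} (hA : A.FG) (h : A ≤ L ⊔ (p : R) • A) : A ≤ L := by
  apply Submodule.le_of_le_smul_of_le_jacobson_bot (I := maximalIdeal R) hA
    (by rw [jacobson_eq_maximalIdeal]; exact bot_ne_top)
  refine h.trans (sup_le_sup_left ?_ _)
  intro x hx
  obtain ⟨y, hy, rfl⟩ := hx
  exact Submodule.smul_mem_smul hp hy

variable (p R) in
/-- The module `(R/p^n)^N`, presented as a quotient of `R^N`. -/
abbrev EE (N n : ℕ) : Type := (Fin N → R) ⧸ ((p : R) ^ n • (⊤ : Submodule R (Fin N → R)))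

theorem finite_EE (N n : ℕ) : Finite (EE p R N n) := by
  let I : Ideal ℤ_[p] := Ideal.span {(p : ℤ_[p]) ^ n}
  have hfI : Finite (ℤ_[p] ⧸ I) := by
    have : Function.Injective (RingHom.kerLift (PadicInt.toZModPow (p := p) n)) := RingHom.kerLift_injective _
    have : NeZero (p ^ n) := ⟨pow_ne_zero _ (Fact.out : p.Prime).ne_zero⟩
    have h3 : Finite (ℤ_[p] ⧸ RingHom.ker (PadicInt.toZModPow (p := p) n)) := Finite.of_injective _ ‹_›
    rwa [PadicInt.ker_toZModPow] at h3
  have h1 : Finite ((Fin N → R) ⧸ (I • (⊤ : Submodule ℤ_[p] (Fin N → R)))) := by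
    have : Module.Finite (ℤ_[p] ⧸ I) ((Fin N → R) ⧸ (I • (⊤ : Submodule ℤ_[p] (Fin N → R)))) :=
      Module.Finite.of_restrictScalars_finite ℤ_[p] _ _
    exact Module.finite_of_finite (ℤ_[p] ⧸ I)
  let f : ((Fin N → R) ⧸ (I • (⊤ : Submodule ℤ_[p] (Fin N → R)))) → EE p R N n :=
    Quotient.map' id (by
      intro a b hab
      rw [Submodule.quotientRel_def] at hab ⊢
      rw [Submodule.ideal_span_singleton_smul] at hab
      obtain ⟨y, -, hy⟩ := hab
      refine ⟨y, trivial, ?_⟩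
      change (p : R) ^ n • y = id a - id b
      change (p : ℤ_[p]) ^ n • y = a - b at hy
      rw [id, id, ← hy, ← algebraMap_smul R ((p : ℤ_[p]) ^ n) y]
      simp)
  exact Finite.of_surjective f (by
    intro x
    obtain ⟨y, rfl⟩ := Submodule.Quotient.mk_surjective _ x
    exact ⟨Submodule.Quotient.mk y, rfl⟩)

theorem smul_top_succ (N n : ℕ) : (p : R) ^ (n + 1) • (⊤ : Submodule R (Fin N → R)) =
    (p : R) • ((p : R) ^ n • (⊤ : Submodule R (Fin N → R))) := by
  rw [pow_succ', mul_smul]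

theorem fg_of_finite (p : ℕ) [Fact p.Prime] {R : Type} [CommRing R]
    [Algebra ℤ_[p] R] [Module.Finite ℤ_[p] R] {V : Type} [AddCommGroup V] [Module R V]
    [Module.Finite R V] (A : Submodule R V) : A.FG := by
  have : IsNoetherianRing R := IsNoetherianRing.of_finite ℤ_[p] R
  exact IsNoetherian.noetherian A

end ring_part

section struct_part

open scoped Pointwise

set_option linter.unusedSectionVars false

variable {p : ℕ} [Fact p.Prime] {R : Type} [CommRing R] [IsLocalRing R]
    [Algebra ℤ_[p] R] [Module.Finite ℤ_[p] R]

theorem smul_mono' {V : Type} [AddCommGroup V] [Module R V] (a : R) {A B : Submodule R V}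
    (h : A ≤ B) : a • A ≤ a • B := by
  rintro _ ⟨y, hy, rfl⟩
  exact ⟨y, h hy, rfl⟩

/-- fewer than `N` elements cannot span a submodule containing `p^n R^N` -/
theorem not_few_gens (hinj : Function.Injective (algebraMap ℤ_[p] R)) {N n : ℕ}
    (h : Fin N → (Fin (N + 1) → R))
    (hs : (p : R) ^ n • (⊤ : Submodule R (Fin (N + 1) → R)) ≤ Submodule.span R (Set.range h)) :
    False := by
  have hB : ∀ j : Fin (N + 1), ∃ b : Fin N → R,
      ∑ i, b i • h i = (p : R) ^ n • (Pi.single j 1 : Fin (N + 1) → R) := by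
    intro j
    have : (p : R) ^ n • (Pi.single j 1 : Fin (N + 1) → R) ∈ Submodule.span R (Set.range h) :=
      hs ⟨_, trivial, rfl⟩
    exact (Submodule.mem_span_range_iff_exists_fun R).1 this
  choose b hb using hB
  let B : Matrix (Fin (N + 1)) (Fin (N + 1)) R := fun j => Fin.cons 0 (b j)
  let A : Matrix (Fin (N + 1)) (Fin (N + 1)) R := Fin.cons 0 h
  have hBA : B * A = (p : R) ^ n • (1 : Matrix (Fin (N + 1)) (Fin (N + 1)) R) := by
    ext j l
    rw [Matrix.mul_apply, Fin.sum_univ_succ]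
    have := congrFun (hb j) l
    simp only [Finset.sum_apply, Pi.smul_apply, smul_eq_mul] at this
    simp only [A, B, Fin.cons_zero, Fin.cons_succ, Pi.zero_apply, mul_zero, zero_add,
      Matrix.smul_apply, smul_eq_mul]
    rw [this, Matrix.one_apply, Pi.single_apply]
    simp only [eq_comm]
  have hA : A.det = 0 := Matrix.det_eq_zero_of_row_eq_zero 0 (by intro j; simp [A])
  have hdet := congrArg Matrix.det hBA
  rw [Matrix.det_mul, hA, mul_zero, Matrix.det_smul, Matrix.det_one, mul_one, ← pow_mul] at hdet
  exact p_pow_ne_zero hinj _ hdet.symm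

theorem comap_span {V : Type} [AddCommGroup V] [Module R V] (S : Submodule R V) {N : ℕ}
    (h : Fin N → V) : (Submodule.span R (Set.range (fun i => S.mkQ (h i)))).comap S.mkQ =
      Submodule.span R (Set.range h) ⊔ S := by
  have : Set.range (fun i => S.mkQ (h i)) = S.mkQ '' Set.range h := by
    rw [← Set.range_comp]; rfl
  rw [this, ← Submodule.map_span, Submodule.comap_map_mkQ, sup_comm]

theorem finrank_K (hinj : Function.Injective (algebraMap ℤ_[p] R)) {N n : ℕ}
    (K : Submodule R (EE p R N (n + 1))) (hK : (p : R) ^ n • ⊤ ≤ K) (g : Fin N → K)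
    (hg : Submodule.span R (Set.range g) = ⊤) :
    Module.finrank (ResidueField R) (ResidueField R ⊗[R] K) = N := by
  have := finite_EE (p := p) (R := R) N (n + 1)
  have : Module.Finite R K := Module.Finite.of_finite
  have hp := p_mem hinj
  apply le_antisymm (finrank_le_of_gens g hg)
  by_contra hlt
  rw [not_le] at hlt
  obtain ⟨N, rfl⟩ : ∃ N', N = N' + 1 := ⟨N - 1, by omega⟩
  obtain ⟨h, hh⟩ := exists_gens (R := R) (K := K) (r := N) (by omega)
  set S := ((p : R) ^ (n + 1) • (⊤ : Submodule R (Fin (N + 1) → R))) with hS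
  let h' : Fin N → (Fin (N + 1) → R) := fun i => Function.surjInv (Submodule.mkQ_surjective S) (h i)
  have hh' : (fun i => S.mkQ (h' i)) = fun i => (h i : EE p R (N + 1) (n + 1)) :=
    funext fun i => Function.surjInv_eq (Submodule.mkQ_surjective S) _
  have h1 : Submodule.span R (Set.range (fun i => (h i : EE p R (N + 1) (n + 1)))) = K := by
    have h2 := congrArg (Submodule.map K.subtype) hh
    rw [Submodule.map_span, Submodule.map_top, Submodule.range_subtype, ← Set.range_comp] at h2
    exact h2
  have h3 := comap_span S h'
  rw [hh', h1] at h3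
  have h4 : (p : R) ^ n • (⊤ : Submodule R (Fin (N + 1) → R)) ≤ K.comap S.mkQ := by
    rintro _ ⟨y, -, rfl⟩
    exact hK ⟨S.mkQ y, trivial, rfl⟩
  have h5 : K.comap S.mkQ ≤ Submodule.span R (Set.range h') := by
    apply nak hp (fg_of_finite p _)
    conv_lhs => rw [h3]
    apply sup_le_sup_left
    refine hS.le.trans ?_
    rw [smul_top_succ]
    exact smul_mono' _ h4
  exact not_few_gens hinj h' (h4.trans h5)

theorem lift_good (hinj : Function.Injective (algebraMap ℤ_[p] R)) {N n : ℕ} (hN : 0 < N)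
    (g : Fin N → EE p R N (n + 1))
    (hg : (p : R) ^ n • ⊤ ≤ Submodule.span R (Set.range g)) :
    OccursAsCokernel R (EE p R N (n + 1) ⧸ Submodule.span R (Set.range g)) := by
  have hp := p_mem hinj
  set S := ((p : R) ^ (n + 1) • (⊤ : Submodule R (Fin N → R))) with hS
  let h' : Fin N → (Fin N → R) := fun i => Function.surjInv (Submodule.mkQ_surjective S) (g i)
  have hh' : (fun i => S.mkQ (h' i)) = g :=
    funext fun i => Function.surjInv_eq (Submodule.mkQ_surjective S) _
  have h3 := comap_span S h'
  rw [hh'] at h3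
  have h4 : (p : R) ^ n • (⊤ : Submodule R (Fin N → R)) ≤ Submodule.span R (Set.range h') := by
    apply nak hp (fg_of_finite p _)
    rw [← smul_top_succ, ← hS, ← h3]
    rintro _ ⟨y, -, rfl⟩
    exact hg ⟨S.mkQ y, trivial, rfl⟩
  have h5 : S ≤ Submodule.span R (Set.range h') := by
    rw [hS, pow_succ, mul_smul]
    exact (smul_mono' _ le_top).trans h4
  have h6 : (Submodule.span R (Set.range h')).map S.mkQ = Submodule.span R (Set.range g) := by
    rw [Submodule.map_span, ← Set.range_comp, ← hh']; rfl
  refine ⟨N, hN, Fintype.linearCombination R h', ?_⟩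
  rw [Fintype.range_linearCombination]
  have e := Submodule.quotientQuotientEquivQuotient S _ h5
  rw [h6] at e
  exact ⟨e.symm⟩

theorem schanuel {M : Type} [AddCommGroup M] [Module R M]
    (hM : OccursAsCokernel R M) {N : ℕ} (φ : (Fin N → R) →ₗ[R] M) (hφ : Function.Surjective φ)
    (hfg : Module.Finite R (LinearMap.ker φ)) :
    ∃ g : Fin N → LinearMap.ker φ, Submodule.span R (Set.range g) = ⊤ := by
  obtain ⟨N0, -, G, ⟨e⟩⟩ := hM
  let ψ : (Fin N0 → R) →ₗ[R] M := e.toLinearMap ∘ₗ (LinearMap.range G).mkQ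
  have hψ : Function.Surjective ψ := e.surjective.comp (Submodule.mkQ_surjective _)
  have hψG : ∀ x, ψ x = 0 → ∃ y, G y = x := by
    intro x hx
    have : (LinearMap.range G).mkQ x = 0 := e.injective (by rw [map_zero]; exact hx)
    rw [Submodule.mkQ_apply, Submodule.Quotient.mk_eq_zero] at this
    exact this
  have hGψ : ∀ y, ψ (G y) = 0 := by
    intro y
    have : (LinearMap.range G).mkQ (G y) = 0 := by
      rw [Submodule.mkQ_apply, Submodule.Quotient.mk_eq_zero]; exact ⟨y, rfl⟩
    change e _ = 0
    rw [this, map_zero]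
  obtain ⟨α, hα⟩ := Module.projective_lifting_property φ ψ hφ
  obtain ⟨β, hβ⟩ := Module.projective_lifting_property ψ φ hψ
  have hα' : ∀ x, φ (α x) = ψ x := fun x => LinearMap.congr_fun hα x
  have hβ' : ∀ x, ψ (β x) = φ x := fun x => LinearMap.congr_fun hβ x
  let Φ1 : (Fin N0 → R) × (Fin N → R) →ₗ[R] (Fin N0 → R) := G.coprod β
  let Φ2 : (Fin N0 → R) × (Fin N → R) →ₗ[R] LinearMap.ker φ :=
    LinearMap.codRestrict _ (LinearMap.snd R _ _ - α ∘ₗ Φ1) (by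
      intro x
      simp [Φ1, hα', hβ', hGψ])
  let Φ := Φ2.prod Φ1
  have hΦ : Function.Surjective Φ := by
    rintro ⟨⟨κ, hκ⟩, y⟩
    have hκ' : φ κ = 0 := hκ
    obtain ⟨z, hz⟩ := hψG (y - β (κ + α y)) (by
      rw [map_sub, hβ', map_add, hκ', hα', zero_add, sub_self])
    refine ⟨(z, κ + α y), ?_⟩
    have h1 : Φ1 (z, κ + α y) = y := by simp [Φ1, hz]
    ext1
    · apply Subtype.ext
      change (κ + α y) - α (Φ1 (z, κ + α y)) = κ
      rw [h1, add_sub_cancel_right]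
    · exact h1
  have hT : Function.Surjective (Φ.baseChange (ResidueField R)) :=
    LinearMap.lTensor_surjective _ hΦ
  have hle := LinearMap.finrank_le_finrank_of_surjective hT
  have h1 : Module.finrank (ResidueField R) (ResidueField R ⊗[R] ((Fin N0 → R) × (Fin N → R)))
      = N0 + N := by
    rw [Module.finrank_baseChange]; simp
  have h2 : Module.finrank (ResidueField R) (ResidueField R ⊗[R] (LinearMap.ker φ × (Fin N0 → R)))
      = Module.finrank (ResidueField R) (ResidueField R ⊗[R] (LinearMap.ker φ)) + N0 := by
    rw [(TensorProduct.prodRight R (ResidueField R) (ResidueField R) (LinearMap.ker φ)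
      (Fin N0 → R)).finrank_eq, Module.finrank_prod,
      Module.finrank_baseChange (R := ResidueField R) (S := R) (M' := Fin N0 → R)]
    simp
  exact exists_gens (by omega)

theorem exists_poly {N : ℕ} (n : ℕ) (g : Fin N → (Fin N → R)) :
    ∃ F : Polynomial ℤ_[p], F.Monic ∧
      F.natDegree = (⊤ : Submodule ℤ_[p] (Fin N → R)).spanFinrank ∧
      ∀ t : ℕ, ¬ ((p : R) ^ n • (⊤ : Submodule R (Fin N → R)) ≤
        Submodule.span R (Set.range (fun i => g i - (t : R) • (Pi.single i 1 : Fin N → R)))) →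
        (p : ℤ_[p]) ^ (n + 1) ∣ F.eval (t : ℤ_[p]) := by
  let G : (Fin N → R) →ₗ[R] (Fin N → R) := Fintype.linearCombination R g
  let G' : Module.End ℤ_[p] (Fin N → R) := G.restrictScalars ℤ_[p]
  obtain ⟨F, hF, hd, h0⟩ := LinearMap.exists_monic_and_natDegree_eq_and_aeval_eq_zero ℤ_[p] G'
  refine ⟨F, hF, hd, fun t ht => ?_⟩
  by_contra hdiv
  obtain ⟨c, hc⟩ := padic_dvd_pow hdiv
  apply ht
  rintro _ ⟨y, -, rfl⟩
  have hdec := Polynomial.modByMonic_add_div F (Polynomial.X - Polynomial.C (t : ℤ_[p]))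
  rw [Polynomial.modByMonic_X_sub_C_eq_C_eval] at hdec
  rw [← hdec] at h0
  have h1 := LinearMap.congr_fun h0 y
  simp only [map_add, map_mul, map_sub, Polynomial.aeval_X, Polynomial.aeval_C, LinearMap.add_apply,
    Module.End.mul_apply, LinearMap.sub_apply, Module.algebraMap_end_apply, LinearMap.zero_apply] at h1
  set z := (Polynomial.aeval G' (F /ₘ (Polynomial.X - Polynomial.C (t : ℤ_[p])))) y
  have h2 : ∀ x : Fin N → R, G' x - (t : ℤ_[p]) • x ∈
      Submodule.span R (Set.range (fun i => g i - (t : R) • (Pi.single i 1 : Fin N → R))) := by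
    intro x
    rw [← Fintype.range_linearCombination]
    refine ⟨x, ?_⟩
    rw [Fintype.linearCombination_apply]
    simp only [smul_sub, Finset.sum_sub_distrib]
    congr 1
    rw [← algebraMap_smul R (t : ℤ_[p]) x, map_natCast]
    simp only [smul_comm _ (t : R)]
    rw [← Finset.smul_sum]
    congr 1
    ext j
    simp [Pi.single_apply]
  have h3 : (p : R) ^ n • y = (algebraMap ℤ_[p] R c) • (F.eval (t : ℤ_[p]) • y) := by
    rw [← algebraMap_smul R (F.eval (t : ℤ_[p])) y, smul_smul, ← map_mul, mul_comm, ← hc]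
    simp
  change (p : R) ^ n • y ∈ _
  rw [h3]
  apply Submodule.smul_mem
  rw [eq_neg_of_add_eq_zero_left h1]
  exact Submodule.neg_mem _ (h2 _)

end struct_part

section count_part

/-- number of generating `N`-tuples -/
noncomputable def gam (R : Type) [CommRing R] (N : ℕ) (M : Type) [AddCommGroup M] [Module R M] : ℕ :=
  Nat.card {g : Fin N → M // Submodule.span R (Set.range g) = ⊤}

theorem card_swap {A B : Type*} [Fintype A] [Fintype B] (P : A → B → Prop) :
    ∑ a, Nat.card {b // P a b} = ∑ b, Nat.card {a // P a b} := by
  rw [← Nat.card_sigma, ← Nat.card_sigma]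
  exact Nat.card_congr
    { toFun := fun x => ⟨x.2.1, x.1, x.2.2⟩
      invFun := fun x => ⟨x.2.1, x.1, x.2.2⟩
      left_inv := fun _ => rfl
      right_inv := fun _ => rfl }

variable {R : Type} [CommRing R]
variable {E : Type} [AddCommGroup E] [Module R E] {M : Type} [AddCommGroup M] [Module R M]

theorem gam_le [Finite M] (N : ℕ) : gam R N M ≤ Nat.card M ^ N := by
  unfold gam
  calc _ ≤ Nat.card (Fin N → M) := Nat.card_le_card_of_injective _ Subtype.val_injective
    _ = _ := by rw [Nat.card_fun]; simp

theorem card_ker_mul [Finite E] [Finite M] (φ : E →ₗ[R] M) (hφ : Function.Surjective φ) :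
    Nat.card (LinearMap.ker φ) * Nat.card M = Nat.card E := by
  have := card_preimage_mul φ.toAddMonoidHom hφ (fun b => b = 0)
  simpa using this

theorem finite_hom [Finite E] [Finite M] : Finite (E →ₗ[R] M) :=
  Finite.of_injective (fun f : E →ₗ[R] M => (f : E → M)) DFunLike.coe_injective

theorem numSurj_quot (S : Submodule R E) :
    numSurj R (E ⧸ S) M =
      Nat.card {φ : {φ : E →ₗ[R] M // Function.Surjective φ} // S ≤ LinearMap.ker φ.1} := by
  unfold numSurj
  refine Nat.card_congr (Equiv.ofBijective (fun f => ⟨⟨f.1 ∘ₗ S.mkQ,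
    f.2.comp (Submodule.mkQ_surjective S)⟩, ?_⟩) ⟨?_, ?_⟩)
  · intro x hx
    rw [LinearMap.mem_ker, LinearMap.comp_apply, Submodule.mkQ_apply,
      (Submodule.Quotient.mk_eq_zero S).2 hx, map_zero]
  · intro f f' h
    simp only [Subtype.mk.injEq] at h
    apply Subtype.ext
    exact (LinearMap.cancel_right (Submodule.mkQ_surjective S)).1 h
  · rintro ⟨⟨φ, hφ⟩, hS⟩
    refine ⟨⟨S.liftQ φ hS, ?_⟩, ?_⟩
    · intro y
      obtain ⟨x, rfl⟩ := hφ y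
      exact ⟨S.mkQ x, by simp⟩
    · apply Subtype.ext; apply Subtype.ext
      exact Submodule.liftQ_mkQ S φ hS

theorem card_equiv_quot (S : Submodule R E) :
    Nat.card ((E ⧸ S) ≃ₗ[R] M) =
      Nat.card {φ : {φ : E →ₗ[R] M // Function.Surjective φ} // S = LinearMap.ker φ.1} := by
  refine Nat.card_congr (Equiv.ofBijective (fun f => ⟨⟨f.toLinearMap ∘ₗ S.mkQ,
    f.surjective.comp (Submodule.mkQ_surjective S)⟩, ?_⟩) ⟨?_, ?_⟩)
  · rw [LinearEquiv.ker_comp, Submodule.ker_mkQ]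
  · intro f f' h
    simp only [Subtype.mk.injEq] at h
    exact LinearEquiv.toLinearMap_injective ((LinearMap.cancel_right (Submodule.mkQ_surjective S)).1 h)
  · rintro ⟨⟨φ, hφ⟩, hS⟩
    refine ⟨LinearEquiv.ofBijective (S.liftQ φ hS.le) ⟨?_, ?_⟩, ?_⟩
    · rw [← LinearMap.ker_eq_bot, Submodule.ker_liftQ, ← hS, Submodule.mkQ_map_self]
    · intro y
      obtain ⟨x, rfl⟩ := hφ y
      exact ⟨S.mkQ x, by simp⟩
    · apply Subtype.ext; apply Subtype.ext
      exact Submodule.liftQ_mkQ S φ hS.le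

theorem card_equiv_aut {C : Type} [AddCommGroup C] [Module R C] (e : C ≃ₗ[R] M) :
    Nat.card (C ≃ₗ[R] M) = numAut R M :=
  Nat.card_congr
    { toFun := fun f => e.symm.trans f
      invFun := fun f => e.trans f
      left_inv := fun f => by ext; simp
      right_inv := fun f => by ext; simp }

theorem numAut_pos [Finite M] : 0 < numAut R M := by
  have : Finite (M ≃ₗ[R] M) :=
    Finite.of_injective (fun f : M ≃ₗ[R] M => (f : M → M)) DFunLike.coe_injective
  exact Nat.card_pos

theorem numSurj_congr {C : Type} [AddCommGroup C] [Module R C] {M₀ : Type} [AddCommGroup M₀]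
    [Module R M₀] (e : C ≃ₗ[R] M) : numSurj R C M₀ = numSurj R M M₀ :=
  Nat.card_congr
    { toFun := fun f => ⟨f.1 ∘ₗ e.symm.toLinearMap, f.2.comp e.symm.surjective⟩
      invFun := fun f => ⟨f.1 ∘ₗ e.toLinearMap, f.2.comp e.surjective⟩
      left_inv := fun f => by apply Subtype.ext; ext; simp
      right_inv := fun f => by apply Subtype.ext; ext; simp }

/-- first moment identity -/
theorem sum_numSurj [Finite E] [Finite M] (N : ℕ) [Fintype (Fin N → E)] :
    ((∑ g : Fin N → E, numSurj R (E ⧸ Submodule.span R (Set.range g)) M : ℕ) : ℝ) =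
      (numSurj R E M : ℝ) * ((Nat.card E : ℝ) / Nat.card M) ^ N := by
  have : Finite (E →ₗ[R] M) := finite_hom
  cases nonempty_fintype {φ : E →ₗ[R] M // Function.Surjective φ}
  simp_rw [numSurj_quot]
  rw [card_swap (fun (g : Fin N → E) (φ : {φ : E →ₗ[R] M // Function.Surjective φ}) =>
    Submodule.span R (Set.range g) ≤ LinearMap.ker φ.1)]
  have h : ∀ φ : {φ : E →ₗ[R] M // Function.Surjective φ},
      (Nat.card {g : Fin N → E // Submodule.span R (Set.range g) ≤ LinearMap.ker φ.1} : ℝ) =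
      ((Nat.card E : ℝ) / Nat.card M) ^ N := by
    intro φ
    have e : {g : Fin N → E // Submodule.span R (Set.range g) ≤ LinearMap.ker φ.1} ≃
        (Fin N → LinearMap.ker φ.1) :=
      { toFun := fun g i => ⟨g.1 i, g.2 (Submodule.subset_span ⟨i, rfl⟩)⟩
        invFun := fun g => ⟨fun i => g i, by
          rw [Submodule.span_le]; rintro _ ⟨i, rfl⟩; exact (g i).2⟩
        left_inv := fun _ => rfl
        right_inv := fun _ => rfl }
    rw [Nat.card_congr e, Nat.card_fun]
    have h0 : (Nat.card M : ℝ) ≠ 0 := by exact_mod_cast Nat.card_pos.ne'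
    have := card_ker_mul φ.1 φ.2
    rw [← this]; push_cast
    rw [mul_div_cancel_right₀ _ h0]; simp
  push_cast
  rw [Finset.sum_congr rfl (fun φ _ => h φ)]
  simp [numSurj]

theorem card_iso_mul [Finite E] [Finite M] (N : ℕ)
    [Fintype {φ : E →ₗ[R] M // Function.Surjective φ}] :
    Nat.card {g : Fin N → E // Nonempty ((E ⧸ Submodule.span R (Set.range g)) ≃ₗ[R] M)} *
      numAut R M = ∑ φ : {φ : E →ₗ[R] M // Function.Surjective φ},
        Nat.card {g : Fin N → E // Submodule.span R (Set.range g) = LinearMap.ker φ.1} := by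
  classical
  cases nonempty_fintype (Fin N → E)
  rw [← card_swap (fun (g : Fin N → E) (φ : {φ : E →ₗ[R] M // Function.Surjective φ}) =>
    Submodule.span R (Set.range g) = LinearMap.ker φ.1)]
  simp_rw [← card_equiv_quot]
  have h : ∀ g : Fin N → E, Nat.card ((E ⧸ Submodule.span R (Set.range g)) ≃ₗ[R] M) =
      if Nonempty ((E ⧸ Submodule.span R (Set.range g)) ≃ₗ[R] M) then numAut R M else 0 := by
    intro g
    split_ifs with hg
    · exact card_equiv_aut hg.some
    · rw [not_nonempty_iff] at hg; simp
  rw [Finset.sum_congr rfl (fun g _ => h g), ← Finset.sum_filter, Finset.sum_const, smul_eq_mul,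
    Nat.card_eq_fintype_card, Fintype.card_subtype]

theorem card_span_eq (N : ℕ) (K : Submodule R E) :
    Nat.card {g : Fin N → E // Submodule.span R (Set.range g) = K} = gam R N K := by
  have key : ∀ g : Fin N → K, Submodule.span R (Set.range g) = ⊤ ↔
      Submodule.span R (Set.range fun i => (g i : E)) = K := by
    intro g
    have h1 : Submodule.span R (Set.range fun i => (g i : E)) =
        (Submodule.span R (Set.range g)).map K.subtype := by
      rw [Submodule.map_span, ← Set.range_comp]; rfl
    rw [h1]
    constructor
    · intro h; rw [h, Submodule.map_top, Submodule.range_subtype]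
    · intro h
      apply Submodule.map_injective_of_injective K.injective_subtype
      rw [h, Submodule.map_top, Submodule.range_subtype]
  exact Nat.card_congr
    { toFun := fun g => ⟨fun i => ⟨g.1 i, g.2.le (Submodule.subset_span ⟨i, rfl⟩)⟩, (key _).2 g.2⟩
      invFun := fun g => ⟨fun i => g.1 i, (key _).1 g.2⟩
      left_inv := fun _ => rfl
      right_inv := fun _ => rfl }

theorem tendsto_gam [Finite M] :
    Filter.Tendsto (fun N => (gam R N M : ℝ) / (Nat.card M : ℝ) ^ N) Filter.atTop (nhds 1) := by
  classical
  have hfs : Finite (Submodule R M) := Finite.of_injective (fun S => (S : Set M)) SetLike.coe_injective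
  cases nonempty_fintype (Submodule R M)
  set A := Nat.card (Submodule R M)
  have hM : 0 < (Nat.card M : ℝ) := by exact_mod_cast Nat.card_pos
  have hlow : ∀ N, 1 - (A : ℝ) * (1 / 2) ^ N ≤ (gam R N M : ℝ) / (Nat.card M : ℝ) ^ N := by
    intro N
    cases nonempty_fintype (Fin N → M)
    have h1 : Nat.card (Fin N → M) ≤ gam R N M +
        ∑ H ∈ (Finset.univ : Finset (Submodule R M)).filter (· ≠ ⊤), Nat.card (Fin N → H) := by
      have hg : gam R N M = (Finset.univ.filter
          (fun g : Fin N → M => Submodule.span R (Set.range g) = ⊤)).card := by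
        rw [gam, Nat.card_eq_fintype_card, Fintype.card_subtype]
      have hH : ∀ H : Submodule R M, (Finset.univ.filter
          (fun g : Fin N → M => ∀ i, g i ∈ H)).card = Nat.card (Fin N → H) := by
        intro H
        rw [← Fintype.card_subtype, ← Nat.card_eq_fintype_card]
        exact Nat.card_congr (Equiv.subtypePiEquivPi)
      rw [hg, Nat.card_eq_fintype_card, ← Finset.card_univ, ← Finset.sum_congr rfl (fun H _ => hH H)]
      refine le_trans (Finset.card_le_card ?_) ((Finset.card_union_le _ _).trans
        (Nat.add_le_add_left Finset.card_biUnion_le _))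
      intro g _
      rw [Finset.mem_union, Finset.mem_filter, Finset.mem_biUnion]
      by_cases h : Submodule.span R (Set.range g) = ⊤
      · left; exact ⟨Finset.mem_univ _, h⟩
      · right
        exact ⟨Submodule.span R (Set.range g), by simp [h], by
          simp only [Finset.mem_filter, Finset.mem_univ, true_and]
          exact fun i => Submodule.subset_span ⟨i, rfl⟩⟩
    have h2 : ∀ H ∈ (Finset.univ : Finset (Submodule R M)).filter (· ≠ ⊤),
        (Nat.card (Fin N → H) : ℝ) ≤ ((Nat.card M : ℝ) / 2) ^ N := by
      intro H hH
      have hne : H ≠ ⊤ := (Finset.mem_filter.1 hH).2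
      rw [Nat.card_fun]
      push_cast
      simp only [Nat.card_eq_fintype_card, Fintype.card_fin]
      apply pow_le_pow_left₀ (by positivity)
      have hc := Submodule.card_eq_card_quotient_mul_card H
      have : Nontrivial (M ⧸ H) := Submodule.Quotient.nontrivial_iff.2 hne
      have : Finite (M ⧸ H) := Finite.of_surjective _ (Submodule.mkQ_surjective H)
      have h3 : 1 < Nat.card (M ⧸ H) := Finite.one_lt_card
      have h4 : 2 * Nat.card H ≤ Nat.card M := by rw [hc]; nlinarith [Nat.card_pos (α := H)]
      rw [le_div_iff₀ (by norm_num), mul_comm]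
      exact_mod_cast h4
    have h3 : ((Nat.card M : ℝ)) ^ N ≤ gam R N M + A * ((Nat.card M : ℝ) / 2) ^ N := by
      have h1' : ((Nat.card (Fin N → M) : ℕ) : ℝ) ≤ gam R N M +
        ∑ H ∈ (Finset.univ : Finset (Submodule R M)).filter (· ≠ ⊤), (Nat.card (Fin N → H) : ℝ) := by
        exact_mod_cast h1
      have h5 := Finset.sum_le_card_nsmul _ _ _ h2
      rw [Nat.card_fun] at h1'
      push_cast at h1'
      simp only [Nat.card_eq_fintype_card (α := Fin N), Fintype.card_fin] at h1'
      refine h1'.trans (add_le_add le_rfl (h5.trans ?_))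
      rw [nsmul_eq_mul]
      apply mul_le_mul_of_nonneg_right _ (by positivity)
      have : (Finset.filter (· ≠ ⊤) (Finset.univ : Finset (Submodule R M))).card ≤ A := by
        refine (Finset.card_filter_le _ _).trans ?_
        simp [A]
      exact_mod_cast this
    rw [le_div_iff₀ (by positivity), sub_mul, one_mul, mul_assoc, ← mul_pow]
    have : (1 / 2 * (Nat.card M : ℝ)) = Nat.card M / 2 := by ring
    rw [this]; linarith
  have hup : ∀ N, (gam R N M : ℝ) / (Nat.card M : ℝ) ^ N ≤ 1 := by
    intro N
    rw [div_le_one (by positivity)]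
    exact_mod_cast gam_le N
  refine tendsto_of_tendsto_of_tendsto_of_le_of_le ?_ tendsto_const_nhds hlow hup
  have := (tendsto_pow_atTop_nhds_zero_of_lt_one (r := (1 / 2 : ℝ)) (by norm_num) (by norm_num)).const_mul (A : ℝ)
  simpa using this.const_sub 1

end count_part

section main_part

open scoped Pointwise

set_option linter.unusedSectionVars false

/-- partial products of `c_R` -/
noncomputable def cN (R : Type) [CommRing R] [IsLocalRing R] (N : ℕ) : ℝ :=
  ∏ i ∈ Finset.range N, (1 - ((Nat.card (ResidueField R) : ℝ))⁻¹ ^ (i + 1))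

theorem cN_facts (R : Type) [CommRing R] [IsLocalRing R] [Finite (ResidueField R)] :
    (∀ N, 0 < cN R N) ∧ 0 < cConst R ∧
      Filter.Tendsto (cN R) Filter.atTop (nhds (cConst R)) := by
  have hq1 : (1 : ℝ) < Nat.card (ResidueField R) := by exact_mod_cast Finite.one_lt_card
  set r := ((Nat.card (ResidueField R) : ℝ))⁻¹ with hr
  have hr0 : 0 < r := by positivity
  have hr1 : r < 1 := inv_lt_one_of_one_lt₀ hq1
  have hf : ∀ i : ℕ, 0 < 1 - r ^ (i + 1) := fun i => by
    exact sub_pos.2 (pow_lt_one₀ hr0.le hr1 (Nat.succ_ne_zero i))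
  have hs : Summable (fun i : ℕ => r ^ (i + 1)) :=
    (summable_nat_add_iff 1).2 (summable_geometric_of_lt_one hr0.le hr1)
  have hsn : Summable (fun i : ℕ => ‖-(r ^ (i + 1))‖) := by
    simpa [abs_of_pos hr0] using hs
  have hpos : ∀ N, 0 < cN R N := fun N => Finset.prod_pos (fun i _ => hf i)
  have hm : Multipliable (fun i : ℕ => 1 - r ^ (i + 1)) := by
    simpa [sub_eq_add_neg] using multipliable_one_add_of_summable hsn
  have ht : Filter.Tendsto (cN R) Filter.atTop (nhds (cConst R)) := hm.hasProd.tendsto_prod_nat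
  have hne : cConst R ≠ 0 := by
    have := tprod_one_add_ne_zero_of_summable (f := fun i : ℕ => -(r ^ (i + 1)))
      (fun i => by rw [← sub_eq_add_neg]; exact (hf i).ne') hsn
    simpa [sub_eq_add_neg, cConst, hr] using this
  exact ⟨hpos, lt_of_le_of_ne (ge_of_tendsto' ht (fun N => (hpos N).le)) hne.symm, ht⟩

variable {p : ℕ} [Fact p.Prime] {R : Type} [CommRing R] [IsLocalRing R]
    [Algebra ℤ_[p] R] [Module.Finite ℤ_[p] R]

theorem exists_kill (p : ℕ) [Fact p.Prime] (R : Type) [CommRing R] [Algebra ℤ_[p] R]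
    (M : Type) [AddCommGroup M] [Module R M] [Finite M] :
    ∃ n : ℕ, ∀ x : M, (p : R) ^ n • x = 0 := by
  have hc : Nat.card M ≠ 0 := Nat.card_pos.ne'
  obtain ⟨c, hc⟩ := natCast_sub_dvd_pow (p := p) (s := Nat.card M) (t := 0) (L := Nat.card M + 1)
    (by omega) (by omega) hc
  refine ⟨Nat.card M + 1, fun x => ?_⟩
  have h := congrArg (algebraMap ℤ_[p] R) hc
  simp only [map_pow, map_mul, map_natCast, Nat.cast_zero, sub_zero] at h
  rw [h, mul_comm, mul_smul, Nat.cast_smul_eq_nsmul, card_nsmul_eq_zero', smul_zero]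

theorem kill_mono {M : Type} [AddCommGroup M] [Module R M] {n m : ℕ} (hnm : n ≤ m)
    (h : ∀ x : M, (p : R) ^ n • x = 0) (x : M) : (p : R) ^ m • x = 0 := by
  obtain ⟨k, rfl⟩ := Nat.exists_eq_add_of_le hnm
  rw [add_comm, pow_add, mul_smul, h, smul_zero]

theorem numSurj_EE {M : Type} [AddCommGroup M] [Module R M] {N n : ℕ}
    (h : ∀ x : M, (p : R) ^ n • x = 0) : numSurj R (EE p R N n) M = gam R N M := by
  set S := ((p : R) ^ n • (⊤ : Submodule R (Fin N → R))) with hS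
  have h1 : ∀ φ : (Fin N → R) →ₗ[R] M, S ≤ LinearMap.ker φ := by
    rintro φ _ ⟨y, -, rfl⟩
    change φ ((p : R) ^ n • y) = 0
    rw [map_smul, h]
  rw [numSurj_quot]
  have e1 : {φ : {φ : (Fin N → R) →ₗ[R] M // Function.Surjective φ} // S ≤ LinearMap.ker φ.1} ≃
      {φ : (Fin N → R) →ₗ[R] M // Function.Surjective φ} :=
    Equiv.subtypeUnivEquiv (fun φ => h1 φ.1)
  rw [Nat.card_congr e1, gam]
  refine Nat.card_congr (Equiv.symm (Equiv.ofBijective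
    (fun g => ⟨Fintype.linearCombination R g.1, ?_⟩) ⟨?_, ?_⟩))
  · rw [← LinearMap.range_eq_top, Fintype.range_linearCombination]; exact g.2
  · intro g g' hgg
    simp only [Subtype.mk.injEq] at hgg
    apply Subtype.ext; funext i
    have := LinearMap.congr_fun hgg (Pi.single i 1)
    simpa [Fintype.linearCombination_apply_single] using this
  · rintro ⟨φ, hφ⟩
    have hh : Fintype.linearCombination R (fun i => φ (Pi.single i 1)) = φ := by
      apply LinearMap.pi_ext'
      intro i
      ext
      simp [Fintype.linearCombination_apply_single]
    refine ⟨⟨fun i => φ (Pi.single i 1), ?_⟩, ?_⟩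
    · rw [← Fintype.range_linearCombination, hh, LinearMap.range_eq_top]; exact hφ
    · exact Subtype.ext hh

theorem gam_eq [Finite (ResidueField R)] (hinj : Function.Injective (algebraMap ℤ_[p] R)) {N n : ℕ}
    (K : Submodule R (EE p R N (n + 1))) (hK : (p : R) ^ n • ⊤ ≤ K)
    (h : ∃ g : Fin N → K, Submodule.span R (Set.range g) = ⊤) :
    (gam R N K : ℝ) = (Nat.card K : ℝ) ^ N * cN R N := by
  have := finite_EE (p := p) (R := R) N (n + 1)
  obtain ⟨g, hg⟩ := h
  exact card_gens (finrank_K hinj K hK g hg)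

theorem gam_le' [Finite (ResidueField R)] (hinj : Function.Injective (algebraMap ℤ_[p] R)) {N n : ℕ}
    (K : Submodule R (EE p R N (n + 1))) (hK : (p : R) ^ n • ⊤ ≤ K) :
    (gam R N K : ℝ) ≤ (Nat.card K : ℝ) ^ N * cN R N := by
  by_cases h : ∃ g : Fin N → K, Submodule.span R (Set.range g) = ⊤
  · exact (gam_eq hinj K hK h).le
  · have : gam R N K = 0 := by
      rw [gam]
      have : IsEmpty {g : Fin N → K // Submodule.span R (Set.range g) = ⊤} :=
        ⟨fun g => h ⟨g.1, g.2⟩⟩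
      simp
    rw [this, Nat.cast_zero]
    have := (cN_facts R).1 N
    positivity

theorem ker_ge {M : Type} [AddCommGroup M] [Module R M] {N n k : ℕ}
    (h : ∀ x : M, (p : R) ^ n • x = 0) (φ : EE p R N k →ₗ[R] M) :
    (p : R) ^ n • ⊤ ≤ LinearMap.ker φ := by
  rintro _ ⟨y, -, rfl⟩
  change φ ((p : R) ^ n • y) = 0
  rw [map_smul, h]

theorem card_ker_eq {E M : Type} [AddCommGroup E] [Module R E] [AddCommGroup M] [Module R M]
    [Finite E] [Finite M] (φ : E →ₗ[R] M) (hφ : Function.Surjective φ) :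
    (Nat.card (LinearMap.ker φ) : ℝ) = (Nat.card E : ℝ) / Nat.card M := by
  have h0 : (Nat.card M : ℝ) ≠ 0 := by exact_mod_cast Nat.card_pos.ne'
  rw [eq_div_iff h0]
  exact_mod_cast card_ker_mul φ hφ

/-- number of tuples with cokernel isomorphic to `M` -/
noncomputable def BB (p : ℕ) (R : Type) [CommRing R] (N n : ℕ)
    (M : Type) [AddCommGroup M] [Module R M] : ℕ :=
  Nat.card {g : Fin N → EE p R N n //
    Nonempty ((EE p R N n ⧸ Submodule.span R (Set.range g)) ≃ₗ[R] M)}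

theorem BB_le [Finite (ResidueField R)] (hinj : Function.Injective (algebraMap ℤ_[p] R))
    {M : Type} [AddCommGroup M] [Module R M] [Finite M] {N n : ℕ}
    (h : ∀ x : M, (p : R) ^ n • x = 0) :
    (BB p R N (n + 1) M : ℝ) * numAut R M ≤ (Nat.card (EE p R N (n + 1)) : ℝ) ^ N * cN R N := by
  have := finite_EE (p := p) (R := R) N (n + 1)
  have : Finite (EE p R N (n + 1) →ₗ[R] M) := finite_hom
  cases nonempty_fintype {φ : EE p R N (n + 1) →ₗ[R] M // Function.Surjective φ}
  have h1 := congrArg (Nat.cast : ℕ → ℝ) (card_iso_mul (R := R) (E := EE p R N (n + 1)) (M := M) N)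
  push_cast at h1
  rw [BB, h1]
  have hM : 0 < (Nat.card M : ℝ) := by exact_mod_cast Nat.card_pos
  have hc := (cN_facts R).1 N
  have h2 : ∀ φ ∈ (Finset.univ : Finset {φ : EE p R N (n + 1) →ₗ[R] M // Function.Surjective φ}),
      (Nat.card {g : Fin N → EE p R N (n + 1) // Submodule.span R (Set.range g) =
        LinearMap.ker φ.1} : ℝ) ≤
      ((Nat.card (EE p R N (n + 1)) : ℝ) / Nat.card M) ^ N * cN R N := by
    intro φ _
    rw [card_span_eq, ← card_ker_eq φ.1 φ.2]
    exact gam_le' hinj _ (ker_ge h φ.1)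
  refine (Finset.sum_le_card_nsmul _ _ _ h2).trans ?_
  have h3 : (Finset.univ : Finset {φ : EE p R N (n + 1) →ₗ[R] M // Function.Surjective φ}).card
      = gam R N M := by
    rw [← numSurj_EE (kill_mono (Nat.le_succ n) h), numSurj]; simp
  rw [h3, nsmul_eq_mul, ← mul_assoc]
  apply mul_le_mul_of_nonneg_right _ hc.le
  have h4 : (gam R N M : ℝ) ≤ (Nat.card M : ℝ) ^ N := by exact_mod_cast gam_le N
  rw [div_pow, ← mul_div_assoc, div_le_iff₀ (by positivity), mul_comm]
  exact mul_le_mul_of_nonneg_left h4 (by positivity)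

theorem BB_eq [Finite (ResidueField R)] (hinj : Function.Injective (algebraMap ℤ_[p] R))
    {M : Type} [AddCommGroup M] [Module R M] [Finite M] {N n : ℕ}
    (hM : OccursAsCokernel R M)
    (h : ∀ x : M, (p : R) ^ n • x = 0) :
    (BB p R N (n + 1) M : ℝ) * numAut R M =
      (gam R N M : ℝ) / (Nat.card M : ℝ) ^ N * (Nat.card (EE p R N (n + 1)) : ℝ) ^ N * cN R N := by
  have := finite_EE (p := p) (R := R) N (n + 1)
  have : Finite (EE p R N (n + 1) →ₗ[R] M) := finite_hom
  cases nonempty_fintype {φ : EE p R N (n + 1) →ₗ[R] M // Function.Surjective φ}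
  have h1 := congrArg (Nat.cast : ℕ → ℝ) (card_iso_mul (R := R) (E := EE p R N (n + 1)) (M := M) N)
  push_cast at h1
  rw [BB, h1]
  have h2 : ∀ φ ∈ (Finset.univ : Finset {φ : EE p R N (n + 1) →ₗ[R] M // Function.Surjective φ}),
      (Nat.card {g : Fin N → EE p R N (n + 1) // Submodule.span R (Set.range g) =
        LinearMap.ker φ.1} : ℝ) =
      ((Nat.card (EE p R N (n + 1)) : ℝ) / Nat.card M) ^ N * cN R N := by
    intro φ _
    rw [card_span_eq, ← card_ker_eq φ.1 φ.2]
    refine gam_eq hinj _ (ker_ge h φ.1) ?_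
    let S := ((p : R) ^ (n + 1) • (⊤ : Submodule R (Fin N → R)))
    have hs : Function.Surjective (φ.1 ∘ₗ S.mkQ) := φ.2.comp (Submodule.mkQ_surjective S)
    obtain ⟨g, hg⟩ := schanuel hM (φ.1 ∘ₗ S.mkQ) hs (Module.Finite.iff_fg.2 (fg_of_finite p _))
    let f : LinearMap.ker (φ.1 ∘ₗ S.mkQ) →ₗ[R] LinearMap.ker φ.1 :=
      S.mkQ.restrict (fun x hx => hx)
    have hf : Function.Surjective f := by
      rintro ⟨y, hy⟩
      obtain ⟨x, rfl⟩ := Submodule.mkQ_surjective S y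
      exact ⟨⟨x, hy⟩, rfl⟩
    refine ⟨fun i => f (g i), ?_⟩
    have h5 := congrArg (Submodule.map f) hg
    rw [Submodule.map_span, Submodule.map_top, LinearMap.range_eq_top.2 hf, ← Set.range_comp] at h5
    exact h5
  rw [Finset.sum_congr rfl h2, Finset.sum_const]
  have h3 : (Finset.univ : Finset {φ : EE p R N (n + 1) →ₗ[R] M // Function.Surjective φ}).card
      = gam R N M := by
    rw [← numSurj_EE (kill_mono (Nat.le_succ n) h), numSurj]; simp
  rw [h3, nsmul_eq_mul, div_pow]
  ring

/-- few tuples are bad -/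
theorem bad_count {N n L : ℕ}
    (hn : (⊤ : Submodule ℤ_[p] (Fin N → R)).spanFinrank * L < n + 1) :
    L * Nat.card {g : Fin N → EE p R N (n + 1) //
        ¬ ((p : R) ^ n • ⊤ ≤ Submodule.span R (Set.range g))} ≤
      (⊤ : Submodule ℤ_[p] (Fin N → R)).spanFinrank * Nat.card (EE p R N (n + 1)) ^ N := by
  classical
  have := finite_EE (p := p) (R := R) N (n + 1)
  cases nonempty_fintype (Fin N → EE p R N (n + 1))
  set d := (⊤ : Submodule ℤ_[p] (Fin N → R)).spanFinrank
  let S := ((p : R) ^ (n + 1) • (⊤ : Submodule R (Fin N → R)))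
  let ee : Fin N → EE p R N (n + 1) := fun i => S.mkQ (Pi.single i 1)
  let Bad : (Fin N → EE p R N (n + 1)) → Prop :=
    fun g => ¬ ((p : R) ^ n • ⊤ ≤ Submodule.span R (Set.range g))
  have h1 : ∀ t : Fin L, Nat.card {g // Bad (g - ((t : ℕ) : R) • ee)} = Nat.card {g // Bad g} := by
    intro t
    exact Nat.card_congr ((Equiv.subRight (((t : ℕ) : R) • ee)).subtypeEquiv (fun g => Iff.rfl))
  have h2 := card_swap (fun (t : Fin L) (g : Fin N → EE p R N (n + 1)) => Bad (g - ((t : ℕ) : R) • ee))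
  rw [Finset.sum_congr rfl (fun t _ => h1 t), Finset.sum_const, Finset.card_univ, Fintype.card_fin,
    smul_eq_mul] at h2
  change L * Nat.card {g // Bad g} ≤ _
  rw [h2]
  have h3 : ∀ g ∈ (Finset.univ : Finset (Fin N → EE p R N (n + 1))),
      Nat.card {t : Fin L // Bad (g - ((t : ℕ) : R) • ee)} ≤ d := by
    intro g _
    let g' : Fin N → (Fin N → R) := fun i => Function.surjInv (Submodule.mkQ_surjective S) (g i)
    have hg' : ∀ i, S.mkQ (g' i) = g i := fun i => Function.surjInv_eq (Submodule.mkQ_surjective S) _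
    obtain ⟨F, hF, hd, hbad⟩ := exists_poly (p := p) n g'
    let T : Finset ℕ := (Finset.univ.filter (fun t : Fin L => Bad (g - ((t : ℕ) : R) • ee))).map
      Fin.valEmbedding
    have hT : T.card = Nat.card {t : Fin L // Bad (g - ((t : ℕ) : R) • ee)} := by
      rw [Finset.card_map, Nat.card_eq_fintype_card, Fintype.card_subtype]
    rw [← hT]
    refine poly_bad d L (n + 1) F T hF hd ?_ ?_ hn
    · intro t ht
      obtain ⟨s, -, rfl⟩ := Finset.mem_map.1 ht
      exact s.2
    · intro t ht
      obtain ⟨s, hs, rfl⟩ := Finset.mem_map.1 ht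
      apply hbad
      intro hc
      apply (Finset.mem_filter.1 hs).2
      rintro _ ⟨y, -, rfl⟩
      obtain ⟨x, rfl⟩ := Submodule.mkQ_surjective S y
      have h4 := Submodule.mem_map_of_mem (f := S.mkQ) (hc ⟨x, trivial, rfl⟩)
      rw [Submodule.map_span, ← Set.range_comp] at h4
      have h5 : (⇑S.mkQ ∘ fun i => g' i - ((Fin.valEmbedding s : ℕ) : R) • (Pi.single i 1 : Fin N → R))
          = g - ((s : ℕ) : R) • ee := by
        funext i
        simp only [Function.comp_apply, map_sub, map_smul, hg']
        rfl
      rw [h5] at h4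
      exact h4
  refine (Finset.sum_le_card_nsmul _ _ _ h3).trans ?_
  rw [smul_eq_mul, Finset.card_univ, ← Nat.card_eq_fintype_card, Nat.card_fun, mul_comm]
  simp

end main_part

section final_part

open scoped Pointwise

variable {p : ℕ} [Fact p.Prime] {R : Type} [CommRing R] [IsLocalRing R]
    [Algebra ℤ_[p] R] [Module.Finite ℤ_[p] R] [Finite (ResidueField R)]

theorem total_EE {M₀ : Type} [AddCommGroup M₀] [Module R M₀] [Finite M₀] {N n : ℕ}
    [Fintype (Fin N → EE p R N n)] (h : ∀ x : M₀, (p : R) ^ n • x = 0) :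
    ∑ g : Fin N → EE p R N n,
      (numSurj R (EE p R N n ⧸ Submodule.span R (Set.range g)) M₀ : ℝ) =
      (gam R N M₀ : ℝ) / (Nat.card M₀ : ℝ) ^ N * (Nat.card (EE p R N n) : ℝ) ^ N := by
  have := finite_EE (p := p) (R := R) N n
  have h1 := sum_numSurj (R := R) (E := EE p R N n) (M := M₀) N
  push_cast at h1
  rw [h1, numSurj_EE h, div_pow]
  ring

theorem upper_bound (hinj : Function.Injective (algebraMap ℤ_[p] R))
    (ι : Type) (Mod : ι → ModuleCat.{0} R)
    (hfin : ∀ i, Finite (Mod i))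
    (hcok : ∀ i, OccursAsCokernel R (Mod i))
    (hirr : ∀ i j, Nonempty ((Mod i : Type) ≃ₗ[R] Mod j) → i = j)
    (M₀ : Type) [AddCommGroup M₀] [Module R M₀] [Finite M₀] (S : Finset ι) (N : ℕ) :
    ∑ i ∈ S, (numSurj R (Mod i) M₀ : ℝ) / (numAut R (Mod i) : ℝ) *
      ((gam R N (Mod i) : ℝ) / (Nat.card (Mod i) : ℝ) ^ N * cN R N) ≤ 1 := by
  classical
  have hk : ∀ i, ∃ n : ℕ, ∀ x : Mod i, (p : R) ^ n • x = 0 := fun i =>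
    have := hfin i
    exists_kill p R (Mod i)
  choose k hk using hk
  obtain ⟨k0, hk0⟩ := exists_kill p R M₀
  let n := S.sup k + k0
  have := finite_EE (p := p) (R := R) N (n + 1)
  cases nonempty_fintype (Fin N → EE p R N (n + 1))
  have htot := total_EE (p := p) (R := R) (N := N) (n := n + 1)
    (kill_mono (p := p) (R := R) (show k0 ≤ n + 1 by omega) hk0)
  have hEpos : 0 < (Nat.card (EE p R N (n + 1)) : ℝ) := by exact_mod_cast Nat.card_pos
  let Fil : ι → Finset (Fin N → EE p R N (n + 1)) := fun i => Finset.univ.filter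
    (fun g => Nonempty ((EE p R N (n + 1) ⧸ Submodule.span R (Set.range g)) ≃ₗ[R] Mod i))
  have hdisj : (S : Set ι).PairwiseDisjoint Fil := by
    intro i _ j _ hij
    rw [Function.onFun, Finset.disjoint_left]
    intro g hg hg'
    obtain ⟨e⟩ := (Finset.mem_filter.1 hg).2
    obtain ⟨e'⟩ := (Finset.mem_filter.1 hg').2
    exact hij (hirr i j ⟨e.symm.trans e'⟩)
  have h1 : ∀ i ∈ S, (numSurj R (Mod i) M₀ : ℝ) / (numAut R (Mod i) : ℝ) *
      ((gam R N (Mod i) : ℝ) / (Nat.card (Mod i) : ℝ) ^ N * cN R N) * (Nat.card (EE p R N (n + 1)) : ℝ) ^ N =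
      ∑ g ∈ Fil i, (numSurj R (EE p R N (n + 1) ⧸ Submodule.span R (Set.range g)) M₀ : ℝ) := by
    intro i hi
    have := hfin i
    have hb := BB_eq (p := p) (N := N) (n := n) hinj (hcok i)
      (kill_mono (p := p) (R := R) (show k i ≤ n by
        have := Finset.le_sup (f := k) hi; omega) (hk i))
    have ha : (numAut R (Mod i) : ℝ) ≠ 0 := by exact_mod_cast numAut_pos.ne'
    have h2 : ∀ g ∈ Fil i, (numSurj R (EE p R N (n + 1) ⧸ Submodule.span R (Set.range g)) M₀ : ℝ) =
        numSurj R (Mod i) M₀ := by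
      intro g hg
      obtain ⟨e⟩ := (Finset.mem_filter.1 hg).2
      rw [numSurj_congr e]
    rw [Finset.sum_congr rfl h2, Finset.sum_const, nsmul_eq_mul]
    have h3 : (Fil i).card = BB p R N (n + 1) (Mod i) := by
      rw [BB, Nat.card_eq_fintype_card, Fintype.card_subtype]
    rw [h3]
    field_simp at hb ⊢
    linear_combination (-(numSurj R (Mod i) M₀ : ℝ)) * hb
  have h2 : (∑ i ∈ S, (numSurj R (Mod i) M₀ : ℝ) / (numAut R (Mod i) : ℝ) *
      ((gam R N (Mod i) : ℝ) / (Nat.card (Mod i) : ℝ) ^ N * cN R N)) * (Nat.card (EE p R N (n + 1)) : ℝ) ^ N ≤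
      1 * (Nat.card (EE p R N (n + 1)) : ℝ) ^ N := by
    rw [Finset.sum_mul, Finset.sum_congr rfl h1, ← Finset.sum_biUnion hdisj]
    refine (Finset.sum_le_sum_of_subset_of_nonneg (Finset.subset_univ _)
      (fun _ _ _ => Nat.cast_nonneg _)).trans ?_
    rw [htot]
    apply mul_le_mul_of_nonneg_right _ (by positivity)
    have hM : 0 < (Nat.card M₀ : ℝ) := by exact_mod_cast Nat.card_pos
    rw [div_le_one (by positivity)]
    exact_mod_cast gam_le N
  exact le_of_mul_le_mul_right h2 (by positivity)

theorem lower_bound (hinj : Function.Injective (algebraMap ℤ_[p] R))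
    (ι : Type) (Mod : ι → ModuleCat.{0} R)
    (hfin : ∀ i, Finite (Mod i))
    (hcomplete : ∀ (M : Type) [AddCommGroup M] [Module R M], Finite M →
      OccursAsCokernel R M → ∃ i, Nonempty (M ≃ₗ[R] Mod i))
    (M₀ : Type) [AddCommGroup M₀] [Module R M₀] [Finite M₀] (N : ℕ) (hN : 0 < N) (L : ℕ)
    (hL : 0 < L) :
    ∃ S : Finset ι, (gam R N M₀ : ℝ) / (Nat.card M₀ : ℝ) ^ N ≤
      (∑ i ∈ S, (numSurj R (Mod i) M₀ : ℝ) / (numAut R (Mod i) : ℝ)) * cN R N +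
      ((⊤ : Submodule ℤ_[p] (Fin N → R)).spanFinrank : ℝ) * (Nat.card M₀ : ℝ) ^ N / L := by
  classical
  obtain ⟨k0, hk0⟩ := exists_kill p R M₀
  set d := (⊤ : Submodule ℤ_[p] (Fin N → R)).spanFinrank with hd
  let n := d * L + k0
  have := finite_EE (p := p) (R := R) N (n + 1)
  cases nonempty_fintype (Fin N → EE p R N (n + 1))
  have htot := total_EE (p := p) (R := R) (N := N) (n := n + 1)
    (kill_mono (p := p) (R := R) (show k0 ≤ n + 1 by omega) hk0)
  have hbad := bad_count (p := p) (R := R) (N := N) (n := n) (L := L)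
    (Nat.lt_succ_of_le (Nat.le_add_right _ _))
  rw [← hd] at hbad
  have hEpos : 0 < (Nat.card (EE p R N (n + 1)) : ℝ) := by exact_mod_cast Nat.card_pos
  have hMpos : 0 < (Nat.card M₀ : ℝ) := by exact_mod_cast Nat.card_pos
  have hLpos : 0 < (L : ℝ) := by exact_mod_cast hL
  have hcpos := (cN_facts R).1 N
  let Good : (Fin N → EE p R N (n + 1)) → Prop :=
    fun g => ((p : R) ^ n • ⊤ ≤ Submodule.span R (Set.range g))
  have hidx : ∀ g : {g : Fin N → EE p R N (n + 1) // Good g},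
      ∃ i, Nonempty ((EE p R N (n + 1) ⧸ Submodule.span R (Set.range g.1)) ≃ₗ[R] Mod i) := by
    intro g
    apply hcomplete _ (Finite.of_surjective _ (Submodule.mkQ_surjective _))
    exact lift_good hinj hN g.1 g.2
  choose idx hidx using hidx
  let S : Finset ι := Finset.univ.image idx
  have hkill : ∀ i ∈ S, ∀ x : Mod i, (p : R) ^ n • x = 0 := by
    intro i hi x
    obtain ⟨g, -, rfl⟩ := Finset.mem_image.1 hi
    obtain ⟨e⟩ := hidx g
    apply e.symm.injective
    rw [map_smul, map_zero]
    obtain ⟨y, hy⟩ := Submodule.mkQ_surjective _ (e.symm x)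
    rw [← hy, ← map_smul, Submodule.mkQ_apply, Submodule.Quotient.mk_eq_zero]
    exact g.2 (Submodule.smul_mem_pointwise_smul _ _ _ Submodule.mem_top)
  have hK : ∀ g : Fin N → EE p R N (n + 1),
      (numSurj R (EE p R N (n + 1) ⧸ Submodule.span R (Set.range g)) M₀ : ℝ) ≤
        (Nat.card M₀ : ℝ) ^ N := by
    intro g
    have : Finite (EE p R N (n + 1) →ₗ[R] M₀) := finite_hom
    have h1 : numSurj R (EE p R N (n + 1) ⧸ Submodule.span R (Set.range g)) M₀ ≤
        numSurj R (EE p R N (n + 1)) M₀ := by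
      rw [numSurj_quot]
      exact Nat.card_le_card_of_injective _ Subtype.val_injective
    rw [numSurj_EE (kill_mono (p := p) (R := R) (show k0 ≤ n + 1 by omega) hk0)] at h1
    exact_mod_cast h1.trans (gam_le N)
  have hpt : ∀ g ∈ (Finset.univ : Finset (Fin N → EE p R N (n + 1))),
      (numSurj R (EE p R N (n + 1) ⧸ Submodule.span R (Set.range g)) M₀ : ℝ) ≤
        (∑ i ∈ S, if Nonempty ((EE p R N (n + 1) ⧸ Submodule.span R (Set.range g)) ≃ₗ[R] Mod i)
          then (numSurj R (Mod i) M₀ : ℝ) else 0) +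
        (if ¬ Good g then (Nat.card M₀ : ℝ) ^ N else 0) := by
    intro g _
    have hnn : ∀ i ∈ S, (0 : ℝ) ≤
        (if Nonempty ((EE p R N (n + 1) ⧸ Submodule.span R (Set.range g)) ≃ₗ[R] Mod i)
          then (numSurj R (Mod i) M₀ : ℝ) else 0) := by
      intro i _
      split_ifs
      · exact Nat.cast_nonneg _
      · exact le_rfl
    by_cases hg : Good g
    · rw [if_neg (not_not.2 hg), add_zero]
      have h1 := Finset.single_le_sum hnn
        (Finset.mem_image_of_mem idx (Finset.mem_univ ⟨g, hg⟩))
      rw [if_pos (hidx ⟨g, hg⟩)] at h1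
      obtain ⟨e⟩ := hidx ⟨g, hg⟩
      rw [numSurj_congr e]
      exact h1
    · rw [if_pos hg]
      have := Finset.sum_nonneg hnn
      linarith [hK g]
  have hsum := Finset.sum_le_sum hpt
  rw [htot, Finset.sum_add_distrib, Finset.sum_comm] at hsum
  have hA : ∀ i ∈ S, (∑ g : Fin N → EE p R N (n + 1),
      if Nonempty ((EE p R N (n + 1) ⧸ Submodule.span R (Set.range g)) ≃ₗ[R] Mod i)
          then (numSurj R (Mod i) M₀ : ℝ) else 0) ≤
      (numSurj R (Mod i) M₀ : ℝ) / (numAut R (Mod i) : ℝ) *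
        ((Nat.card (EE p R N (n + 1)) : ℝ) ^ N * cN R N) := by
    intro i hi
    have := hfin i
    rw [← Finset.sum_filter, Finset.sum_const, nsmul_eq_mul]
    have hb := BB_le (p := p) (N := N) (n := n) hinj (hkill i hi)
    rw [BB, Nat.card_eq_fintype_card, Fintype.card_subtype] at hb
    have ha : 0 < (numAut R (Mod i) : ℝ) := by exact_mod_cast numAut_pos
    rw [← le_div_iff₀ ha] at hb
    refine (mul_le_mul_of_nonneg_right hb (Nat.cast_nonneg _)).trans (le_of_eq ?_)
    ring
  have hB : (∑ g : Fin N → EE p R N (n + 1), if ¬ Good g then (Nat.card M₀ : ℝ) ^ N else 0) ≤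
      (d : ℝ) * (Nat.card (EE p R N (n + 1)) : ℝ) ^ N / L * (Nat.card M₀ : ℝ) ^ N := by
    rw [← Finset.sum_filter, Finset.sum_const, nsmul_eq_mul]
    rw [Nat.card_eq_fintype_card, Fintype.card_subtype] at hbad
    apply mul_le_mul_of_nonneg_right _ (by positivity)
    rw [le_div_iff₀ hLpos, mul_comm]
    have hbad' := (Nat.cast_le (α := ℝ)).2 hbad
    rw [Nat.cast_mul, Nat.cast_mul, Nat.cast_pow] at hbad'
    exact hbad'
  have hfinal := hsum.trans (add_le_add (Finset.sum_le_sum hA) hB)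
  rw [← Finset.sum_mul] at hfinal
  refine ⟨S, le_of_mul_le_mul_right (hfinal.trans (le_of_eq ?_))
    (show 0 < (Nat.card (EE p R N (n + 1)) : ℝ) ^ N by positivity)⟩
  ring

end final_part
theorem statement10 (p : ℕ) [Fact p.Prime] (R : Type) [CommRing R] [IsLocalRing R]
    [Algebra ℤ_[p] R] (hinj : Function.Injective (algebraMap ℤ_[p] R))
    [Module.Finite ℤ_[p] R] [Finite (ResidueField R)]
    -- `Mod : ι → ModuleCat R` is a complete irredundant family of representatives of the
    -- isomorphism classes of finite `R`-modules occurring as cokernels: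
    (ι : Type) (Mod : ι → ModuleCat.{0} R)
    (hfin : ∀ i, Finite (Mod i))
    (hcok : ∀ i, OccursAsCokernel R (Mod i))
    (hcomplete : ∀ (M : Type) [AddCommGroup M] [Module R M], Finite M →
      OccursAsCokernel R M → ∃ i, Nonempty (M ≃ₗ[R] Mod i))
    (hirr : ∀ i j, Nonempty ((Mod i : Type) ≃ₗ[R] Mod j) → i = j)
    (M₀ : Type) [AddCommGroup M₀] [Module R M₀] [Finite M₀] :
    HasSum (fun i => (numSurj R (Mod i) M₀ : ℝ) / (numAut R (Mod i) : ℝ)) (cConst R)⁻¹ := by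
  have hc := (cN_facts R).2.1
  have hlim := (cN_facts R).2.2
  apply hasSum_of_isLUB_of_nonneg
  · intro i
    positivity
  constructor
  · rintro _ ⟨S, rfl⟩
    have h1 : Filter.Tendsto (fun N => ∑ i ∈ S,
        (numSurj R (Mod i) M₀ : ℝ) / (numAut R (Mod i) : ℝ) *
          ((gam R N (Mod i) : ℝ) / (Nat.card (Mod i) : ℝ) ^ N * cN R N)) Filter.atTop
        (nhds (∑ i ∈ S, (numSurj R (Mod i) M₀ : ℝ) / (numAut R (Mod i) : ℝ) *
          (1 * cConst R))) := by
      refine tendsto_finsetSum _ (fun i _ => ?_)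
      have := hfin i
      exact (tendsto_gam.mul hlim).const_mul _
    have h2 := le_of_tendsto' h1
      (fun N => upper_bound hinj ι Mod hfin hcok hirr M₀ S N)
    rw [one_mul, ← Finset.sum_mul] at h2
    change ∑ i ∈ S, _ ≤ _
    rw [← one_div, le_div_iff₀ hc]
    exact h2
  · intro b hb
    have h1 : ∀ N : ℕ, 0 < N → (gam R N M₀ : ℝ) / (Nat.card M₀ : ℝ) ^ N ≤ b * cN R N := by
      intro N hN
      have h2 : Filter.Tendsto (fun L : ℕ => b * cN R N +
          ((⊤ : Submodule ℤ_[p] (Fin N → R)).spanFinrank : ℝ) * (Nat.card M₀ : ℝ) ^ N / (L : ℝ))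
          Filter.atTop (nhds (b * cN R N + 0)) :=
        (tendsto_const_div_atTop_nhds_zero_nat _).const_add _
      rw [add_zero] at h2
      refine ge_of_tendsto h2 ?_
      filter_upwards [Filter.eventually_gt_atTop 0] with L hL
      obtain ⟨S, hS⟩ := lower_bound hinj ι Mod hfin hcomplete M₀ N hN L hL
      refine hS.trans (add_le_add_left ?_ _)
      exact mul_le_mul_of_nonneg_right (hb ⟨S, rfl⟩) ((cN_facts R).1 N).le
    have h3 : (1 : ℝ) ≤ b * cConst R := by
      refine le_of_tendsto_of_tendsto (tendsto_gam (R := R) (M := M₀)) (hlim.const_mul b) ?_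
      filter_upwards [Filter.eventually_gt_atTop 0] with N hN
      exact h1 N hN
    rw [← one_div, div_le_iff₀ hc]
    exact h3
end

section
/- Assume F_R ≠ F_2, i.e., |F_R| ≥ 3. Let ν be a nonnegative, absolutely summable function on the set of isomorphism classes of finite R-modules such that for every finite R-module M_0, Σ_M ν(M)·#Surj_R(M, M_0) = 1 (sum over isomorphism classes). Then ν(M) = c_R/#Aut_R(M) for every M occurring as a cokernel and ν(M) = 0 for every other M; in particular such ν is unique. -/
/- STATEMENT 11: Assume |F_R| ≥ 3.  Let ν be a nonnegative, absolutely summable function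
   on the set of isomorphism classes of finite R-modules such that for every finite
   R-module M₀, Σ_M ν(M)·#Surj_R(M, M₀) = 1 (sum over isomorphism classes).  Then
   ν(M) = c_R/#Aut_R(M) for every M occurring as a cokernel and ν(M) = 0 for every other
   M; in particular such ν is unique.

   The set of isomorphism classes of finite R-modules is expressed by a complete
   irredundant family of representatives. -/

open IsLocalRing

section analysis
open Filter Topology

noncomputable def aCoef (q : ℝ) (e : ℕ) : ℝ :=
  (-1) ^ e / ∏ i ∈ Finset.range e, (q ^ (i + 1) - 1)

theorem qpow_pos {q : ℝ} (hq : 1 < q) (i : ℕ) : 0 < q ^ (i + 1) - 1 := by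
  have := one_lt_pow₀ hq (Nat.succ_ne_zero i)
  simpa using this

theorem aCoef_zero (q : ℝ) : aCoef q 0 = 1 := by simp [aCoef]

theorem aCoef_succ {q : ℝ} (hq : 1 < q) (e : ℕ) :
    aCoef q (e + 1) * (q ^ (e + 1) - 1) = - aCoef q e := by
  have h := (qpow_pos hq e).ne'
  have h2 : ∏ i ∈ Finset.range e, (q ^ (i + 1) - 1) ≠ 0 :=
    Finset.prod_ne_zero_iff.2 fun i _ => (qpow_pos hq i).ne'
  rw [aCoef, aCoef, Finset.prod_range_succ, pow_succ]
  field_simp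

theorem aCoef_ne {q : ℝ} (hq : 1 < q) (e : ℕ) : aCoef q e ≠ 0 := by
  have h2 : ∏ i ∈ Finset.range e, (q ^ (i + 1) - 1) ≠ 0 :=
    Finset.prod_ne_zero_iff.2 fun i _ => (qpow_pos hq i).ne'
  exact div_ne_zero (pow_ne_zero _ (by norm_num)) h2

theorem partial_sum {q : ℝ} (hq : 1 < q) (X : ℝ) (k : ℕ) :
    ∑ e ∈ Finset.range (k + 1), aCoef q e * ∏ i ∈ Finset.range e, (X - q ^ i)
      = ∏ i ∈ Finset.range k, ((q ^ (i + 1) - X) / (q ^ (i + 1) - 1)) := by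
  have key : ∀ k : ℕ, (X - 1) * ∏ i ∈ Finset.range k, ((q ^ (i + 1) - X) / (q ^ (i + 1) - 1))
      = aCoef q k * ∏ i ∈ Finset.range (k + 1), (X - q ^ i) := by
    intro k
    induction k with
    | zero => simp [aCoef]
    | succ k ih =>
      rw [Finset.prod_range_succ, ← mul_assoc, ih, Finset.prod_range_succ _ (k + 1),
        ← neg_neg (aCoef q k), ← aCoef_succ hq k]
      have h := (qpow_pos hq k).ne'
      field_simp
      ring
  induction k with
  | zero => simp [aCoef]
  | succ k ih =>
    rw [Finset.sum_range_succ, ih, Finset.prod_range_succ (fun i => (q ^ (i + 1) - X) / (q ^ (i + 1) - 1)) k]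
    have h := (qpow_pos hq k).ne'
    have h1 := key k
    have h2 := aCoef_succ hq k
    have h3 : aCoef q (k + 1) = - aCoef q k / (q ^ (k + 1) - 1) := by
      field_simp; linarith
    rw [h3]
    have h4 : -aCoef q k / (q ^ (k + 1) - 1) * ∏ i ∈ Finset.range (k + 1), (X - q ^ i)
      = - ((X - 1) * ∏ i ∈ Finset.range k, ((q ^ (i + 1) - X) / (q ^ (i + 1) - 1))) /
        (q ^ (k + 1) - 1) := by rw [h1]; ring
    rw [h4]
    field_simp
    ring

theorem hasSum_aCoef {q : ℝ} (hq : 1 < q) (d : ℕ) :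
    HasSum (fun e => aCoef q e * ∏ i ∈ Finset.range e, (q ^ d - q ^ i))
      (if d = 0 then 1 else 0) := by
  have h1 := partial_sum hq (q ^ d) d
  have h2 : ∏ i ∈ Finset.range d, ((q ^ (i + 1) - q ^ d) / (q ^ (i + 1) - 1))
      = if d = 0 then 1 else 0 := by
    split_ifs with h
    · subst h; simp
    · obtain ⟨d, rfl⟩ := Nat.exists_eq_succ_of_ne_zero h
      apply Finset.prod_eq_zero (Finset.mem_range.2 (Nat.lt_succ_self d))
      simp
  rw [← h2, ← h1]
  apply hasSum_sum_of_ne_finset_zero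
  intro e he
  have : d < e := by simpa using he
  rw [Finset.prod_eq_zero (Finset.mem_range.2 this) (by simp), mul_zero]

theorem summable_aCoef {q : ℝ} (hq : 1 < q) (x : ℝ) :
    Summable (fun e => aCoef q e * x ^ e) := by
  rcases eq_or_ne x 0 with rfl | hx
  · apply summable_of_ne_finset_zero (s := {0})
    intro b hb
    simp at hb
    simp [hb]
  apply summable_of_ratio_test_tendsto_lt_one (l := 0) one_pos
  · exact Eventually.of_forall fun e => mul_ne_zero (aCoef_ne hq e) (pow_ne_zero _ hx)
  · have h : ∀ e, ‖aCoef q (e + 1) * x ^ (e + 1)‖ / ‖aCoef q e * x ^ e‖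
        = |x| / (q ^ (e + 1) - 1) := by
      intro e
      have h := qpow_pos hq e
      have h1 : ‖aCoef q e‖ = ‖aCoef q (e + 1)‖ * (q ^ (e + 1) - 1) := by
        rw [← norm_neg, ← aCoef_succ hq, norm_mul, Real.norm_of_nonneg h.le]
      have h3 : ‖aCoef q (e + 1)‖ ≠ 0 := norm_ne_zero_iff.2 (aCoef_ne hq _)
      have h4 : ‖x‖ ≠ 0 := norm_ne_zero_iff.2 hx
      rw [norm_mul, norm_mul, h1, norm_pow, norm_pow, ← Real.norm_eq_abs]
      have := h.ne'
      field_simp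
      rw [pow_succ]
    simp_rw [h]
    apply Tendsto.div_atTop tendsto_const_nhds
    apply tendsto_atTop_add_const_right
    exact (tendsto_pow_atTop_atTop_of_one_lt hq).comp (tendsto_add_atTop_nat 1)

noncomputable def Gfun (q x : ℝ) : ℝ := ∑' e, aCoef q e * x ^ e

theorem Gfun_mul {q : ℝ} (hq : 1 < q) (x : ℝ) : Gfun q (q * x) = (1 - x) * Gfun q x := by
  have s1 := summable_aCoef hq (q * x)
  have s2 := summable_aCoef hq x
  have h : Gfun q (q * x) - Gfun q x = - (x * Gfun q x) := by
    rw [Gfun, Gfun, ← s1.tsum_sub s2, (s1.sub s2).tsum_eq_zero_add, ← tsum_mul_left, ← tsum_neg]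
    simp only [pow_zero, mul_one, sub_self, zero_add]
    congr 1
    ext e
    have := aCoef_succ hq e
    rw [mul_pow]
    linear_combination x ^ (e + 1) * this
  linarith

theorem Gfun_pow {q : ℝ} (hq : 1 < q) (t : ℕ) : Gfun q (q ^ (t + 1)) = 0 := by
  induction t with
  | zero => simpa using Gfun_mul hq 1
  | succ t ih => rw [pow_succ', Gfun_mul hq, ih, mul_zero]

theorem Gfun_one {q : ℝ} (hq : 1 < q) : Gfun q 1 = ∏' i : ℕ, (1 - q⁻¹ ^ (i + 1)) := by
  have hq0 : q ≠ 0 := by positivity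
  have hi0 : 0 ≤ q⁻¹ := by positivity
  have hi : q⁻¹ < 1 := inv_lt_one_of_one_lt₀ hq
  have hm : Multipliable (fun i : ℕ => 1 - q⁻¹ ^ (i + 1)) := by
    have : Summable (fun i : ℕ => - q⁻¹ ^ (i + 1)) :=
      ((summable_nat_add_iff 1).2 (summable_geometric_of_lt_one hi0 hi)).neg
    simpa [sub_eq_add_neg] using Real.multipliable_one_add_of_summable this
  have h1 : ∀ k : ℕ, Gfun q 1 = (∏ i ∈ Finset.range k, (1 - q⁻¹ ^ (i + 1))) * Gfun q (q⁻¹ ^ k) := by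
    intro k
    induction k with
    | zero => simp
    | succ k ih =>
      rw [ih, Finset.prod_range_succ, mul_assoc, ← Gfun_mul hq]
      congr 2
      rw [pow_succ']; field_simp
  have h2 : Tendsto (fun k : ℕ => Gfun q (q⁻¹ ^ k)) atTop (𝓝 1) := by
    have e1 : (1 : ℝ) = ∑' e : ℕ, (if e = 0 then 1 else 0 : ℝ) := by simp
    rw [e1]
    apply tendsto_tsum_of_dominated_convergence (bound := fun e => ‖aCoef q e * 1 ^ e‖)
      (summable_aCoef hq 1).norm
    · intro e
      split_ifs with he
      · subst he; simp [aCoef]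
      · have : Tendsto (fun k : ℕ => (q⁻¹ ^ k) ^ e) atTop (𝓝 (0 ^ e)) :=
          (tendsto_pow_atTop_nhds_zero_of_lt_one hi0 hi).pow e
        simpa [he] using this.const_mul (aCoef q e)
    · refine Eventually.of_forall fun k e => ?_
      rw [norm_mul, norm_mul]
      gcongr
      simp only [norm_pow, Real.norm_of_nonneg hi0, norm_one]
      gcongr
      exact pow_le_one₀ hi0 hi.le
  have h3 := hm.tendsto_prod_tprod_nat.mul h2
  simp_rw [← h1, mul_one] at h3
  exact tendsto_nhds_unique tendsto_const_nhds h3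

end analysis

section loc
variable {R : Type} [CommRing R] [IsLocalRing R] {K : Type} [AddCommGroup K] [Module R K]

theorem linInd_of_surj (e : ℕ) (φ : K →ₗ[R] (Fin e → ResidueField R)) :
    Function.Surjective φ ↔
      LinearIndependent (ResidueField R)
        (fun i : Fin e => (LinearMap.proj i ∘ₗ φ : K →ₗ[R] ResidueField R)) := by
  constructor
  · intro hφ
    rw [Fintype.linearIndependent_iff]
    intro c hc i
    obtain ⟨k, hk⟩ := hφ (Pi.single i 1)
    have := LinearMap.congr_fun hc k
    simpa [hk, Pi.single_apply] using this
  · intro hli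
    rw [← LinearMap.range_eq_top]
    by_contra hne
    let S : Submodule (ResidueField R) (Fin e → ResidueField R) :=
      { LinearMap.range φ with
        smul_mem' := by
          rintro c x ⟨k, rfl⟩
          obtain ⟨r, rfl⟩ := residue_surjective c
          exact ⟨r • k, by rw [map_smul]; rfl⟩ }
    have hS : S < ⊤ := by
      refine lt_top_iff_ne_top.2 fun h => hne ?_
      rw [eq_top_iff]
      intro x _
      have : x ∈ S := h ▸ Submodule.mem_top
      exact this
    obtain ⟨ℓ, hℓ, hle⟩ := Submodule.exists_le_ker_of_lt_top S hS
    apply hℓ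
    rw [Fintype.linearIndependent_iff] at hli
    have h0 := hli (fun i => ℓ (Pi.single i 1)) (by
      ext k
      have : ℓ (φ k) = 0 := hle (show φ k ∈ S from ⟨k, rfl⟩)
      rw [LinearMap.pi_apply_eq_sum_univ] at this
      have h2 : ∀ i : Fin e, (fun j => if i = j then (1 : ResidueField R) else 0)
          = Pi.single i 1 := by
        intro i; ext j; simp [Pi.single_apply, eq_comm]
      simp_rw [h2] at this
      simpa [mul_comm] using this)
    ext i
    simpa using h0 i

/-- `Hom(K, F^e)` is `Hom(K,F)^e`. -/
noncomputable def homPi (e : ℕ) :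
    (K →ₗ[R] (Fin e → ResidueField R)) ≃ (Fin e → (K →ₗ[R] ResidueField R)) where
  toFun φ := fun i => LinearMap.proj i ∘ₗ φ
  invFun c := LinearMap.pi c
  left_inv φ := by ext; simp
  right_inv φ := by ext; simp

theorem finite_hom_s11 [Module.Finite R K] {V : Type} [AddCommGroup V] [Module R V] [Finite V] :
    Finite (K →ₗ[R] V) := by
  obtain ⟨n, f, hf⟩ := Module.Finite.exists_fin' R K
  have : Finite ((Fin n → R) →ₗ[R] V) := by
    refine Finite.of_injective (fun g => fun i => g (Pi.single i 1)) ?_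
    intro g g' h
    ext i
    simpa using congrFun h i
  refine Finite.of_injective (fun g : K →ₗ[R] V => g ∘ₗ f) ?_
  intro g g' h
  ext k
  obtain ⟨x, rfl⟩ := hf k
  exact LinearMap.congr_fun h x

variable [Finite (ResidueField R)]

variable (R K) in
/-- dimension of `Hom(K,F)` -/
noncomputable def hdim : ℕ := Module.finrank (ResidueField R) (K →ₗ[R] ResidueField R)

theorem card_hom [Module.Finite R K] :
    Nat.card (K →ₗ[R] ResidueField R) = Nat.card (ResidueField R) ^ hdim R K := by
  have : Finite (K →ₗ[R] ResidueField R) := finite_hom_s11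
  exact Module.natCard_eq_pow_finrank

theorem card_hom_pi [Module.Finite R K] (e : ℕ) :
    Nat.card (K →ₗ[R] (Fin e → ResidueField R)) =
      (Nat.card (ResidueField R) ^ hdim R K) ^ e := by
  rw [Nat.card_congr (homPi e), Nat.card_fun, card_hom]
  simp

theorem card_surj [Module.Finite R K] (e : ℕ) :
    (Nat.card {φ : K →ₗ[R] (Fin e → ResidueField R) // Function.Surjective φ} : ℝ) =
      ∏ i ∈ Finset.range e,
        ((Nat.card (ResidueField R) : ℝ) ^ hdim R K - (Nat.card (ResidueField R) : ℝ) ^ i) := by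
  classical
  have hf : Finite (K →ₗ[R] ResidueField R) := finite_hom_s11
  have : Fintype (ResidueField R) := Fintype.ofFinite _
  have e1 : {φ : K →ₗ[R] (Fin e → ResidueField R) // Function.Surjective φ} ≃
      {s : Fin e → (K →ₗ[R] ResidueField R) // LinearIndependent (ResidueField R) s} :=
    (homPi e).subtypeEquiv (fun φ => linInd_of_surj e φ)
  rw [Nat.card_congr e1]
  by_cases he : e ≤ hdim R K
  · rw [card_linearIndependent he, ← Fin.prod_univ_eq_prod_range
      (fun i => (Nat.card (ResidueField R) : ℝ) ^ hdim R K - (Nat.card (ResidueField R) : ℝ) ^ i) e]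
    push_cast
    refine Finset.prod_congr rfl fun i _ => ?_
    change ((_ ^ hdim R K - _ : ℕ) : ℝ) = _
    rw [Nat.cast_sub (Nat.pow_le_pow_right Fintype.card_pos (i.2.le.trans he))]
    simp
  · rw [Finset.prod_eq_zero (Finset.mem_range.2 (not_le.1 he)) (by simp)]
    rw [Nat.cast_eq_zero, Nat.card_eq_zero]
    left
    constructor
    rintro ⟨s, hs⟩
    apply he
    have := hs.fintype_card_le_finrank
    rw [Fintype.card_fin] at this
    exact this

/-- generators -/
theorem exists_gens_s11 [Module.Finite R K] :
    ∃ f : (Fin (hdim R K) → R) →ₗ[R] K, Function.Surjective f := by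
  let T := TensorProduct R (ResidueField R) K
  have hd : Module.finrank (ResidueField R) T = hdim R K := by
    have e1 := LinearMap.liftBaseChangeEquiv (R := R) (M := K) (N := ResidueField R) (ResidueField R)
    rw [hdim, LinearEquiv.finrank_eq e1]
    exact (Subspace.dual_finrank_eq).symm
  have hs : Function.Surjective (TensorProduct.mk R (ResidueField R) K 1) :=
    TensorProduct.mk_surjective _ _ _ residue_surjective
  let b : Module.Basis (Fin (hdim R K)) (ResidueField R) T :=
    Module.finBasisOfFinrankEq _ _ hd
  choose g hg using fun i => hs (b i)
  have := span_eq_top_of_tmul_eq_basis g b hg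
  refine ⟨Fintype.linearCombination R g, ?_⟩
  rw [← LinearMap.range_eq_top, Fintype.range_linearCombination, this]

theorem hdim_le [Module.Finite R K] (n : ℕ) (f : (Fin n → R) →ₗ[R] K)
    (hf : Function.Surjective f) : hdim R K ≤ n := by
  have h1 : Finite (K →ₗ[R] ResidueField R) := finite_hom_s11
  have h2 : Finite ((Fin n → R) →ₗ[R] ResidueField R) := finite_hom_s11
  have h3 : Nat.card ((Fin n → R) →ₗ[R] ResidueField R) ≤ Nat.card (ResidueField R) ^ n := by
    have := Nat.card_le_card_of_injective
      (fun (g : (Fin n → R) →ₗ[R] ResidueField R) => fun i : Fin n => g (Pi.single i 1)) (by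
        intro g g' h
        ext i
        simpa using congrFun h i)
    simpa [Nat.card_fun] using this
  have h4 := Nat.card_le_card_of_injective (fun g : K →ₗ[R] ResidueField R => g ∘ₗ f) (by
    intro g g' h
    ext k
    obtain ⟨x, rfl⟩ := hf k
    exact LinearMap.congr_fun h x)
  rw [card_hom] at h4
  exact (Nat.pow_le_pow_iff_right Finite.one_lt_card).1 (h4.trans h3)

theorem hdim_free (n : ℕ) : hdim R (Fin n → R) = n := by
  have h1 := card_hom (R := R) (K := Fin n → R)
  rw [← Nat.card_congr ((Pi.basisFun R (Fin n)).constr (M' := ResidueField R) ℕ).toEquiv,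
    Nat.card_fun, Nat.card_fin] at h1
  exact (Nat.pow_right_injective Finite.one_lt_card h1).symm

theorem hdim_eq_zero [Module.Finite R K] : hdim R K = 0 ↔ Subsingleton K := by
  constructor
  · intro h
    obtain ⟨f, hf⟩ := exists_gens_s11 (R := R) (K := K)
    have : IsEmpty (Fin (hdim R K)) := by rw [h]; infer_instance
    exact hf.subsingleton
  · intro h
    have := hdim_le 0 (0 : (Fin 0 → R) →ₗ[R] K) (fun k => ⟨0, Subsingleton.elim _ _⟩)
    omega
end loc

section bij
variable {R : Type} [CommRing R] {A M P V E W B : Type} [AddCommGroup A] [Module R A]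
  [AddCommGroup M] [Module R M] [AddCommGroup P] [Module R P] [AddCommGroup V] [Module R V]
  [AddCommGroup E] [Module R E] [AddCommGroup B] [Module R B]

theorem exists_lift_surj (p : B →ₗ[R] A) (hp : Function.Surjective p) (Θ : B →ₗ[R] E)
    (h : ∀ b, p b = 0 → Θ b = 0) : ∃ g : A →ₗ[R] E, ∀ b, g (p b) = Θ b := by
  have hle : LinearMap.ker p ≤ LinearMap.ker Θ := fun b hb => h b hb
  refine ⟨(LinearMap.ker p).liftQ Θ hle ∘ₗ (p.quotKerEquivOfSurjective hp).symm.toLinearMap, ?_⟩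
  intro b
  have : (p.quotKerEquivOfSurjective hp).symm (p b) = Submodule.Quotient.mk b := by
    rw [LinearEquiv.symm_apply_eq]; rfl
  simp [this]

theorem exists_lift_inj (j : V →ₗ[R] E) (hj : Function.Injective j) (Θ : B →ₗ[R] E)
    (h : ∀ b, ∃ v, j v = Θ b) : ∃ θ : B →ₗ[R] V, ∀ b, j (θ b) = Θ b := by
  refine ⟨(LinearEquiv.ofInjective j hj).symm.toLinearMap ∘ₗ
    Θ.codRestrict (LinearMap.range j) (fun b => h b), ?_⟩
  intro b
  have := (LinearEquiv.ofInjective j hj).apply_symm_apply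
    (Θ.codRestrict (LinearMap.range j) (fun b => h b) b)
  exact congrArg Subtype.val this

/-- fibre product -/
abbrev fib (f : A →ₗ[R] M) (π : P →ₗ[R] M) : Submodule R (A × P) :=
  LinearMap.eqLocus (f ∘ₗ LinearMap.fst R A P) (π ∘ₗ LinearMap.snd R A P)

def inlK (f : A →ₗ[R] M) (π : P →ₗ[R] M) : LinearMap.ker f →ₗ[R] fib f π :=
  (LinearMap.inl R A P ∘ₗ (LinearMap.ker f).subtype).codRestrict _ (by
    rintro ⟨a, ha⟩; simpa using ha)

def inrK (f : A →ₗ[R] M) (π : P →ₗ[R] M) : LinearMap.ker π →ₗ[R] fib f π :=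
  (LinearMap.inr R A P ∘ₗ (LinearMap.ker π).subtype).codRestrict _ (by
    rintro ⟨a, ha⟩; simpa using ha.symm)

@[simp] theorem inlK_coe (f : A →ₗ[R] M) (π : P →ₗ[R] M) (k : LinearMap.ker f) :
    (inlK f π k : A × P) = (k.1, 0) := rfl

@[simp] theorem inrK_coe (f : A →ₗ[R] M) (π : P →ₗ[R] M) (k : LinearMap.ker π) :
    (inrK f π k : A × P) = (0, k.1) := rfl

theorem fib_prop {f : A →ₗ[R] M} {π : P →ₗ[R] M} (b : fib f π) : f b.1.1 = π b.1.2 := b.2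

/-- the local bijection -/
theorem local_equiv (f : A →ₗ[R] M) (hf : Function.Surjective f)
    (π : P →ₗ[R] M) (hπ : Function.Surjective π)
    (h : LinearMap.ker π →ₗ[R] V) (i : P →ₗ[R] E) (j : V →ₗ[R] E) (ρ : E →ₗ[R] M)
    (hj : Function.Injective j) (hρj : ∀ v, ρ (j v) = 0) (hex : ∀ y, ρ y = 0 → ∃ v, j v = y)
    (hρi : ∀ x, ρ (i x) = π x) (hw : ∀ w : LinearMap.ker π, i w = - j (h w)) :
    Nonempty ({g : A →ₗ[R] E // Function.Surjective g ∧ ρ ∘ₗ g = f} ≃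
      {θ : fib f π →ₗ[R] V // Function.Surjective (θ ∘ₗ inlK f π) ∧ θ ∘ₗ inrK f π = h}) := by
  classical
  -- relation
  have ex1 : ∀ g : {g : A →ₗ[R] E // Function.Surjective g ∧ ρ ∘ₗ g = f},
      ∃ θ : {θ : fib f π →ₗ[R] V // Function.Surjective (θ ∘ₗ inlK f π) ∧ θ ∘ₗ inrK f π = h},
      ∀ b : fib f π, j (θ.1 b) = g.1 b.1.1 - i b.1.2 := by
    rintro ⟨g, hg, hgf⟩
    have hgf' : ∀ a, ρ (g a) = f a := fun a => LinearMap.congr_fun hgf a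
    obtain ⟨θ, hθ⟩ := exists_lift_inj j hj
      (g ∘ₗ LinearMap.fst R A P ∘ₗ (fib f π).subtype - i ∘ₗ LinearMap.snd R A P ∘ₗ (fib f π).subtype)
      (by
        intro b
        apply hex
        simp [hgf', hρi, fib_prop b])
    refine ⟨⟨θ, ?_, ?_⟩, fun b => by simpa using hθ b⟩
    · intro v
      obtain ⟨a, ha⟩ := hg (j v)
      refine ⟨⟨a, ?_⟩, hj ?_⟩
      · rw [LinearMap.mem_ker, ← hgf', ha, hρj]
      · rw [LinearMap.comp_apply, hθ]
        simp [ha]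
    · ext w
      apply hj
      rw [LinearMap.comp_apply, hθ]
      simp [hw]
  choose F hF using ex1
  refine ⟨Equiv.ofBijective F ⟨?_, ?_⟩⟩
  · intro g g' hgg
    apply Subtype.ext
    ext a
    obtain ⟨x, hx⟩ := hπ (f a)
    have h1 := hF g ⟨(a, x), hx.symm⟩
    have h2 := hF g' ⟨(a, x), hx.symm⟩
    rw [hgg, h2] at h1
    simpa using h1.symm
  · rintro ⟨θ, hθ1, hθ2⟩
    obtain ⟨g, hg⟩ := exists_lift_surj (LinearMap.fst R A P ∘ₗ (fib f π).subtype)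
      (by
        intro a
        obtain ⟨x, hx⟩ := hπ (f a)
        exact ⟨⟨(a, x), hx.symm⟩, rfl⟩)
      (j ∘ₗ θ + i ∘ₗ LinearMap.snd R A P ∘ₗ (fib f π).subtype)
      (by
        rintro ⟨⟨a, x⟩, hb⟩ h0
        have h0 : a = 0 := h0
        subst h0
        have hx : x ∈ LinearMap.ker π := by simpa using hb.symm
        have h3 : θ ⟨(0, x), hb⟩ = h ⟨x, hx⟩ := LinearMap.congr_fun hθ2 ⟨x, hx⟩
        have h4 := hw ⟨x, hx⟩
        simp only at h4
        simp [h3, h4])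
    have hg' : ∀ b : fib f π, g b.1.1 = j (θ b) + i b.1.2 := hg
    have hgf : ∀ a, ρ (g a) = f a := by
      intro a
      obtain ⟨x, hx⟩ := hπ (f a)
      have := hg' ⟨(a, x), hx.symm⟩
      simp only at this
      rw [this, map_add, hρj, hρi, hx, zero_add]
    have hsurj : Function.Surjective g := by
      intro y
      obtain ⟨a, ha⟩ := hf (ρ y)
      obtain ⟨v, hv⟩ := hex (y - g a) (by rw [map_sub, hgf, ha, sub_self])
      obtain ⟨a', ha'⟩ := hθ1 v
      refine ⟨a' + a, ?_⟩
      have := hg' (inlK f π a')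
      have ha2 : θ (inlK f π a') = v := ha'
      rw [ha2] at this
      have h5 : g a' = j v := by simpa using this
      rw [map_add, h5, hv, sub_add_cancel]
    refine ⟨⟨g, hsurj, LinearMap.ext hgf⟩, Subtype.ext (LinearMap.ext fun b => hj ?_)⟩
    rw [hF]
    simp [hg']

/-- splitting of the fibre product -/
theorem fib_split (f : A →ₗ[R] M) (hf : Function.Surjective f) [Module.Projective R P]
    (π : P →ₗ[R] M) :
    Nonempty ({θ : fib f π →ₗ[R] V // Function.Surjective (θ ∘ₗ inlK f π)} ≃
      {φ : LinearMap.ker f →ₗ[R] V // Function.Surjective φ} × (P →ₗ[R] V)) := by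
  obtain ⟨σ, hσ⟩ := Module.projective_lifting_property f π hf
  have hσ' : ∀ x, f (σ x) = π x := fun x => LinearMap.congr_fun hσ x
  let sec : P →ₗ[R] fib f π := (σ.prod LinearMap.id).codRestrict _ (fun x => by simp [hσ'])
  let ret : fib f π →ₗ[R] LinearMap.ker f :=
    ((LinearMap.fst R A P - σ ∘ₗ LinearMap.snd R A P) ∘ₗ (fib f π).subtype).codRestrict _
      (fun b => by simp [hσ', fib_prop b])
  have hsec : ∀ x, (sec x : A × P) = (σ x, x) := fun x => rfl
  have hret : ∀ b, (ret b : A) = b.1.1 - σ b.1.2 := fun x => rfl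
  have hdec : ∀ b : fib f π, inlK f π (ret b) + sec b.1.2 = b := by
    intro b
    apply Subtype.ext
    apply Prod.ext <;> simp [hret, hsec]
  have hr1 : ∀ k, ret (inlK f π k) = k := by
    intro k; apply Subtype.ext; simp [hret]
  have hr2 : ∀ x, ret (sec x) = 0 := by
    intro k; apply Subtype.ext; simp [hret, hsec]
  refine ⟨{ toFun := fun θ => (⟨θ.1 ∘ₗ inlK f π, θ.2⟩, θ.1 ∘ₗ sec)
            invFun := fun φ => ⟨φ.1.1 ∘ₗ ret + φ.2 ∘ₗ LinearMap.snd R A P ∘ₗ (fib f π).subtype, ?_⟩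
            left_inv := ?_
            right_inv := ?_ }⟩
  · convert φ.1.2
    ext k
    simp [hr1]
  · intro θ
    apply Subtype.ext
    ext b
    have := congrArg θ.1 (hdec b)
    simpa using this
  · rintro ⟨⟨φ, hφ⟩, ψ⟩
    apply Prod.ext
    · apply Subtype.ext
      ext k
      simp [hr1]
    · ext x
      simp [hr2, hsec]

/-- The extension attached to `h`. -/
abbrev relSub (π : P →ₗ[R] M) (h : LinearMap.ker π →ₗ[R] V) : Submodule R (P × V) :=
  LinearMap.range ((LinearMap.ker π).subtype.prod h)

abbrev ExtM (π : P →ₗ[R] M) (h : LinearMap.ker π →ₗ[R] V) : Type := (P × V) ⧸ relSub π h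

def ExtM.ρ (π : P →ₗ[R] M) (h : LinearMap.ker π →ₗ[R] V) : ExtM π h →ₗ[R] M :=
  (relSub π h).liftQ (π ∘ₗ LinearMap.fst R P V) (by
    rintro _ ⟨w, rfl⟩
    simp)

def ExtM.j (π : P →ₗ[R] M) (h : LinearMap.ker π →ₗ[R] V) : V →ₗ[R] ExtM π h :=
  (relSub π h).mkQ ∘ₗ LinearMap.inr R P V

theorem ExtM.j_inj (π : P →ₗ[R] M) (h : LinearMap.ker π →ₗ[R] V) :
    Function.Injective (ExtM.j π h) := by
  rw [injective_iff_map_eq_zero]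
  intro v hv
  have : ((0, v) : P × V) ∈ relSub π h := by
    simpa [ExtM.j] using hv
  obtain ⟨w, hw⟩ := this
  simp only [LinearMap.prod_apply, Function.prod_apply, Prod.mk.injEq] at hw
  obtain ⟨h1, h2⟩ := hw
  have : w = 0 := Subtype.ext h1
  rw [← h2, this, map_zero]

theorem ExtM.exact (π : P →ₗ[R] M) (h : LinearMap.ker π →ₗ[R] V) (y : ExtM π h)
    (hy : ExtM.ρ π h y = 0) : ∃ v, ExtM.j π h v = y := by
  obtain ⟨⟨x, v⟩, rfl⟩ := Submodule.Quotient.mk_surjective _ y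
  have hx : π x = 0 := by simpa [ExtM.ρ] using hy
  refine ⟨v - h ⟨x, hx⟩, ?_⟩
  simp only [ExtM.j, LinearMap.comp_apply, Submodule.mkQ_apply]
  rw [Submodule.Quotient.eq]
  refine ⟨- ⟨x, hx⟩, ?_⟩
  simp

theorem ExtM.finite [Finite M] [Finite V] (π : P →ₗ[R] M) (h : LinearMap.ker π →ₗ[R] V) :
    Finite (ExtM π h) := by
  refine Finite.of_surjective (fun mv : M × V =>
    Function.invFun (ExtM.ρ π h) mv.1 + ExtM.j π h mv.2) ?_
  intro y
  have h1 : ExtM.ρ π h (Function.invFun (ExtM.ρ π h) (ExtM.ρ π h y)) = ExtM.ρ π h y :=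
    Function.invFun_eq ⟨y, rfl⟩
  obtain ⟨v, hv⟩ := ExtM.exact π h (y - Function.invFun (ExtM.ρ π h) (ExtM.ρ π h y))
    (by rw [map_sub, h1, sub_self])
  exact ⟨(ExtM.ρ π h y, v), by simp [hv]⟩

/-- swapping two sigmas -/
def sigmaSwap {α β : Type} (X : α → β → Type) : (Σ a, Σ b, X a b) ≃ Σ b, Σ a, X a b where
  toFun s := ⟨s.2.1, s.1, s.2.2⟩
  invFun s := ⟨s.2.1, s.1, s.2.2⟩
  left_inv _ := rfl
  right_inv _ := rfl

theorem main_equiv [Module.Projective R P] (π : P →ₗ[R] M) (hπ : Function.Surjective π) :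
    Nonempty ((Σ h : LinearMap.ker π →ₗ[R] V, {g : A →ₗ[R] ExtM π h // Function.Surjective g}) ≃
      Σ f : {f : A →ₗ[R] M // Function.Surjective f},
        ({φ : LinearMap.ker f.1 →ₗ[R] V // Function.Surjective φ} × (P →ₗ[R] V))) := by
  have hρs : ∀ h : LinearMap.ker π →ₗ[R] V, Function.Surjective (ExtM.ρ π h) := by
    intro h m
    obtain ⟨x, hx⟩ := hπ m
    exact ⟨Submodule.Quotient.mk (x, 0), by simpa [ExtM.ρ] using hx⟩
  have e1 : ∀ h : LinearMap.ker π →ₗ[R] V, {g : A →ₗ[R] ExtM π h // Function.Surjective g} ≃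
      Σ f : {f : A →ₗ[R] M // Function.Surjective f},
        {g : A →ₗ[R] ExtM π h // Function.Surjective g ∧ ExtM.ρ π h ∘ₗ g = f.1} := fun h =>
    { toFun := fun g => ⟨⟨ExtM.ρ π h ∘ₗ g.1, (hρs h).comp g.2⟩, ⟨g.1, g.2, rfl⟩⟩
      invFun := fun s => ⟨s.2.1, s.2.2.1⟩
      left_inv := fun g => rfl
      right_inv := by
        rintro ⟨f, ⟨g, hg, hgf⟩⟩
        obtain rfl : ⟨ExtM.ρ π h ∘ₗ g, (hρs h).comp hg⟩ = f := Subtype.ext hgf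
        rfl }
  have e2 : ∀ (h : LinearMap.ker π →ₗ[R] V) (f : {f : A →ₗ[R] M // Function.Surjective f}),
      Nonempty ({g : A →ₗ[R] ExtM π h // Function.Surjective g ∧ ExtM.ρ π h ∘ₗ g = f.1} ≃
      {θ : fib f.1 π →ₗ[R] V // Function.Surjective (θ ∘ₗ inlK f.1 π) ∧ θ ∘ₗ inrK f.1 π = h}) := by
    intro h f
    refine local_equiv f.1 f.2 π hπ h ((relSub π h).mkQ ∘ₗ LinearMap.inl R P V)
      (ExtM.j π h) (ExtM.ρ π h) (ExtM.j_inj π h) ?_ (ExtM.exact π h) ?_ ?_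
    · intro v; simp [ExtM.j, ExtM.ρ]
    · intro v; simp [ExtM.ρ]
    · intro w
      rw [eq_neg_iff_add_eq_zero]
      simp only [ExtM.j, LinearMap.comp_apply, Submodule.mkQ_apply]
      rw [← Submodule.Quotient.mk_add, Submodule.Quotient.mk_eq_zero]
      exact ⟨w, by simp⟩
  have e3 : ∀ (f : {f : A →ₗ[R] M // Function.Surjective f}),
      (Σ h : LinearMap.ker π →ₗ[R] V, {θ : fib f.1 π →ₗ[R] V //
        Function.Surjective (θ ∘ₗ inlK f.1 π) ∧ θ ∘ₗ inrK f.1 π = h}) ≃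
      {θ : fib f.1 π →ₗ[R] V // Function.Surjective (θ ∘ₗ inlK f.1 π)} := fun f =>
    { toFun := fun s => ⟨s.2.1, s.2.2.1⟩
      invFun := fun θ => ⟨θ.1 ∘ₗ inrK f.1 π, ⟨θ.1, θ.2, rfl⟩⟩
      left_inv := by
        rintro ⟨h, ⟨g, hg, rfl⟩⟩
        rfl
      right_inv := fun g => rfl }
  have e4 := fun (f : {f : A →ₗ[R] M // Function.Surjective f}) =>
    fib_split (V := V) f.1 f.2 π
  exact ⟨(Equiv.sigmaCongrRight fun h => (e1 h).trans
      (Equiv.sigmaCongrRight fun f => (e2 h f).some)).trans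
    ((sigmaSwap _).trans (Equiv.sigmaCongrRight fun f => (e3 f).trans (e4 f).some))⟩

end bij
theorem rank_bound (p : ℕ) [Fact p.Prime] (R : Type) [CommRing R]
    [Algebra ℤ_[p] R] (hinj : Function.Injective (algebraMap ℤ_[p] R))
    [Module.Finite ℤ_[p] R] (n s : ℕ) (W : Submodule R (Fin n → R))
    (hW : Finite ((Fin n → R) ⧸ W)) (f : (Fin s → R) →ₗ[R] W) (hf : Function.Surjective f) :
    n ≤ s := by
  have hd : 0 < Module.finrank ℤ_[p] R := by
    have h1 := LinearMap.finrank_le_finrank_of_injective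
      (f := Algebra.linearMap ℤ_[p] R) hinj
    simp at h1
    omega
  let W' : Submodule ℤ_[p] (Fin n → R) := W.restrictScalars ℤ_[p]
  have hq : Module.finrank ℤ_[p] ((Fin n → R) ⧸ W') = 0 := by
    have hfin : Finite ((Fin n → R) ⧸ W') := hW
    rw [Module.finrank_eq_zero_iff_isTorsion]
    intro x
    have hc : Nat.card ((Fin n → R) ⧸ W') ≠ 0 := Nat.card_pos.ne'
    refine ⟨⟨(Nat.card ((Fin n → R) ⧸ W') : ℤ_[p]), ?_⟩, ?_⟩
    · rw [mem_nonZeroDivisors_iff_ne_zero]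
      exact_mod_cast hc
    · change (Nat.card ((Fin n → R) ⧸ W') : ℤ_[p]) • x = 0
      rw [Nat.cast_smul_eq_nsmul]
      exact card_nsmul_eq_zero'
  have h2 := Submodule.finrank_quotient_add_finrank W'
  have h3 : Module.finrank ℤ_[p] W' ≤ Module.finrank ℤ_[p] (Fin s → R) :=
    LinearMap.finrank_le_finrank_of_surjective (f := (f.restrictScalars ℤ_[p] : (Fin s → R) →ₗ[ℤ_[p]] W')) hf
  have h4 : ∀ k, Module.finrank ℤ_[p] (Fin k → R) = k * Module.finrank ℤ_[p] R := by
    intro k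
    induction k with
    | zero => rw [zero_mul]; exact Module.finrank_zero_of_subsingleton
    | succ k ih =>
      rw [(Fin.consLinearEquiv ℤ_[p] (fun _ : Fin (k + 1) => R)).symm.finrank_eq]
      have h5 := Submodule.finrank_quotient_add_finrank
        (LinearMap.ker (LinearMap.snd ℤ_[p] R (Fin k → R)))
      rw [(LinearMap.quotKerEquivOfSurjective _ LinearMap.snd_surjective).finrank_eq,
        LinearMap.ker_snd,
        LinearMap.finrank_range_of_inj LinearMap.inl_injective, ih] at h5
      rw [add_mul, one_mul]
      exact h5.symm
  rw [hq, zero_add] at h2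
  rw [h2, h4, h4] at h3
  exact Nat.le_of_mul_le_mul_right h3 hd
theorem numBij (R A M : Type) [CommRing R] [AddCommGroup A] [Module R A]
    [AddCommGroup M] [Module R M] :
    Nat.card {f : A →ₗ[R] M // Function.Bijective f} = Nat.card (A ≃ₗ[R] M) :=
  Nat.card_congr
    { toFun := fun f => LinearEquiv.ofBijective f.1 f.2
      invFun := fun e => ⟨e.toLinearMap, e.bijective⟩
      left_inv := fun f => rfl
      right_inv := fun e => by ext; rfl }

section core
variable {R : Type} [CommRing R] [IsLocalRing R] [Finite (ResidueField R)]

/-- The count of pairs `(f, φ)`. -/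
noncomputable def Tcount (R A M : Type) [CommRing R] [IsLocalRing R] [AddCommGroup A] [Module R A]
    [AddCommGroup M] [Module R M] (e : ℕ) : ℕ :=
  Nat.card (Σ f : {f : A →ₗ[R] M // Function.Surjective f},
    {φ : LinearMap.ker f.1 →ₗ[R] (Fin e → ResidueField R) // Function.Surjective φ})

theorem Tcount_sum {A M : Type} [AddCommGroup A] [Module R A] [Finite A]
    [AddCommGroup M] [Module R M] [Finite M] (hq : 1 < (Nat.card (ResidueField R) : ℝ)) :
    HasSum (fun e => aCoef (Nat.card (ResidueField R)) e * (Tcount R A M e : ℝ))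
      (Nat.card (A ≃ₗ[R] M) : ℝ) := by
  classical
  have hfin : Finite (A →ₗ[R] M) := finite_hom_s11
  have : Fintype {f : A →ₗ[R] M // Function.Surjective f} := Fintype.ofFinite _
  have h1 : ∀ e, aCoef (Nat.card (ResidueField R)) e * (Tcount R A M e : ℝ) =
      ∑ f : {f : A →ₗ[R] M // Function.Surjective f},
        aCoef (Nat.card (ResidueField R)) e * ∏ i ∈ Finset.range e,
        ((Nat.card (ResidueField R) : ℝ) ^ hdim R (LinearMap.ker f.1)
          - (Nat.card (ResidueField R) : ℝ) ^ i) := by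
    intro e
    have hf2 : ∀ f : {f : A →ₗ[R] M // Function.Surjective f},
        Finite (LinearMap.ker f.1 →ₗ[R] (Fin e → ResidueField R)) := fun f => finite_hom_s11
    rw [Tcount, Nat.card_sigma, Nat.cast_sum, Finset.mul_sum]
    refine Finset.sum_congr rfl fun f _ => ?_
    rw [card_surj]
  simp_rw [h1]
  have h2 : (Nat.card (A ≃ₗ[R] M) : ℝ) = ∑ f : {f : A →ₗ[R] M // Function.Surjective f},
      (if hdim R (LinearMap.ker f.1) = 0 then 1 else 0 : ℝ) := by
    rw [← numBij, Finset.sum_boole, ← Fintype.card_subtype, ← Nat.card_eq_fintype_card]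
    congr 1
    refine Nat.card_congr (Equiv.symm ((Equiv.subtypeSubtypeEquivSubtypeInter _
      (fun f : A →ₗ[R] M => hdim R (LinearMap.ker f) = 0)).trans (Equiv.subtypeEquivRight ?_)))
    intro f
    rw [hdim_eq_zero, Submodule.subsingleton_iff_eq_bot, LinearMap.ker_eq_bot]
    exact and_comm
  rw [h2]
  exact hasSum_sum fun f _ => hasSum_aCoef hq _

theorem Tcount_ext {A M : Type} [AddCommGroup A] [Module R A] [Finite A]
    [AddCommGroup M] [Module R M] [Finite M] (n : ℕ) (π : (Fin n → R) →ₗ[R] M)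
    (hπ : Function.Surjective π) [Module.Finite R (LinearMap.ker π)] (e : ℕ)
    [Fintype (LinearMap.ker π →ₗ[R] (Fin e → ResidueField R))] :
    ∑ h : LinearMap.ker π →ₗ[R] (Fin e → ResidueField R), numSurj R A (ExtM π h)
      = Tcount R A M e * (Nat.card (ResidueField R) ^ n) ^ e := by
  obtain ⟨eq⟩ := main_equiv (A := A) (V := Fin e → ResidueField R) π hπ
  have hfin : ∀ h : LinearMap.ker π →ₗ[R] (Fin e → ResidueField R),
      Finite (A →ₗ[R] ExtM π h) := fun h => by
    have := ExtM.finite π h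
    exact finite_hom_s11
  have h1 := Nat.card_congr (eq.trans (Equiv.sigmaProdDistrib _ _).symm)
  rw [Nat.card_sigma, Nat.card_prod, card_hom_pi, hdim_free] at h1
  exact h1

theorem core (hq : 1 < (Nat.card (ResidueField R) : ℝ))
    (ι : Type) (Mod : ι → ModuleCat.{0} R)
    (hfin : ∀ i, Finite (Mod i))
    (hirr : ∀ i j, Nonempty ((Mod i : Type) ≃ₗ[R] Mod j) → i = j)
    (ν : ι → ℝ) (hν0 : ∀ i, 0 ≤ ν i)
    (hmom : ∀ (M₀ : Type) [AddCommGroup M₀] [Module R M₀], Finite M₀ →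
      HasSum (fun i => ν i * (numSurj R (Mod i) M₀ : ℝ)) 1) (i₀ : ι)
    (n t : ℕ) (π : (Fin n → R) →ₗ[R] Mod i₀)
    (hπ : Function.Surjective π) [Module.Finite R (LinearMap.ker π)]
    (ht : hdim R (LinearMap.ker π) = t + n) :
    ν i₀ * (numAut R (Mod i₀) : ℝ) =
      Gfun (Nat.card (ResidueField R)) ((Nat.card (ResidueField R) : ℝ) ^ t) := by
  classical
  set q : ℝ := (Nat.card (ResidueField R) : ℝ) with hqdef
  have hq0 : 0 < q := by linarith
  have := hfin i₀
  have h1 : ∀ e, HasSum (fun i => ν i * (Tcount R (Mod i) (Mod i₀) e : ℝ)) ((q ^ t) ^ e) := by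
    intro e
    have hf1 : Finite (LinearMap.ker π →ₗ[R] (Fin e → ResidueField R)) := finite_hom_s11
    have : Fintype (LinearMap.ker π →ₗ[R] (Fin e → ResidueField R)) := Fintype.ofFinite _
    have h2 := hasSum_sum (s := Finset.univ) fun
      (h : LinearMap.ker π →ₗ[R] (Fin e → ResidueField R)) _ =>
      hmom (ExtM π h) (ExtM.finite π h)
    have h3 : ∀ i, ∑ h : LinearMap.ker π →ₗ[R] (Fin e → ResidueField R),
        ν i * (numSurj R (Mod i) (ExtM π h) : ℝ) =
        (ν i * (Tcount R (Mod i) (Mod i₀) e : ℝ)) * (q ^ n) ^ e := by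
      intro i
      have := hfin i
      rw [← Finset.mul_sum, ← Nat.cast_sum, Tcount_ext n π hπ e]
      push_cast
      rw [mul_assoc]
    simp_rw [h3] at h2
    rw [Finset.sum_const, Finset.card_univ, ← Nat.card_eq_fintype_card, card_hom_pi, ht,
      nsmul_one] at h2
    push_cast at h2
    rw [← hqdef, pow_add, mul_pow] at h2
    exact (hasSum_mul_right_iff (by positivity)).1 h2
  have h2 : ∀ i, HasSum (fun e => aCoef q e * (Tcount R (Mod i) (Mod i₀) e : ℝ))
      (Nat.card (Mod i ≃ₗ[R] Mod i₀) : ℝ) := fun i => by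
    have := hfin i
    exact Tcount_sum hq
  let F : ℕ × ι → ℝ := fun x => aCoef q x.1 * (ν x.2 * (Tcount R (Mod x.2) (Mod i₀) x.1 : ℝ))
  have hF : Summable F := by
    rw [← summable_norm_iff]
    have hn : ∀ e i, ‖F (e, i)‖ = |aCoef q e| * (ν i * (Tcount R (Mod i) (Mod i₀) e : ℝ)) := by
      intro e i
      rw [Real.norm_eq_abs, abs_mul, abs_of_nonneg (mul_nonneg (hν0 i) (Nat.cast_nonneg _))]
    rw [summable_prod_of_nonneg (fun _ => norm_nonneg _)]
    constructor
    · intro e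
      simp_rw [hn]
      exact (h1 e).summable.mul_left _
    · simp_rw [hn, tsum_mul_left, (h1 _).tsum_eq]
      have := (summable_aCoef hq (q ^ t)).norm
      refine this.congr fun e => ?_
      rw [Real.norm_eq_abs, abs_mul, abs_of_nonneg (by positivity : 0 ≤ (q ^ t) ^ e)]
  have s1 := hF.hasSum.prod_fiberwise (g := fun e => aCoef q e * (q ^ t) ^ e)
    (fun e => (h1 e).mul_left _)
  have s2 := ((Equiv.prodComm ι ℕ).hasSum_iff.2 hF.hasSum).prod_fiberwise
    (g := fun i => ν i * (Nat.card (Mod i ≃ₗ[R] Mod i₀) : ℝ)) (fun i => by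
      have := (h2 i).mul_left (ν i)
      have heq : (fun e => (F ∘ (Equiv.prodComm ι ℕ)) (i, e)) =
          fun e => ν i * (aCoef q e * (Tcount R (Mod i) (Mod i₀) e : ℝ)) := by
        funext e
        change aCoef q e * (ν i * (Tcount R (Mod i) (Mod i₀) e : ℝ)) = _
        ring
      rw [heq]
      exact this)
  have s3 : HasSum (fun i => ν i * (Nat.card (Mod i ≃ₗ[R] Mod i₀) : ℝ))
      (ν i₀ * (numAut R (Mod i₀) : ℝ)) := by
    apply hasSum_single i₀
    intro i hi
    have : IsEmpty (Mod i ≃ₗ[R] Mod i₀) := ⟨fun e => hi (hirr i i₀ ⟨e⟩)⟩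
    simp
  rw [s3.unique s2, Gfun, s1.tsum_eq]

end core

theorem statement11 (p : ℕ) [Fact p.Prime] (R : Type) [CommRing R] [IsLocalRing R]
    [Algebra ℤ_[p] R] (hinj : Function.Injective (algebraMap ℤ_[p] R))
    [Module.Finite ℤ_[p] R] [Finite (ResidueField R)]
    (hq : 3 ≤ Nat.card (ResidueField R))
    -- `Mod : ι → ModuleCat R` is a complete irredundant family of representatives of the
    -- isomorphism classes of all finite `R`-modules:
    (ι : Type) (Mod : ι → ModuleCat.{0} R)
    (hfin : ∀ i, Finite (Mod i))
    (hcomplete : ∀ (M : Type) [AddCommGroup M] [Module R M], Finite M →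
      ∃ i, Nonempty (M ≃ₗ[R] Mod i))
    (hirr : ∀ i j, Nonempty ((Mod i : Type) ≃ₗ[R] Mod j) → i = j)
    (ν : ι → ℝ) (hν0 : ∀ i, 0 ≤ ν i) (hνsum : Summable ν)
    (hmom : ∀ (M₀ : Type) [AddCommGroup M₀] [Module R M₀], Finite M₀ →
      HasSum (fun i => ν i * (numSurj R (Mod i) M₀ : ℝ)) 1) :
    ∀ i, (OccursAsCokernel R (Mod i) → ν i = cConst R / (numAut R (Mod i) : ℝ)) ∧
      (¬ OccursAsCokernel R (Mod i) → ν i = 0) := by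
  classical
  have hq1 : 1 < (Nat.card (ResidueField R) : ℝ) := by
    exact_mod_cast (by omega : 1 < Nat.card (ResidueField R))
  have hnoe : IsNoetherianRing R := IsNoetherianRing.of_finite ℤ_[p] R
  intro i
  have := hfin i
  have haut : (numAut R (Mod i) : ℝ) ≠ 0 := by
    have : Finite (Mod i ≃ₗ[R] Mod i) := DFunLike.finite _
    exact_mod_cast (Nat.card_pos (α := Mod i ≃ₗ[R] Mod i)).ne'
  have hge : ∀ (n : ℕ) (π : (Fin n → R) →ₗ[R] Mod i), Function.Surjective π →
      n ≤ hdim R (LinearMap.ker π) := by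
    intro n π hπ
    obtain ⟨f, hf⟩ := exists_gens_s11 (R := R) (K := LinearMap.ker π)
    have hfq : Finite ((Fin n → R) ⧸ LinearMap.ker π) :=
      Finite.of_equiv _ (π.quotKerEquivOfSurjective hπ).symm.toEquiv
    exact rank_bound p R hinj n _ _ hfq f hf
  constructor
  · rintro ⟨n, hn, G, ⟨e⟩⟩
    let π : (Fin n → R) →ₗ[R] Mod i := e.toLinearMap ∘ₗ (LinearMap.range G).mkQ
    have hπ : Function.Surjective π := e.surjective.comp (Submodule.mkQ_surjective _)
    have hker : LinearMap.ker π = LinearMap.range G := by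
      simp [π, LinearEquiv.ker_comp]
    have h1 := hge n π hπ
    have h2 : hdim R (LinearMap.ker π) ≤ n := by
      rw [hker]
      exact hdim_le n G.rangeRestrict G.surjective_rangeRestrict
    have h3 := core hq1 ι Mod hfin hirr ν hν0 hmom i n 0 π hπ (by omega)
    rw [pow_zero, Gfun_one hq1] at h3
    rw [eq_div_iff haut, h3, cConst]
  · intro hnot
    obtain ⟨m, π₀, hπ₀⟩ := Module.Finite.exists_fin' R (Mod i)
    obtain ⟨n, hn, π, hπ⟩ : ∃ n : ℕ, 0 < n ∧ ∃ π : (Fin n → R) →ₗ[R] Mod i,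
        Function.Surjective π := by
      refine ⟨m + 1, Nat.succ_pos _, π₀ ∘ₗ LinearMap.funLeft R R Fin.castSucc, ?_⟩
      exact hπ₀.comp (LinearMap.funLeft_surjective_of_injective R R _ (Fin.castSucc_injective m))
    have h1 := hge n π hπ
    have h2 : hdim R (LinearMap.ker π) ≠ n := by
      intro h
      apply hnot
      have hex : ∃ f : (Fin n → R) →ₗ[R] LinearMap.ker π, Function.Surjective f := by
        have := exists_gens_s11 (R := R) (K := LinearMap.ker π)
        rwa [h] at this
      obtain ⟨f, hf⟩ := hex
      refine ⟨n, hn, (LinearMap.ker π).subtype ∘ₗ f, ⟨?_⟩⟩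
      have hr : LinearMap.range ((LinearMap.ker π).subtype ∘ₗ f) = LinearMap.ker π := by
        rw [LinearMap.range_comp, LinearMap.range_eq_top.2 hf, Submodule.map_top,
          Submodule.range_subtype]
      exact (Submodule.quotEquivOfEq _ _ hr).trans (π.quotKerEquivOfSurjective hπ)
    obtain ⟨t, ht⟩ := Nat.exists_eq_add_of_lt (lt_of_le_of_ne h1 (Ne.symm h2))
    have h3 := core hq1 ι Mod hfin hirr ν hν0 hmom i n (t + 1) π hπ (by omega)
    rw [Gfun_pow hq1] at h3
    exact (mul_eq_zero.1 h3).resolve_right haut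
end

section
/- Write q = |F_R|. For every integer d ≥ 0, the sum over isomorphism classes of finite R-modules M with d_M ≤ d of the quantity [∏_{j=1}^{d−d_M} (1 − q^{−j})^{−1}] / (|M|^d · #Aut_R(M)) converges and equals c_R^{−1} = ∏_{i=1}^∞ (1 − q^{−i})^{−1}. -/
/- STATEMENT 12: Write q = |F_R|.  For every integer d ≥ 0, the sum over isomorphism
   classes of finite R-modules M with d_M ≤ d of
   [∏_{j=1}^{d−d_M} (1 − q^{−j})^{−1}] / (|M|^d · #Aut_R(M))
   converges and equals c_R^{−1} = ∏_{i=1}^∞ (1 − q^{−i})^{−1}.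

   Here d_M = dim_{F_R} Tor_1^R(M, F_R) − dim_{F_R}(M ⊗_R F_R) (a nonnegative
   quantity); dimensions over F_R of these finite F_R-vector spaces are expressed as
   base-q logarithms of cardinalities.  The sum over isomorphism classes is expressed by
   a complete irredundant family of representatives of all finite R-modules, restricted
   to the subfamily with d_M ≤ d. -/

open IsLocalRing CategoryTheory

/-- `Tor_1^R(M, N)` (as an object of `ModuleCat R`). -/
noncomputable def tor1 (R : Type) [CommRing R] (M : Type) [AddCommGroup M] [Module R M]
    (N : Type) [AddCommGroup N] [Module R N] : ModuleCat R :=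
  ((Tor (ModuleCat R) 1).obj (ModuleCat.of R M)).obj (ModuleCat.of R N)

/-- The dimension over the residue field `F_R` of a finite module `X` which is an
`F_R`-vector space: the base-`|F_R|` logarithm of its cardinality. -/
noncomputable def resDim (R : Type) [CommRing R] [IsLocalRing R] (X : Type) : ℕ :=
  Nat.log (Nat.card (ResidueField R)) (Nat.card X)

/-- `d_M = dim_{F_R} Tor_1^R(M, F_R) − dim_{F_R}(M ⊗_R F_R)`. -/
noncomputable def dInv (R : Type) [CommRing R] [IsLocalRing R]
    (M : Type) [AddCommGroup M] [Module R M] : ℕ :=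
  resDim R (tor1 R M (ResidueField R)) - resDim R (TensorProduct R M (ResidueField R))

theorem snake_card {R : Type} [CommRing R]
    {A2 A1 A0 AF K1 K0 KF M2 M1 M0 : Type}
    [AddCommGroup A2] [AddCommGroup A1] [AddCommGroup A0] [AddCommGroup AF]
    [AddCommGroup K1] [AddCommGroup K0] [AddCommGroup KF]
    [AddCommGroup M2] [AddCommGroup M1] [AddCommGroup M0]
    [Module R A2] [Module R A1] [Module R A0] [Module R AF]
    [Module R K1] [Module R K0] [Module R KF]
    [Module R M2] [Module R M1] [Module R M0]
    (a2 : A2 →ₗ[R] A1) (a1 : A1 →ₗ[R] A0) (a0 : A0 →ₗ[R] AF)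
    (ha21 : Function.Exact a2 a1) (ha10 : Function.Exact a1 a0)
    (k1 : K1 →ₗ[R] K0) (k0 : K0 →ₗ[R] KF)
    (hk : Function.Exact k1 k0) (hks : Function.Surjective k0)
    (m2 : M2 →ₗ[R] M1) (m1 : M1 →ₗ[R] M0)
    (i1 : K1 →ₗ[R] A1) (i0 : K0 →ₗ[R] A0) (iF : KF →ₗ[R] AF) (hi0 : Function.Injective i0)
    (s2 : A2 →ₗ[R] M2) (s1 : A1 →ₗ[R] M1) (s0 : A0 →ₗ[R] M0)
    (hs2 : Function.Surjective s2) (hs1 : Function.Surjective s1)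
    (he1 : Function.Exact i1 s1) (he0 : Function.Exact i0 s0)
    (c1 : ∀ x, i0 (k1 x) = a1 (i1 x)) (c0 : ∀ x, iF (k0 x) = a0 (i0 x))
    (d2 : ∀ x, s1 (a2 x) = m2 (s2 x)) (d1 : ∀ x, s0 (a1 x) = m1 (s1 x))
    {H : Type} [AddCommGroup H] [Module R H] (h : LinearMap.ker m1 →ₗ[R] H)
    (hh : Function.Surjective h) (hker : ∀ x, h x = 0 ↔ ∃ y, m2 y = x.1) :
    Nonempty (H ≃ₗ[R] LinearMap.ker iF) := by
  let Z : Submodule R (A1 × K0) := LinearMap.eqLocus (a1 ∘ₗ LinearMap.fst R A1 K0)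
    (i0 ∘ₗ LinearMap.snd R A1 K0)
  have hZ : ∀ z : Z, a1 z.1.1 = i0 z.1.2 := fun z => z.2
  let α : Z →ₗ[R] H := h ∘ₗ (LinearMap.codRestrict (LinearMap.ker m1)
    (s1 ∘ₗ LinearMap.fst R A1 K0 ∘ₗ Z.subtype) (by
      intro z
      change m1 (s1 z.1.1) = 0
      rw [← d1, hZ]
      exact he0.apply_apply_eq_zero _))
  let β : Z →ₗ[R] LinearMap.ker iF := LinearMap.codRestrict (LinearMap.ker iF)
    (k0 ∘ₗ LinearMap.snd R A1 K0 ∘ₗ Z.subtype) (by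
      intro z
      change iF (k0 z.1.2) = 0
      rw [c0, ← hZ]
      exact ha10.apply_apply_eq_zero _)
  have hα : Function.Surjective α := by
    intro y
    obtain ⟨⟨x, hx⟩, rfl⟩ := hh y
    obtain ⟨a, rfl⟩ := hs1 x
    have : s0 (a1 a) = 0 := by rw [d1]; exact hx
    obtain ⟨k, hk'⟩ := (he0 _).1 this
    exact ⟨⟨(a, k), hk'.symm⟩, rfl⟩
  have hβ : Function.Surjective β := by
    rintro ⟨y, hy⟩
    obtain ⟨k, rfl⟩ := hks y
    have : a0 (i0 k) = 0 := by rw [← c0]; exact hy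
    obtain ⟨a, ha⟩ := (ha10 _).1 this
    exact ⟨⟨(a, k), ha⟩, rfl⟩
  have hab : LinearMap.ker α = LinearMap.ker β := by
    ext ⟨⟨a, k⟩, hz⟩
    have hz' : a1 a = i0 k := hz
    have e1 : (⟨(a, k), hz⟩ : Z) ∈ LinearMap.ker α ↔ ∃ y, m2 y = s1 a := hker _
    have e2 : (⟨(a, k), hz⟩ : Z) ∈ LinearMap.ker β ↔ k0 k = 0 := by
      simp [LinearMap.mem_ker, β]
    rw [e1, e2]
    constructor
    · rintro ⟨y, hy⟩
      obtain ⟨x, rfl⟩ := hs2 y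
      have : s1 (a - a2 x) = 0 := by rw [map_sub, d2, hy, sub_self]
      obtain ⟨z, hz2⟩ := (he1 _).1 this
      have : i0 (k1 z) = i0 k := by
        rw [c1, hz2, map_sub, ha21.apply_apply_eq_zero, sub_zero, hz']
      rw [← hi0 this]
      exact hk.apply_apply_eq_zero _
    · intro h0
      obtain ⟨z, rfl⟩ := (hk _).1 h0
      have : a1 (a - i1 z) = 0 := by rw [map_sub, hz', c1, sub_self]
      obtain ⟨x, hx⟩ := (ha21 _).1 this
      refine ⟨s2 x, ?_⟩
      rw [← d2, hx, map_sub, he1.apply_apply_eq_zero, sub_zero]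
  exact ⟨(α.quotKerEquivOfSurjective hα).symm ≪≫ₗ Submodule.quotEquivOfEq _ _ hab ≪≫ₗ
    β.quotKerEquivOfSurjective hβ⟩

theorem tor1_equiv {R : Type} [CommRing R] {A M N : Type} [AddCommGroup A] [Module R A]
    [AddCommGroup M] [Module R M] [AddCommGroup N] [Module R N] [Module.Flat R A]
    (φ : A →ₗ[R] M) (hφ : Function.Surjective φ) :
    Nonempty (tor1 R M N ≃ₗ[R] LinearMap.ker ((LinearMap.ker φ).subtype.rTensor N)) := by
  let P := projectiveResolution (ModuleCat.of R N)
  let F := (MonoidalCategory.tensoringLeft (ModuleCat.{0} R)).obj (ModuleCat.of R M)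
  let C := (F.mapHomologicalComplex _).obj P.complex
  have e1 : tor1 R M N ≅ C.homology 1 := P.isoLeftDerivedObj F 1
  have e2 : C.homology 1 ≅ (C.sc' 2 1 0).homology :=
    ShortComplex.homologyMapIso (C.isoSc' 2 1 0 (by simp) (by simp))
  have e3 := (C.sc' 2 1 0).moduleCatHomologyIso
  let e : tor1 R M N ≃ₗ[R] (LinearMap.ker (C.sc' 2 1 0).g.hom ⧸ LinearMap.range (C.sc' 2 1 0).moduleCatToCycles) := (e1 ≪≫ e2 ≪≫ e3).toLinearEquiv
  let δ2 : P.complex.X 2 →ₗ[R] P.complex.X 1 := (P.complex.d 2 1).hom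
  let δ1 : P.complex.X 1 →ₗ[R] P.complex.X 0 := (P.complex.d 1 0).hom
  let δ0 : P.complex.X 0 →ₗ[R] N := (P.π.f 0).hom
  have hδ0 : Function.Surjective δ0 := (ModuleCat.epi_iff_surjective _).1 (inferInstanceAs (Epi (P.π.f 0)))
  have hδ10 : Function.Exact δ1 δ0 := by
    have := P.exact₀
    rw [ShortComplex.moduleCat_exact_iff_range_eq_ker] at this
    exact LinearMap.exact_iff.2 this.symm
  have hδ21 : Function.Exact δ2 δ1 := by
    have := P.exact_succ 0
    rw [ShortComplex.moduleCat_exact_iff_range_eq_ker] at this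
    exact LinearMap.exact_iff.2 this.symm
  have hflat : ∀ n, Module.Flat R (P.complex.X n) := by
    intro n
    have : Projective (P.complex.X n) := inferInstance
    have : Module.Projective R (P.complex.X n) := (IsProjective.iff_projective _).2 this
    infer_instance
  have := hflat 0
  let σ2 : TensorProduct R A (P.complex.X 2) →ₗ[R] (C.sc' 2 1 0).X₁ := φ.rTensor (P.complex.X 2)
  let σ1 : TensorProduct R A (P.complex.X 1) →ₗ[R] (C.sc' 2 1 0).X₂ := φ.rTensor (P.complex.X 1)
  let σ0 : TensorProduct R A (P.complex.X 0) →ₗ[R] (C.sc' 2 1 0).X₃ := φ.rTensor (P.complex.X 0)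
  have hσ2 : ∀ x, φ.rTensor (P.complex.X 1) (δ2.lTensor A x) =
      δ2.lTensor M (φ.rTensor (P.complex.X 2) x) :=
    fun x => by rw [← LinearMap.comp_apply, ← LinearMap.comp_apply]; simp
  have hσ1 : ∀ x, φ.rTensor (P.complex.X 0) (δ1.lTensor A x) =
      δ1.lTensor M (φ.rTensor (P.complex.X 1) x) :=
    fun x => by rw [← LinearMap.comp_apply, ← LinearMap.comp_apply]; simp
  obtain ⟨e'⟩ := snake_card (R := R) (δ2.lTensor A) (δ1.lTensor A) (δ0.lTensor A)
    (Module.Flat.lTensor_exact A hδ21) (Module.Flat.lTensor_exact A hδ10)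
    (δ1.lTensor (LinearMap.ker φ)) (δ0.lTensor (LinearMap.ker φ))
    (lTensor_exact _ hδ10 hδ0) (LinearMap.lTensor_surjective _ hδ0)
    (M2 := (C.sc' 2 1 0).X₁) (M1 := (C.sc' 2 1 0).X₂) (M0 := (C.sc' 2 1 0).X₃)
    (C.sc' 2 1 0).f.hom (C.sc' 2 1 0).g.hom
    ((LinearMap.ker φ).subtype.rTensor _) ((LinearMap.ker φ).subtype.rTensor _)
    ((LinearMap.ker φ).subtype.rTensor _)
    (Module.Flat.rTensor_preserves_injective_linearMap _ (Submodule.subtype_injective _))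
    σ2 σ1 σ0
    (LinearMap.rTensor_surjective _ hφ) (LinearMap.rTensor_surjective _ hφ)
    (rTensor_exact _ (LinearMap.exact_subtype_ker_map φ) hφ)
    (rTensor_exact _ (LinearMap.exact_subtype_ker_map φ) hφ)
    (fun x => by rw [← LinearMap.comp_apply, ← LinearMap.comp_apply]; simp)
    (fun x => by rw [← LinearMap.comp_apply, ← LinearMap.comp_apply]; simp)
    hσ2 hσ1
    (H := LinearMap.ker (C.sc' 2 1 0).g.hom ⧸ LinearMap.range (C.sc' 2 1 0).moduleCatToCycles)
    (LinearMap.range (C.sc' 2 1 0).moduleCatToCycles).mkQ (Submodule.mkQ_surjective _)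
    (fun x => by
      rw [Submodule.mkQ_apply, Submodule.Quotient.mk_eq_zero, LinearMap.mem_range]
      exact exists_congr fun y => Subtype.ext_iff)
  exact ⟨e ≪≫ₗ e'⟩

/-- probability that `m` random vectors span an `e`-dimensional space over a field of size `q`. -/
noncomputable def spanProb (q m e : ℕ) : ℝ := ∏ i ∈ Finset.range e, (1 - (q : ℝ) ^ i / (q : ℝ) ^ m)

/-- minimal number of generators. -/
noncomputable def genRk (R : Type) [CommRing R] [IsLocalRing R]
    (N : Type) [AddCommGroup N] [Module R N] : ℕ :=
  Module.finrank (ResidueField R) (TensorProduct R (ResidueField R) N)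

theorem span_count_field {F : Type} [Field F] [Finite F] (m e : ℕ) :
    (Nat.card {w : Fin m → (Fin e → F) // Submodule.span F (Set.range w) = ⊤} : ℝ) =
      ((Nat.card F : ℝ) ^ e) ^ m * spanProb (Nat.card F) m e := by
  have hq : 1 < Nat.card F := Finite.one_lt_card
  have hq0 : (Nat.card F : ℝ) ≠ 0 := by positivity
  have key : Nat.card {w : Fin m → (Fin e → F) // Submodule.span F (Set.range w) = ⊤} =
      Nat.card {s : Fin e → (Fin m → F) // LinearIndependent F s} := by
    apply Nat.card_congr
    refine (Equiv.piComm (fun (_ : Fin m) (_ : Fin e) => F)).subtypeEquiv ?_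
    intro w
    let A : Matrix (Fin e) (Fin m) F := Matrix.of (fun i j => w j i)
    have h1 : A.rank = Module.finrank F (Submodule.span F (Set.range w)) :=
      Matrix.rank_eq_finrank_span_cols A
    have h2 : A.rank = Module.finrank F (Submodule.span F (Set.range A.row)) :=
      Matrix.rank_eq_finrank_span_row A
    have h3 : (Equiv.piComm (fun (_ : Fin m) (_ : Fin e) => F)) w = A.row := rfl
    rw [h3, linearIndependent_iff_card_eq_finrank_span, Set.finrank, ← h2, h1, Fintype.card_fin]
    constructor
    · intro h; rw [h]; simp
    · intro h
      apply Submodule.eq_top_of_finrank_eq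
      rw [← h]; simp
  rw [key]
  have : Fintype F := Fintype.ofFinite F
  by_cases hem : e ≤ m
  · rw [card_linearIndependent (K := F) (V := Fin m → F) (by simpa using hem)]
    rw [Module.finrank_fin_fun, ← Nat.card_eq_fintype_card (α := F), spanProb, Finset.prod_range,
      ← pow_mul, mul_comm e m, pow_mul]
    push_cast
    rw [← Fin.prod_const e ((Nat.card F : ℝ) ^ m), ← Finset.prod_mul_distrib]
    refine Finset.prod_congr rfl fun i _ => ?_
    rw [Nat.cast_sub (Nat.pow_le_pow_right hq.le (by omega))]
    push_cast
    field_simp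
  · have h0 : spanProb (Nat.card F) m e = 0 := by
      rw [spanProb]
      refine Finset.prod_eq_zero (i := m) (by simpa using hem) ?_
      rw [div_self (by positivity), sub_self]
    rw [h0, mul_zero]
    have : IsEmpty {s : Fin e → (Fin m → F) // LinearIndependent F s} := by
      constructor
      rintro ⟨s, hs⟩
      have := hs.fintype_card_le_finrank
      simp at this
      omega
    simp

/-- fibres of a surjective additive map on tuples. -/
theorem card_tuples_of_surj {N V : Type} [AddCommGroup N] [AddCommGroup V] [Finite N]
    (f : N →+ V) (hf : Function.Surjective f) (m : ℕ) (Q : (Fin m → V) → Prop) :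
    Nat.card {v : Fin m → N // Q (f ∘ v)} = Nat.card f.ker ^ m * Nat.card {w : Fin m → V // Q w} := by
  have e : ∀ w : {w : Fin m → V // Q w}, {v : Fin m → N // f ∘ v = w.1} ≃ (Fin m → f.ker) := by
    intro w
    choose g hg using hf
    refine ⟨fun v i => ⟨v.1 i - g (w.1 i), ?_⟩, fun u => ⟨fun i => (u i).1 + g (w.1 i), ?_⟩, ?_, ?_⟩
    · have := congrFun v.2 i
      simp only [Function.comp_apply] at this
      simp [AddMonoidHom.mem_ker, hg, this]
    · ext i
      simp [hg, (AddMonoidHom.mem_ker).1 (u i).2]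
    · intro v; ext i; simp
    · intro u; ext i; simp
  have e2 : {v : Fin m → N // Q (f ∘ v)} ≃ (w : {w : Fin m → V // Q w}) × {v : Fin m → N // f ∘ v = w.1} :=
    ⟨fun v => ⟨⟨f ∘ v.1, v.2⟩, ⟨v.1, rfl⟩⟩, fun x => ⟨x.2.1, by rw [x.2.2]; exact x.1.2⟩,
      fun v => rfl, by rintro ⟨⟨w, hw⟩, ⟨v, hv⟩⟩; dsimp at hv; subst hv; rfl⟩
  rw [Nat.card_congr (e2.trans (Equiv.sigmaCongrRight e)), Nat.card_congr (Equiv.sigmaEquivProd _ _),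
    Nat.card_prod, Nat.card_fun, Nat.card_fin, mul_comm]

section local_part

set_option linter.unusedSectionVars false
variable {R : Type} [CommRing R] [IsLocalRing R] [Finite (ResidueField R)]

theorem finite_tensor (N : Type) [AddCommGroup N] [Module R N] [Module.Finite R N] :
    Finite (TensorProduct R (ResidueField R) N) :=
  Module.finite_of_finite (ResidueField R)

theorem card_tensor (N : Type) [AddCommGroup N] [Module R N] [Module.Finite R N] :
    Nat.card (TensorProduct R (ResidueField R) N) = Nat.card (ResidueField R) ^ genRk R N :=
  Module.natCard_eq_pow_finrank (K := ResidueField R) (V := TensorProduct R (ResidueField R) N)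

theorem card_tensor' (N : Type) [AddCommGroup N] [Module R N] [Module.Finite R N] :
    Nat.card (TensorProduct R N (ResidueField R)) = Nat.card (ResidueField R) ^ genRk R N := by
  rw [← card_tensor, Nat.card_congr (TensorProduct.comm R N (ResidueField R)).toEquiv]

theorem span_count (N : Type) [AddCommGroup N] [Module R N] [Finite N] (m : ℕ) :
    (Nat.card {v : Fin m → N // Submodule.span R (Set.range v) = ⊤} : ℝ) =
      (Nat.card N : ℝ) ^ m * spanProb (Nat.card (ResidueField R)) m (genRk R N) := by
  have := finite_tensor (R := R) N
  let b : TensorProduct R (ResidueField R) N ≃ₗ[ResidueField R] (Fin (genRk R N) → ResidueField R) :=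
    (Module.finBasis (ResidueField R) (TensorProduct R (ResidueField R) N)).equivFun
  let g : N →ₗ[R] (Fin (genRk R N) → ResidueField R) :=
    (b.toLinearMap.restrictScalars R) ∘ₗ (TensorProduct.mk R (ResidueField R) N 1)
  have hg : Function.Surjective g :=
    b.surjective.comp (TensorProduct.mk_surjective R N _ Ideal.Quotient.mk_surjective)
  have hiff : ∀ v : Fin m → N, Submodule.span R (Set.range v) = ⊤ ↔
      Submodule.span (ResidueField R) (Set.range (g ∘ v)) = ⊤ := by
    intro v
    rw [← IsLocalRing.map_tensorProduct_mk_eq_top, Submodule.map_span, ← Submodule.restrictScalars_span R (ResidueField R)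
      Ideal.Quotient.mk_surjective, Submodule.restrictScalars_eq_top_iff]
    have : Set.range (g ∘ v) = b '' ((TensorProduct.mk R (ResidueField R) N 1) '' Set.range v) := by
      rw [← Set.range_comp, ← Set.range_comp]; rfl
    rw [this]
    have h2 := Submodule.map_span b.toLinearMap ((TensorProduct.mk R (ResidueField R) N 1) '' Set.range v)
    have h3 : (b.toLinearMap '' ((TensorProduct.mk R (ResidueField R) N 1) '' Set.range v)) = b '' ((TensorProduct.mk R (ResidueField R) N 1) '' Set.range v) := rfl
    rw [← h3, ← h2]
    constructor
    · intro h; rw [h, Submodule.map_top, LinearMap.range_eq_top]; exact b.surjective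
    · intro h
      apply Submodule.map_injective_of_injective (f := b.toLinearMap) b.injective
      rw [h, Submodule.map_top, eq_comm, LinearMap.range_eq_top]; exact b.surjective
  have h1 := card_tuples_of_surj g.toAddMonoidHom hg m
    (fun w => Submodule.span (ResidueField R) (Set.range w) = ⊤)
  have h2 : Nat.card {v : Fin m → N // Submodule.span R (Set.range v) = ⊤} =
     Nat.card {v : Fin m → N // Submodule.span (ResidueField R) (Set.range (g.toAddMonoidHom ∘ v)) = ⊤} :=
    Nat.card_congr (Equiv.subtypeEquivRight hiff)
  have h3 : Nat.card N = Nat.card g.toAddMonoidHom.ker * Nat.card (ResidueField R) ^ genRk R N := by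
    rw [AddSubgroup.card_eq_card_quotient_mul_card_addSubgroup g.toAddMonoidHom.ker,
      Nat.card_congr (QuotientAddGroup.quotientKerEquivOfSurjective _ hg).toEquiv, Nat.card_fun,
      Nat.card_fin, mul_comm]
  rw [h2, h1]
  push_cast
  rw [span_count_field, h3]
  push_cast
  ring


theorem rank_le_of_smul_mem_span {R : Type} [CommRing R] (c : R) (hc : ¬ IsNilpotent c) {e n : ℕ}
    (v : Fin e → (Fin n → R)) (h : ∀ x : Fin n → R, c • x ∈ Submodule.span R (Set.range v)) :
    n ≤ e := by
  rw [nilpotent_iff_mem_prime] at hc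
  push Not at hc
  obtain ⟨P, hP, hcP⟩ := hc
  let L := P.ResidueField
  let g : R →+* L := algebraMap R L
  have hg : g c ≠ 0 := by
    intro h0
    exact hcP (Ideal.algebraMap_residueField_eq_zero.1 h0)
  let w : Fin e → (Fin n → L) := fun j i => g (v j i)
  have hmem : ∀ x ∈ Submodule.span R (Set.range v),
      (fun i => g (x i)) ∈ Submodule.span L (Set.range w) := by
    intro x hx
    induction hx using Submodule.span_induction with
    | mem x hx =>
      obtain ⟨j, rfl⟩ := hx
      exact Submodule.subset_span ⟨j, rfl⟩
    | zero => convert Submodule.zero_mem (Submodule.span L (Set.range w)) using 1; ext i; simp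
    | add x y _ _ hx hy => convert Submodule.add_mem _ hx hy using 1; ext i; simp
    | smul a x _ hx => convert Submodule.smul_mem _ (g a) hx using 1; ext i; simp
  have htop : Submodule.span L (Set.range w) = ⊤ := by
    rw [eq_top_iff, ← (Pi.basisFun L (Fin n)).span_eq, Submodule.span_le]
    rintro _ ⟨i, rfl⟩
    have h1 := hmem _ (h (Pi.single i 1))
    have h2 := Submodule.smul_mem _ (g c)⁻¹ h1
    have h3 : (Pi.basisFun L (Fin n)) i = (g c)⁻¹ • fun j => g ((c • (Pi.single i 1 : Fin n → R)) j) := by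
      ext j
      by_cases hij : j = i
      · subst hij; simp; exact (inv_mul_cancel₀ hg).symm
      · simp [hij]
    rw [h3]
    exact h2
  have := finrank_range_le_card (R := L) w
  rw [Set.finrank, htop] at this
  simpa using this

theorem genRk_span (N : Type) [AddCommGroup N] [Module R N] [Module.Finite R N] :
    ∃ f : Fin (genRk R N) → N, Submodule.span R (Set.range f) = ⊤ := by
  let b := Module.finBasis (ResidueField R) (TensorProduct R (ResidueField R) N)
  have hs : Function.Surjective (TensorProduct.mk R (ResidueField R) N 1) :=
    TensorProduct.mk_surjective R N _ Ideal.Quotient.mk_surjective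
  choose g hg using hs
  exact ⟨fun i => g (b i), IsLocalRing.span_eq_top_of_tmul_eq_basis _ b fun i => hg _⟩

theorem card_range_ker {R X Y : Type} [CommRing R] [AddCommGroup X] [AddCommGroup Y] [Module R X]
    [Module R Y] (f : X →ₗ[R] Y) :
    Nat.card X = Nat.card (LinearMap.range f) * Nat.card (LinearMap.ker f) := by
  rw [Submodule.card_eq_card_quotient_mul_card (LinearMap.ker f),
    Nat.card_congr f.quotKerEquivRange.toEquiv]
  try ring

theorem card_surj_ker {R X Y : Type} [CommRing R] [AddCommGroup X] [AddCommGroup Y] [Module R X]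
    [Module R Y] (f : X →ₗ[R] Y) (hf : Function.Surjective f) :
    Nat.card X = Nat.card Y * Nat.card (LinearMap.ker f) := by
  rw [card_range_ker f, LinearMap.range_eq_top.2 hf, Nat.card_congr (Submodule.topEquiv (R := R) (M := Y)).toEquiv]

theorem tor_card {R : Type} [CommRing R] {A M N : Type} [AddCommGroup A] [Module R A]
    [AddCommGroup M] [Module R M] [AddCommGroup N] [Module R N] [Module.Flat R A]
    (φ : A →ₗ[R] M) (hφ : Function.Surjective φ) :
    Nat.card (TensorProduct R A N) * Nat.card (tor1 R M N) =
      Nat.card (TensorProduct R (LinearMap.ker φ) N) * Nat.card (TensorProduct R M N) := by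
  have hT : Nat.card (tor1 R M N) =
      Nat.card (LinearMap.ker ((LinearMap.ker φ).subtype.rTensor N)) := by
    obtain ⟨e⟩ := tor1_equiv (N := N) φ hφ
    exact Nat.card_congr e.toEquiv
  have h1 := card_range_ker ((LinearMap.ker φ).subtype.rTensor N)
  have hex : LinearMap.range ((LinearMap.ker φ).subtype.rTensor N) = LinearMap.ker (φ.rTensor N) :=
    (LinearMap.exact_iff.1 (rTensor_exact N (LinearMap.exact_subtype_ker_map φ) hφ)).symm
  have h2 := card_surj_ker (φ.rTensor N) (LinearMap.rTensor_surjective N hφ)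
  rw [hex] at h1
  rw [h1, h2, hT]
  ring

theorem genRk_ker [IsNoetherianRing R] (c : R) (hc : ¬ IsNilpotent c) {n : ℕ} (M : Type)
    [AddCommGroup M] [Module R M] [Module.Finite R M] (φ : (Fin n → R) →ₗ[R] M)
    (hφ : Function.Surjective φ) (hcM : ∀ x : M, c • x = 0) :
    genRk R (LinearMap.ker φ) = n + dInv R M := by
  set q := Nat.card (ResidueField R) with hqdef
  have hq : 1 < q := Finite.one_lt_card
  set K := LinearMap.ker φ with hKdef
  have hK : Module.Finite R K := inferInstance
  have h3 : Nat.card (TensorProduct R (Fin n → R) (ResidueField R)) = q ^ n := by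
    rw [card_tensor']
    congr 1
    rw [genRk, Module.finrank_baseChange]
    simp
  have h4 : q ^ n * Nat.card (tor1 R M (ResidueField R)) = q ^ (genRk R K + genRk R M) := by
    rw [pow_add, ← card_tensor' (R := R) K, ← card_tensor' (R := R) M, ← h3]
    exact tor_card φ hφ
  have hle : n ≤ genRk R K := by
    obtain ⟨f, hf⟩ := genRk_span (R := R) K
    refine rank_le_of_smul_mem_span c hc (fun i => (f i).1) fun x => ?_
    have hx : c • x ∈ K := by
      rw [LinearMap.mem_ker, map_smul, hcM]
    have h5 : Submodule.map K.subtype (Submodule.span R (Set.range f)) = K := by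
      rw [hf]; simp
    rw [Submodule.map_span, ← Set.range_comp] at h5
    have h6 : (fun i => (f i).1) = K.subtype ∘ f := rfl
    rw [h6, h5]
    exact hx
  have h5 : Nat.card (tor1 R M (ResidueField R)) = q ^ (genRk R K + genRk R M - n) := by
    apply Nat.eq_of_mul_eq_mul_left (pow_pos (zero_lt_one.trans hq) n)
    rw [h4, ← pow_add]
    congr 1
    omega
  have h6 : dInv R M = (genRk R K + genRk R M - n) - genRk R M := by
    rw [dInv, resDim, resDim, card_tensor', h5, Nat.log_pow hq, Nat.log_pow hq]
  change genRk R K = _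
  omega


theorem genRk_eq_of_surj {K W : Type} [AddCommGroup K] [AddCommGroup W] [Module R K] [Module R W]
    [Module.Finite R K] [Module.Finite R W] (g : K →ₗ[R] W) (hg : Function.Surjective g)
    (P : R) (hP : P ∈ maximalIdeal R) (h : ∀ x, g x = 0 → ∃ y, x = P • y) :
    genRk R K = genRk R W := by
  have hsurj := LinearMap.lTensor_surjective (ResidueField R) hg
  have hex := lTensor_exact (ResidueField R) (LinearMap.exact_subtype_ker_map g) hg
  have hzero : ∀ z, (LinearMap.ker g).subtype.lTensor (ResidueField R) z = 0 := by
    intro z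
    induction z using TensorProduct.induction_on with
    | zero => simp
    | tmul a x =>
      obtain ⟨y, hy⟩ := h x.1 x.2
      rw [LinearMap.lTensor_tmul, Submodule.subtype_apply, hy, ← TensorProduct.smul_tmul]
      have : P • a = 0 := by
        rw [Algebra.smul_def, ResidueField.algebraMap_eq, (residue_eq_zero_iff P).2 hP, zero_mul]
      rw [this, TensorProduct.zero_tmul]
    | add x y hx hy => rw [map_add, hx, hy, add_zero]
  have hinj : Function.Injective (g.lTensor (ResidueField R)) := by
    rw [injective_iff_map_eq_zero]
    intro x hx
    obtain ⟨z, rfl⟩ := (hex x).1 hx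
    exact hzero z
  have hc := Nat.card_congr (Equiv.ofBijective _ ⟨hinj, hsurj⟩)
  rw [card_tensor, card_tensor] at hc
  exact Nat.pow_right_injective Finite.one_lt_card hc

/-- the submodule `c R^n`. -/
def scaled {R : Type} [CommRing R] (n : ℕ) (c : R) : Submodule R (Fin n → R) :=
  LinearMap.range (LinearMap.lsmul R (Fin n → R) c)

theorem card_surj_free {M : Type} [AddCommGroup M] [Module R M] [Finite M] (n : ℕ) :
    (Nat.card {f : (Fin n → R) →ₗ[R] M // Function.Surjective f} : ℝ) =
      (Nat.card M : ℝ) ^ n * spanProb (Nat.card (ResidueField R)) n (genRk R M) := by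
  rw [← span_count]
  congr 1
  apply Nat.card_congr
  refine ((Pi.basisFun R (Fin n)).constr R (M' := M)).symm.toEquiv.subtypeEquiv fun f => ?_
  rw [← LinearMap.range_eq_top]
  have h1 : LinearMap.range f = Submodule.span R (Set.range (fun i => f (Pi.basisFun R (Fin n) i))) := by
    rw [LinearMap.range_eq_map, ← (Pi.basisFun R (Fin n)).span_eq, Submodule.map_span, ← Set.range_comp]
    rfl
  rw [h1]
  rfl

theorem card_surj_quot {M : Type} [AddCommGroup M] [Module R M] (n : ℕ) (c : R)
    (hc : ∀ x : M, c • x = 0) :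
    Nat.card {f : ((Fin n → R) ⧸ scaled n c) →ₗ[R] M // Function.Surjective f} =
    Nat.card {f : (Fin n → R) →ₗ[R] M // Function.Surjective f} := by
  apply Nat.card_congr
  refine ⟨fun f => ⟨f.1 ∘ₗ (scaled n c).mkQ, f.2.comp (Submodule.mkQ_surjective _)⟩,
    fun f => ⟨(scaled n c).liftQ f.1 ?_, ?_⟩, ?_, ?_⟩
  · rintro _ ⟨x, rfl⟩
    rw [LinearMap.mem_ker, LinearMap.lsmul_apply, map_smul, hc]
  · intro y
    obtain ⟨x, rfl⟩ := f.2 y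
    exact ⟨(scaled n c).mkQ x, rfl⟩
  · intro f; ext x; rfl
  · intro f; ext x; rfl

theorem card_surj_eq {R V M : Type} [CommRing R] [AddCommGroup V] [Module R V] [AddCommGroup M] [Module R M] :
    Nat.card {f : V →ₗ[R] M // Function.Surjective f} =
      Nat.card {W : Submodule R V // Nonempty ((V ⧸ W) ≃ₗ[R] M)} * numAut R M := by
  have e : {f : V →ₗ[R] M // Function.Surjective f} ≃
      (W : {W : Submodule R V // Nonempty ((V ⧸ W) ≃ₗ[R] M)}) × ((V ⧸ W.1) ≃ₗ[R] M) := by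
    refine ⟨fun f => ⟨⟨LinearMap.ker f.1, ⟨f.1.quotKerEquivOfSurjective f.2⟩⟩,
      f.1.quotKerEquivOfSurjective f.2⟩,
      fun x => ⟨x.2.toLinearMap ∘ₗ x.1.1.mkQ, x.2.surjective.comp (Submodule.mkQ_surjective _)⟩, ?_, ?_⟩
    · intro f; ext x; rfl
    · rintro ⟨⟨W, hW⟩, e⟩
      have hk : LinearMap.ker (e.toLinearMap ∘ₗ W.mkQ) = W := by
        rw [LinearEquiv.ker_comp, Submodule.ker_mkQ]
      have : ∀ (f : V →ₗ[R] M) (hf : Function.Surjective f) (W' : Submodule R V)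
        (hW' : Nonempty ((V ⧸ W') ≃ₗ[R] M)) (e : (V ⧸ W') ≃ₗ[R] M) (hk : LinearMap.ker f = W')
        (hfe : ∀ x, f x = e (W'.mkQ x)),
        (⟨⟨LinearMap.ker f, ⟨f.quotKerEquivOfSurjective hf⟩⟩, f.quotKerEquivOfSurjective hf⟩ :
          (W : {W : Submodule R V // Nonempty ((V ⧸ W) ≃ₗ[R] M)}) × ((V ⧸ W.1) ≃ₗ[R] M)) =
          ⟨⟨W', hW'⟩, e⟩ := by
        intro f hf W' hW' e hk hfe
        subst hk
        congr 1
        ext x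
        obtain ⟨x, rfl⟩ := Submodule.mkQ_surjective _ x
        rw [← hfe]
        rfl
      exact this _ _ _ _ _ hk (fun _ => rfl)
  have e2 : ∀ W : {W : Submodule R V // Nonempty ((V ⧸ W) ≃ₗ[R] M)},
      ((V ⧸ W.1) ≃ₗ[R] M) ≃ (M ≃ₗ[R] M) := fun W =>
    ⟨fun g => W.2.some.symm ≪≫ₗ g, fun g => W.2.some ≪≫ₗ g, fun g => by ext; simp,
      fun g => by ext; simp⟩
  rw [Nat.card_congr (e.trans (Equiv.sigmaCongrRight e2)), Nat.card_congr (Equiv.sigmaEquivProd _ _),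
    Nat.card_prod, numAut]

theorem card_spanning_tuples {V : Type} [AddCommGroup V] [Module R V] [Finite V]
    (W : Submodule R V) (m : ℕ) :
    (Nat.card {v : Fin m → V // Submodule.span R (Set.range v) = W} : ℝ) =
      (Nat.card W : ℝ) ^ m * spanProb (Nat.card (ResidueField R)) m (genRk R W) := by
  rw [← span_count]
  congr 1
  apply Nat.card_congr
  have key : ∀ v : Fin m → W, Submodule.map W.subtype (Submodule.span R (Set.range v)) =
      Submodule.span R (Set.range fun i => (v i).1) := by
    intro v
    rw [Submodule.map_span, ← Set.range_comp]
    rfl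
  refine ⟨fun v => ⟨fun i => ⟨v.1 i, ?_⟩, ?_⟩, fun v => ⟨fun i => (v.1 i).1, ?_⟩, fun v => rfl,
    fun v => rfl⟩
  · exact v.2.le (Submodule.subset_span ⟨i, rfl⟩)
  · apply Submodule.map_injective_of_injective W.subtype_injective
    rw [key, Submodule.map_top, Submodule.range_subtype]
    exact v.2
  · rw [← key, v.2, Submodule.map_top, Submodule.range_subtype]

theorem genRk_sub [IsNoetherianRing R] (P : R) (hPn : ¬ IsNilpotent P) (hP : P ∈ maximalIdeal R)
    {n j : ℕ} {M : Type} [AddCommGroup M] [Module R M] [Finite M]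
    (hM : ∀ x : M, P ^ j • x = 0)
    (W : Submodule R ((Fin n → R) ⧸ scaled n (P ^ (j + 1))))
    (e : (((Fin n → R) ⧸ scaled n (P ^ (j + 1))) ⧸ W) ≃ₗ[R] M) :
    genRk R W = n + dInv R M := by
  let φ : (Fin n → R) →ₗ[R] M := e.toLinearMap ∘ₗ W.mkQ ∘ₗ (scaled n (P ^ (j + 1))).mkQ
  have hφ : Function.Surjective φ :=
    e.surjective.comp ((Submodule.mkQ_surjective _).comp (Submodule.mkQ_surjective _))
  rw [← genRk_ker (P ^ j) (fun h => hPn h.of_pow) M φ hφ hM]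
  have hmem : ∀ x : Fin n → R, x ∈ LinearMap.ker φ ↔ (scaled n (P ^ (j + 1))).mkQ x ∈ W := by
    intro x
    rw [LinearMap.mem_ker]
    simp [φ]
  let g : LinearMap.ker φ →ₗ[R] W := ((scaled n (P ^ (j + 1))).mkQ ∘ₗ (LinearMap.ker φ).subtype).codRestrict W
    (fun x => (hmem x.1).1 x.2)
  symm
  refine genRk_eq_of_surj g ?_ P hP ?_
  · rintro ⟨w, hw⟩
    obtain ⟨x, rfl⟩ := Submodule.mkQ_surjective _ w
    exact ⟨⟨x, (hmem x).2 hw⟩, rfl⟩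
  · rintro ⟨x, hx⟩ h0
    have h1 : x ∈ scaled n (P ^ (j + 1)) := by
      have := congrArg Subtype.val h0
      exact (Submodule.Quotient.mk_eq_zero _).1 this
    obtain ⟨y, hy⟩ := h1
    refine ⟨⟨P ^ j • y, ?_⟩, ?_⟩
    · rw [LinearMap.mem_ker, map_smul, hM]
    · ext1
      change x = P • P ^ j • y
      rw [← hy, LinearMap.lsmul_apply, smul_smul, ← pow_succ']

theorem count_main [IsNoetherianRing R] (P : R) (hPn : ¬ IsNilpotent P) (hP : P ∈ maximalIdeal R)
    (n m j : ℕ) [Finite ((Fin n → R) ⧸ scaled n (P ^ (j + 1)))]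
    (M : Type) [AddCommGroup M] [Module R M] [Finite M] (hM : ∀ x : M, P ^ j • x = 0) :
    (Nat.card {v : Fin m → ((Fin n → R) ⧸ scaled n (P ^ (j + 1))) //
      Nonempty ((_ ⧸ Submodule.span R (Set.range v)) ≃ₗ[R] M)} : ℝ) * (Nat.card M : ℝ) ^ m * numAut R M =
    (Nat.card ((Fin n → R) ⧸ scaled n (P ^ (j + 1))) : ℝ) ^ m *
      ((Nat.card M : ℝ) ^ n * spanProb (Nat.card (ResidueField R)) n (genRk R M)) *
      spanProb (Nat.card (ResidueField R)) m (n + dInv R M) := by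
  set V := (Fin n → R) ⧸ scaled n (P ^ (j + 1)) with hV
  have hM' : ∀ x : M, P ^ (j + 1) • x = 0 := fun x => by rw [pow_succ', mul_smul, hM, smul_zero]
  rw [← card_surj_free, ← card_surj_quot n (P ^ (j + 1)) hM', card_surj_eq]
  have e : {v : Fin m → V // Nonempty ((_ ⧸ Submodule.span R (Set.range v)) ≃ₗ[R] M)} ≃
      (W : {W : Submodule R V // Nonempty ((V ⧸ W) ≃ₗ[R] M)}) ×
        {v : Fin m → V // Submodule.span R (Set.range v) = W.1} :=
    ⟨fun v => ⟨⟨_, v.2⟩, ⟨v.1, rfl⟩⟩, fun x => ⟨x.2.1, by rw [x.2.2]; exact x.1.2⟩,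
      fun v => rfl, by rintro ⟨⟨W, hW⟩, ⟨v, hv⟩⟩; dsimp at hv; subst hv; rfl⟩
  have : Finite (Submodule R V) := Finite.of_injective (fun W => (W : Set V)) SetLike.coe_injective
  have : Fintype {W : Submodule R V // Nonempty ((V ⧸ W) ≃ₗ[R] M)} := Fintype.ofFinite _
  rw [Nat.card_congr e, Nat.card_sigma]
  push_cast
  have hterm : ∀ W : {W : Submodule R V // Nonempty ((V ⧸ W) ≃ₗ[R] M)},
      (Nat.card {v : Fin m → V // Submodule.span R (Set.range v) = W.1} : ℝ) * (Nat.card M : ℝ) ^ m =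
        (Nat.card V : ℝ) ^ m * spanProb (Nat.card (ResidueField R)) m (n + dInv R M) := by
    rintro ⟨W, ⟨e⟩⟩
    rw [card_spanning_tuples, genRk_sub P hPn hP hM W e,
      Submodule.card_eq_card_quotient_mul_card W, Nat.card_congr e.toEquiv]
    push_cast
    ring
  rw [Finset.sum_mul, Finset.sum_congr rfl fun W _ => hterm W, Finset.sum_const, Finset.card_univ,
    ← Nat.card_eq_fintype_card, nsmul_eq_mul]
  ring

end local_part


theorem exists_monic_aeval {A V : Type} [CommRing A] [Nontrivial A] [AddCommGroup V] [Module A V] {D : ℕ}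
    (π : (Fin D → A) →ₗ[A] V) (hπ : Function.Surjective π) (f : V →ₗ[A] V) :
    ∃ χ : Polynomial A, χ.Monic ∧ χ.natDegree = D ∧ Polynomial.aeval f χ = 0 := by
  obtain ⟨g, hg⟩ := Module.projective_lifting_property π (f ∘ₗ π) hπ
  have hg' : ∀ x, π (g x) = f (π x) := fun x => LinearMap.congr_fun hg x
  refine ⟨g.charpoly, g.charpoly_monic, by rw [LinearMap.charpoly_natDegree, Module.finrank_fin_fun], ?_⟩
  have key : ∀ (χ : Polynomial A) (x : Fin D → A),
      π (Polynomial.aeval g χ x) = Polynomial.aeval f χ (π x) := by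
    intro χ
    induction χ using Polynomial.induction_on' with
    | add p q hp hq => intro x; simp [hp, hq]
    | monomial k a =>
      intro x
      have : ∀ k x, π ((g ^ k) x) = (f ^ k) (π x) := by
        intro k
        induction k with
        | zero => intro x; simp
        | succ k ih => intro x; rw [pow_succ, pow_succ, Module.End.mul_apply, ih, hg', Module.End.mul_apply]
      simp [Polynomial.aeval_monomial, Module.algebraMap_end_eq_smul_id, this]
  ext y
  obtain ⟨x, rfl⟩ := hπ y
  rw [← key, LinearMap.aeval_self_charpoly]
  simp

theorem eval_smul_mem {A V : Type} [CommRing A] [AddCommGroup V] [Module A V] (f : V →ₗ[A] V)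
    (χ : Polynomial A) (hχ : Polynomial.aeval f χ = 0) (t : A) (y : V) :
    ∃ z, χ.eval (-t) • y = f z + t • z := by
  obtain ⟨h, hh⟩ := Polynomial.X_sub_C_dvd_sub_C_eval (a := -t) (p := χ)
  have h1 := congrArg (fun P => Polynomial.aeval f P y) hh
  simp [hχ, Module.algebraMap_end_eq_smul_id] at h1
  refine ⟨- (Polynomial.aeval f h y), ?_⟩
  rw [map_neg, smul_neg, ← neg_add, ← h1, neg_neg]

theorem padic_dvd_or (p : ℕ) [Fact p.Prime] (a : ℤ_[p]) (j : ℕ) :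
    a ∣ (p : ℤ_[p]) ^ j ∨ (p : ℤ_[p]) ^ (j + 1) ∣ a := by
  by_cases ha : a = 0
  · right; rw [ha]; exact dvd_zero _
  · have h := PadicInt.unitCoeff_spec ha
    by_cases hv : a.valuation ≤ j
    · left
      rw [h, Units.mul_left_dvd]
      exact pow_dvd_pow _ hv
    · right
      rw [h]
      exact (pow_dvd_pow _ (by omega)).mul_left _

theorem few_roots (p : ℕ) [Fact p.Prime] (D T : ℕ) : ∃ j : ℕ, ∀ χ : Polynomial ℤ_[p], χ.Monic →
    χ.natDegree = D → ∀ s : Finset ℕ, s ⊆ Finset.range T →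
    (∀ t ∈ s, (p : ℤ_[p]) ^ (j + 1) ∣ χ.eval (-(t : ℤ_[p]))) → s.card ≤ D := by
  have hp1 : (1 : ℝ) < p := by exact_mod_cast (Fact.out : p.Prime).one_lt
  obtain ⟨N, hN⟩ : ∃ N, T < p ^ N := ⟨T, Nat.lt_pow_self (Fact.out : p.Prime).one_lt⟩
  refine ⟨N * D, fun χ hmon hdeg s hs hdvd => ?_⟩
  by_contra hcard
  push Not at hcard
  obtain ⟨s', hs's, hs'⟩ := Finset.exists_subset_card_eq (Nat.succ_le_of_lt hcard)
  let ψ : Polynomial ℚ_[p] := χ.map PadicInt.Coe.ringHom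
  have hψ : ψ.Monic := hmon.map _
  have hψd : ψ.natDegree = D := by rw [hmon.natDegree_map, hdeg]
  have hsum := Lagrange.leadingCoeff_eq_sum (s := s') (v := fun t : ℕ => (-(t : ℚ_[p])))
    (fun a _ b _ h => by simpa using h) (P := ψ) (by
      rw [Polynomial.degree_eq_natDegree hψ.ne_zero, hψd, hs']; rfl)
  rw [hψ.leadingCoeff] at hsum
  have hne : s'.Nonempty := Finset.card_pos.1 (by omega)
  obtain ⟨i, hi, hle⟩ := IsUltrametricDist.exists_norm_finsetSum_le_of_nonempty hne
    (fun i : ℕ => (ψ.eval (-(i : ℚ_[p]))) / ∏ j ∈ s'.erase i, (-(i : ℚ_[p]) - -(j : ℚ_[p])))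
  rw [← hsum, norm_one, norm_div, norm_prod] at hle
  have hfac : ∀ k ∈ s'.erase i, ((p : ℝ) ^ N)⁻¹ ≤ ‖(-(i : ℚ_[p]) - -(k : ℚ_[p]))‖ := by
    intro k hk
    have hki : k ≠ i := Finset.ne_of_mem_erase hk
    have hkT := Finset.mem_range.1 (hs (hs's (Finset.mem_of_mem_erase hk)))
    have hiT := Finset.mem_range.1 (hs (hs's hi))
    have h1 : (-(i : ℚ_[p]) - -(k : ℚ_[p])) = (((k : ℤ) - (i : ℤ) : ℤ) : ℚ_[p]) := by push_cast; ring
    rw [h1]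
    by_contra hlt
    push Not at hlt
    have h2 := (Padic.norm_int_le_pow_iff_dvd (p := p) ((k : ℤ) - i) N).1 (by
      rw [zpow_neg, zpow_natCast]; exact hlt.le)
    have h3 := Int.eq_zero_of_abs_lt_dvd h2 (by
      have : (T : ℤ) < ((p ^ N : ℕ) : ℤ) := by exact_mod_cast hN
      rw [abs_lt]
      push_cast at this ⊢
      constructor <;> omega)
    omega
  have hprod : (((p : ℝ) ^ N)⁻¹) ^ D ≤ ∏ k ∈ s'.erase i, ‖(-(i : ℚ_[p]) - -(k : ℚ_[p]))‖ := by
    have : (s'.erase i).card = D := by rw [Finset.card_erase_of_mem hi, hs']; rfl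
    rw [← this, ← Finset.prod_const]
    exact Finset.prod_le_prod (fun _ _ => by positivity) hfac
  have hnum : ‖ψ.eval (-(i : ℚ_[p]))‖ ≤ ((p : ℝ) ^ (N * D + 1))⁻¹ := by
    have h1 : ψ.eval (-(i : ℚ_[p])) = ((χ.eval (-(i : ℤ_[p])) : ℤ_[p]) : ℚ_[p]) := by
      have := Polynomial.eval_map_apply (p := χ) PadicInt.Coe.ringHom (-(i : ℤ_[p]))
      rw [map_neg, map_natCast] at this
      exact this
    obtain ⟨c, hc⟩ := hdvd i (hs's hi)
    rw [h1, hc]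
    push_cast
    rw [norm_mul, norm_pow, Padic.norm_p, inv_pow]
    have := PadicInt.norm_le_one c
    have h0 : (0:ℝ) ≤ ((p : ℝ) ^ (N * D + 1))⁻¹ := by positivity
    exact mul_le_of_le_one_right h0 (by simpa using this)
  have hpos : 0 < (((p : ℝ) ^ N)⁻¹) ^ D := by positivity
  rw [le_div_iff₀ (hpos.trans_le hprod), one_mul] at hle
  have h5 := (hprod.trans hle).trans hnum
  rw [inv_pow, ← pow_mul, inv_le_inv₀ (by positivity) (by positivity)] at h5
  have h6 : (p : ℝ) ^ (N * D) < (p : ℝ) ^ (N * D + 1) := pow_lt_pow_right₀ hp1 (by omega)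
  linarith

theorem bad_small (p : ℕ) [Fact p.Prime] (R : Type) [CommRing R] [Algebra ℤ_[p] R]
    [Module.Finite ℤ_[p] R] (n m : ℕ) (hnm : n ≤ m)
    (hfin : ∀ j, Finite ((Fin n → R) ⧸ scaled n ((p : R) ^ (j + 1)))) :
    ∃ D : ℕ, ∀ T : ℕ, ∃ j : ℕ,
    T * Nat.card {v : Fin m → ((Fin n → R) ⧸ scaled n ((p : R) ^ (j + 1))) //
      ¬ ∀ x : (_ ⧸ Submodule.span R (Set.range v)), (p : R) ^ j • x = 0} ≤
    D * Nat.card (Fin m → ((Fin n → R) ⧸ scaled n ((p : R) ^ (j + 1)))) := by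
  classical
  obtain ⟨D, π, hπ⟩ := Module.Finite.exists_fin' ℤ_[p] (Fin n → R)
  refine ⟨D, fun T => ?_⟩
  obtain ⟨j, hj⟩ := few_roots p D T
  refine ⟨j, ?_⟩
  have := hfin j
  set U := scaled n ((p : R) ^ (j + 1)) with hU
  let bad : (Fin m → ((Fin n → R) ⧸ U)) → Prop := fun v =>
    ¬ ∀ x : (_ ⧸ Submodule.span R (Set.range v)), (p : R) ^ j • x = 0
  have : Fintype (Fin m → ((Fin n → R) ⧸ U)) := Fintype.ofFinite _
  let e : Fin m → ((Fin n → R) ⧸ U) := fun i => if h : i.1 < n then U.mkQ (Pi.single ⟨i.1, h⟩ 1) else 0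
  have hkill : ∀ y : ((Fin n → R) ⧸ U), (p : R) ^ (j + 1) • y = 0 := by
    intro y
    obtain ⟨x, rfl⟩ := Submodule.mkQ_surjective _ y
    rw [← map_smul, Submodule.mkQ_apply, Submodule.Quotient.mk_eq_zero]
    exact ⟨x, rfl⟩
  have main : ∀ v, ((Finset.range T).filter fun t => bad (v + t • e)).card ≤ D := by
    intro v
    let f₀ : (Fin n → R) →ₗ[R] ((Fin n → R) ⧸ U) :=
      Fintype.linearCombination R (fun i : Fin n => v (Fin.castLE hnm i))
    let f : ((Fin n → R) ⧸ U) →ₗ[R] ((Fin n → R) ⧸ U) := U.liftQ f₀ (by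
      rintro _ ⟨x, rfl⟩
      rw [LinearMap.mem_ker, LinearMap.lsmul_apply, map_smul, hkill])
    obtain ⟨χ, hmon, hdeg, hχ⟩ := exists_monic_aeval ((U.mkQ.restrictScalars ℤ_[p]) ∘ₗ π)
      ((Submodule.mkQ_surjective _).comp hπ) (f.restrictScalars ℤ_[p])
    refine hj χ hmon hdeg _ (Finset.filter_subset _ _) fun t ht => ?_
    have hbad : bad (v + t • e) := (Finset.mem_filter.1 ht).2
    refine (padic_dvd_or p _ j).resolve_left fun hdvd => hbad ?_
    intro x
    obtain ⟨y, rfl⟩ := Submodule.mkQ_surjective _ x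
    rw [← map_smul, Submodule.mkQ_apply, Submodule.Quotient.mk_eq_zero]
    have hspan : ∀ z, f z + (t : R) • z ∈ Submodule.span R (Set.range (v + t • e)) := by
      intro z
      obtain ⟨x, rfl⟩ := Submodule.mkQ_surjective _ z
      have h1 : f (U.mkQ x) = ∑ i, x i • v (Fin.castLE hnm i) := rfl
      have h2 : U.mkQ x = ∑ i, x i • e (Fin.castLE hnm i) := by
        have h3 : x = ∑ i, x i • (Pi.single i 1 : Fin n → R) := by
          ext k; simp [Finset.sum_apply, Pi.single_apply]
        conv_lhs => rw [h3]
        rw [map_sum]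
        refine Finset.sum_congr rfl fun i _ => ?_
        rw [map_smul]
        simp [e]
      rw [h1, h2, Finset.smul_sum, ← Finset.sum_add_distrib]
      refine Submodule.sum_mem _ fun i _ => ?_
      rw [smul_comm, ← smul_add]
      refine Submodule.smul_mem _ _ (Submodule.subset_span ⟨Fin.castLE hnm i, ?_⟩)
      simp [Nat.cast_smul_eq_nsmul]
    obtain ⟨z, hz⟩ := eval_smul_mem (f.restrictScalars ℤ_[p]) χ hχ (t : ℤ_[p]) y
    obtain ⟨c, hc⟩ := hdvd
    have h4 : (p : R) ^ j • y = algebraMap ℤ_[p] R c • (f z + (t : R) • z) := by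
      have h5 : f z + (t : R) • z = χ.eval (-(t : ℤ_[p])) • y := by
        rw [hz, LinearMap.restrictScalars_apply, Nat.cast_smul_eq_nsmul, Nat.cast_smul_eq_nsmul]
      rw [h5, ← algebraMap_smul R (χ.eval (-(t : ℤ_[p]))) y, smul_smul, ← map_mul, mul_comm c, ← hc]
      simp
    rw [h4]
    exact Submodule.smul_mem _ _ (hspan z)
  have hcount : Nat.card {v // bad v} = (Finset.univ.filter bad).card := by
    rw [Nat.card_eq_fintype_card, Fintype.card_subtype]
  change T * Nat.card {v // bad v} ≤ _
  rw [hcount, Nat.card_eq_fintype_card]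
  have h6 : ∀ t : ℕ, ∑ v, (if bad (v + t • e) then 1 else 0) = (Finset.univ.filter bad).card := by
    intro t
    rw [Finset.card_filter]
    exact Equiv.sum_comp (Equiv.addRight (t • e)) (fun v => if bad v then 1 else 0)
  calc T * (Finset.univ.filter bad).card
      = ∑ t ∈ Finset.range T, ∑ v, (if bad (v + t • e) then 1 else 0) := by
        rw [Finset.sum_congr rfl fun t _ => h6 t, Finset.sum_const, Finset.card_range, smul_eq_mul]
    _ = ∑ v, ∑ t ∈ Finset.range T, (if bad (v + t • e) then 1 else 0) := Finset.sum_comm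
    _ ≤ ∑ v, D := Finset.sum_le_sum fun v _ => by rw [← Finset.card_filter]; exact main v
    _ = _ := by rw [Finset.sum_const, Finset.card_univ, smul_eq_mul, mul_comm]


theorem finite_of_killed (p : ℕ) [Fact p.Prime] (V : Type) [AddCommGroup V] [Module ℤ_[p] V]
    [Module.Finite ℤ_[p] V] (k : ℕ) (hk : ∀ x : V, (p : ℤ_[p]) ^ k • x = 0) : Finite V := by
  obtain ⟨D, π, hπ⟩ := Module.Finite.exists_fin' ℤ_[p] V
  have : NeZero (p ^ k) := ⟨pow_ne_zero _ (Fact.out : p.Prime).ne_zero⟩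
  refine Finite.of_surjective (fun a : Fin D → ZMod (p ^ k) => π fun i => ((a i).val : ℤ_[p])) ?_
  intro x
  obtain ⟨y, rfl⟩ := hπ x
  refine ⟨fun i => PadicInt.toZModPow k (y i), ?_⟩
  have h : ∀ i, ∃ c : ℤ_[p], (((PadicInt.toZModPow k (y i)).val : ℕ) : ℤ_[p]) - y i = (p : ℤ_[p]) ^ k * c := by
    intro i
    have h1 : (((PadicInt.toZModPow k (y i)).val : ℕ) : ℤ_[p]) - y i ∈
        RingHom.ker (PadicInt.toZModPow k : ℤ_[p] →+* ZMod (p ^ k)) := by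
      rw [RingHom.mem_ker, map_sub, map_natCast, ZMod.natCast_zmod_val, sub_self]
    rw [PadicInt.ker_toZModPow, Ideal.mem_span_singleton] at h1
    exact h1
  choose c hc using h
  rw [← sub_eq_zero, ← map_sub]
  have : ((fun i => (((PadicInt.toZModPow k (y i)).val : ℕ) : ℤ_[p])) - y) = (p : ℤ_[p]) ^ k • c := by
    ext1 i; exact hc i
  rw [this, map_smul, hk]

theorem p_facts (p : ℕ) [Fact p.Prime] (R : Type) [CommRing R] [IsLocalRing R]
    [Algebra ℤ_[p] R] (hinj : Function.Injective (algebraMap ℤ_[p] R))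
    [Module.Finite ℤ_[p] R] : (p : R) ∈ maximalIdeal R ∧ ¬ IsNilpotent (p : R) := by
  constructor
  · rw [mem_maximalIdeal, mem_nonunits_iff]
    intro h
    have hloc : IsLocalHom (algebraMap ℤ_[p] R) :=
      (algebraMap_isIntegral_iff.2 inferInstance).isLocalHom hinj
    have h2 : IsUnit (algebraMap ℤ_[p] R (p : ℤ_[p])) := by simpa using h
    exact PadicInt.p_nonunit (p := p) (isUnit_of_map_unit _ _ h2)
  · rintro ⟨k, hk⟩
    have h2 : algebraMap ℤ_[p] R ((p : ℤ_[p]) ^ k) = algebraMap ℤ_[p] R 0 := by simpa using hk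
    exact pow_ne_zero k (by exact_mod_cast (Fact.out : p.Prime).ne_zero) (hinj h2)

theorem finite_quot (p : ℕ) [Fact p.Prime] (R : Type) [CommRing R]
    [Algebra ℤ_[p] R] (W : Type) [AddCommGroup W] [Module R W] [Module ℤ_[p] W]
    [IsScalarTower ℤ_[p] R W] [Module.Finite ℤ_[p] W] (U : Submodule R W) (k : ℕ)
    (hU : ∀ x, (p : R) ^ k • x ∈ U) : Finite (W ⧸ U) := by
  have hs : Function.Surjective (U.mkQ.restrictScalars ℤ_[p]) := U.mkQ_surjective
  have : Module.Finite ℤ_[p] (W ⧸ U) := Module.Finite.of_surjective _ hs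
  refine finite_of_killed p _ k fun y => ?_
  obtain ⟨x, rfl⟩ := U.mkQ_surjective y
  have h1 : (p : ℤ_[p]) ^ k • (U.mkQ x) = U.mkQ ((p : R) ^ k • x) := by
    rw [map_smul]
    have h2 := algebraMap_smul R ((p : ℤ_[p]) ^ k) (U.mkQ x)
    rw [map_pow, map_natCast] at h2
    exact h2.symm
  rw [h1, Submodule.mkQ_apply, Submodule.Quotient.mk_eq_zero]
  exact hU x

theorem finite_V (p : ℕ) [Fact p.Prime] (R : Type) [CommRing R]
    [Algebra ℤ_[p] R] [Module.Finite ℤ_[p] R] (n k : ℕ) :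
    Finite ((Fin n → R) ⧸ scaled n ((p : R) ^ k)) :=
  finite_quot p R _ _ k fun x => ⟨x, rfl⟩

theorem killed_of_finite {R : Type} [CommRing R] [IsLocalRing R] (P : R) (hP : P ∈ maximalIdeal R)
    (M : Type) [AddCommGroup M] [Module R M] [Finite M] : ∃ j, ∀ k, j ≤ k → ∀ x : M, P ^ k • x = 0 := by
  have : Finite (M → M) := inferInstance
  obtain ⟨a, b, hab, h⟩ := Finite.exists_ne_map_eq_of_infinite (fun (k : ℕ) (x : M) => P ^ k • x)
  wlog hlt : a < b generalizing a b
  · exact this b a hab.symm h.symm (by omega)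
  refine ⟨a, fun k hk x => ?_⟩
  have h0 : P ^ a • x = 0 := by
    have h1 : P ^ a • x = P ^ b • x := congrFun h x
    have hu : IsUnit (1 - P ^ (b - a)) := by
      by_contra hn
      have h2 : (1 - P ^ (b - a)) ∈ maximalIdeal R := (mem_maximalIdeal _).2 hn
      have h3 : P ^ (b - a) ∈ maximalIdeal R := Ideal.pow_mem_of_mem _ hP _ (by omega)
      have h4 := Ideal.add_mem _ h2 h3
      rw [sub_add_cancel] at h4
      exact (Ideal.ne_top_iff_one _).1 (maximalIdeal.isMaximal R).ne_top h4
    have h5 : (1 - P ^ (b - a)) • (P ^ a • x) = 0 := by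
      rw [sub_smul, one_smul, smul_smul, ← pow_add, Nat.sub_add_cancel hlt.le, ← h1, sub_self]
    exact (hu.smul_eq_zero).1 h5
  obtain ⟨c, rfl⟩ := Nat.exists_eq_add_of_le' hk
  rw [pow_add, mul_smul, h0, smul_zero]


theorem spanProb_eq (q : ℕ) (hq : 2 ≤ q) (m e : ℕ) (h : e ≤ m) :
    spanProb q m e * ∏ j ∈ Finset.range (m - e), (1 - ((q : ℝ))⁻¹ ^ (j + 1)) =
      ∏ j ∈ Finset.range m, (1 - ((q : ℝ))⁻¹ ^ (j + 1)) := by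
  have hq0 : (q : ℝ) ≠ 0 := by positivity
  induction e with
  | zero => simp [spanProb]
  | succ e ih =>
    rw [← ih (by omega), spanProb, Finset.prod_range_succ, ← spanProb]
    obtain ⟨c, rfl⟩ := Nat.exists_eq_add_of_le' h
    have h1 : c + (e + 1) - e = c + 1 := by omega
    have h2 : c + (e + 1) - (e + 1) = c := by omega
    rw [h1, h2, Finset.prod_range_succ]
    have h3 : (q : ℝ) ^ e / (q : ℝ) ^ (c + (e + 1)) = ((q : ℝ))⁻¹ ^ (c + 1) := by
      rw [inv_pow, div_eq_iff (by positivity)]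
      field_simp
      ring
    rw [h3]; ring

theorem spanProb_zero (q : ℕ) (hq : 2 ≤ q) (m e : ℕ) (h : m < e) : spanProb q m e = 0 := by
  have hq0 : (q : ℝ) ≠ 0 := by positivity
  refine Finset.prod_eq_zero (Finset.mem_range.2 h) ?_
  rw [div_self (by positivity), sub_self]

theorem factor_pos (q : ℕ) (hq : 2 ≤ q) (j : ℕ) : 0 < 1 - ((q : ℝ))⁻¹ ^ (j + 1) := by
  have : ((q : ℝ))⁻¹ ^ (j + 1) < 1 := by
    apply pow_lt_one₀ (by positivity) _ (by omega)
    apply inv_lt_one_of_one_lt₀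
    exact_mod_cast hq
  linarith

theorem spanProb_nonneg (q : ℕ) (hq : 2 ≤ q) (m e : ℕ) : 0 ≤ spanProb q m e := by
  rcases le_or_gt e m with h | h
  · refine Finset.prod_nonneg fun i hi => ?_
    rw [sub_nonneg]
    apply div_le_one_of_le₀ _ (by positivity)
    apply pow_le_pow_right₀ (by exact_mod_cast (by omega : 1 ≤ q))
    have := Finset.mem_range.1 hi
    omega
  · rw [spanProb_zero q hq m e h]

theorem spanProb_le_one (q : ℕ) (hq : 2 ≤ q) (m e : ℕ) : spanProb q m e ≤ 1 := by
  rcases le_or_gt e m with h | h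
  · refine Finset.prod_le_one (fun i hi => ?_) (fun i hi => ?_)
    · rw [sub_nonneg]
      apply div_le_one_of_le₀ _ (by positivity)
      apply pow_le_pow_right₀ (by exact_mod_cast (by omega : 1 ≤ q))
      have := Finset.mem_range.1 hi
      omega
    · have : 0 ≤ (q : ℝ) ^ i / (q : ℝ) ^ m := by positivity
      linarith
  · rw [spanProb_zero q hq m e h]; exact zero_le_one

theorem spanProb_tendsto (q : ℕ) (hq : 2 ≤ q) (e : ℕ) :
    Filter.Tendsto (fun m => spanProb q m e) Filter.atTop (nhds 1) := by
  have : (1 : ℝ) = ∏ i ∈ Finset.range e, (1 - 0) := by simp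
  rw [this]
  refine tendsto_finsetProd _ fun i _ => ?_
  refine tendsto_const_nhds.sub ?_
  refine Filter.Tendsto.const_div_atTop ?_ _
  exact tendsto_pow_atTop_atTop_of_one_lt (by exact_mod_cast hq)

theorem phi_summable (q : ℕ) (hq : 2 ≤ q) : Summable fun j : ℕ => - ((q : ℝ))⁻¹ ^ (j + 1) := by
  refine Summable.neg ?_
  refine (summable_nat_add_iff 1).mpr (summable_geometric_of_lt_one (by positivity) ?_)
  apply inv_lt_one_of_one_lt₀
  exact_mod_cast hq

theorem phi_tendsto (q : ℕ) (hq : 2 ≤ q) :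
    Filter.Tendsto (fun n => ∏ j ∈ Finset.range n, (1 - ((q : ℝ))⁻¹ ^ (j + 1))) Filter.atTop
      (nhds (∏' j : ℕ, (1 - ((q : ℝ))⁻¹ ^ (j + 1)))) := by
  have := Real.multipliable_one_add_of_summable (phi_summable q hq)
  simp only [← sub_eq_add_neg] at this
  exact this.tendsto_prod_tprod_nat

theorem phi_pos (q : ℕ) (hq : 2 ≤ q) : 0 < ∏' j : ℕ, (1 - ((q : ℝ))⁻¹ ^ (j + 1)) := by
  refine lt_of_le_of_ne ?_ (Ne.symm ?_)
  · exact ge_of_tendsto' (phi_tendsto q hq) fun n =>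
      Finset.prod_nonneg fun j _ => (factor_pos q hq j).le
  · have := tprod_one_add_ne_zero_of_summable (f := fun j : ℕ => - ((q : ℝ))⁻¹ ^ (j + 1))
      (fun j => by have := factor_pos q hq j; linarith) (by simpa using (phi_summable q hq).norm)
    simpa only [← sub_eq_add_neg] using this

/-- The analytic step. -/
theorem analytic {ι : Type} (q : ℕ) (hq : 2 ≤ q) (d : ℕ) (g D : ι → ℕ) (w : ι → ℝ) (hw : ∀ i, 0 ≤ w i)
    (h : ∀ n, HasSum (fun i => spanProb q n (g i) * spanProb q (n + d) (n + D i) * w i) 1) :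
    HasSum (fun i : {i : ι // D i ≤ d} =>
      (∏ j ∈ Finset.range (d - D i.1), (1 - ((q : ℝ))⁻¹ ^ (j + 1))⁻¹) * w i.1)
      (∏' j : ℕ, (1 - ((q : ℝ))⁻¹ ^ (j + 1)))⁻¹ := by
  set T : {i : ι // D i ≤ d} → ℝ := fun i =>
      (∏ j ∈ Finset.range (d - D i.1), (1 - ((q : ℝ))⁻¹ ^ (j + 1))⁻¹) * w i.1 with hT
  set c := ∏' j : ℕ, (1 - ((q : ℝ))⁻¹ ^ (j + 1)) with hc
  let Φ : ℕ → ℝ := fun n => ∏ j ∈ Finset.range n, (1 - ((q : ℝ))⁻¹ ^ (j + 1))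
  have hcpos : 0 < c := phi_pos q hq
  have hT0 : ∀ i, 0 ≤ T i := fun i => mul_nonneg
    (Finset.prod_nonneg fun j _ => (inv_pos.2 (factor_pos q hq j)).le) (hw _)
  have hΦ0 : ∀ n, 0 ≤ Φ n := fun n => Finset.prod_nonneg fun j _ => (factor_pos q hq j).le
  have hΦ1 : ∀ n, Φ n ≤ 1 := fun n => Finset.prod_le_one (fun j _ => (factor_pos q hq j).le) fun j _ => by
    have : 0 ≤ ((q : ℝ))⁻¹ ^ (j + 1) := by positivity
    linarith
  have hΦlim : Filter.Tendsto (fun n => Φ (n + d)) Filter.atTop (nhds c) :=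
    (phi_tendsto q hq).comp (Filter.tendsto_add_atTop_nat d)
  have hsub : ∀ n, HasSum (fun i : {i : ι // D i ≤ d} => Φ (n + d) * spanProb q n (g i.1) * T i) 1 := by
    intro n
    have hs : Function.support (fun i => spanProb q n (g i) * spanProb q (n + d) (n + D i) * w i) ⊆
        {i | D i ≤ d} := by
      intro i hi
      by_contra hlt
      apply hi
      have hlt' : d < D i := not_le.1 hlt
      simp only
      rw [spanProb_zero q hq (n + d) (n + D i) (by omega)]
      ring
    have h1 := (hasSum_subtype_iff_of_support_subset hs).2 (h n)
    refine Eq.mp (congrArg (fun F => HasSum F (1 : ℝ)) (funext ?_)) h1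
    rintro ⟨i, hi⟩
    simp only [Function.comp, hT]
    have h2 := spanProb_eq q hq (n + d) (n + D i) (by omega)
    have h3 : n + d - (n + D i) = d - D i := by omega
    rw [h3] at h2
    have h4 : (∏ j ∈ Finset.range (d - D i), (1 - ((q : ℝ))⁻¹ ^ (j + 1))) ≠ 0 :=
      (Finset.prod_pos fun j _ => factor_pos q hq j).ne'
    rw [Finset.prod_inv_distrib]
    change _ = (∏ j ∈ Finset.range (n + d), (1 - ((q : ℝ))⁻¹ ^ (j + 1))) * _ * _
    rw [← h2]
    generalize (∏ j ∈ Finset.range (d - D i), (1 - ((q : ℝ))⁻¹ ^ (j + 1))) = Z at h4 ⊢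
    field_simp
  have hlim : ∀ i, Filter.Tendsto (fun n => Φ (n + d) * spanProb q n (g i.1) * T i) Filter.atTop
      (nhds (c * T i)) := by
    intro i
    have := (hΦlim.mul (spanProb_tendsto q hq (g i.1))).mul_const (T i)
    rwa [mul_one] at this
  have hsumm : Summable T := by
    refine summable_of_sum_le (c := c⁻¹) hT0 fun s => ?_
    have h1 : ∑ i ∈ s, c * T i ≤ 1 := by
      refine le_of_tendsto' (tendsto_finsetSum s fun i _ => hlim i) fun n => ?_
      exact sum_le_hasSum s (fun i _ => mul_nonneg (mul_nonneg (hΦ0 _) (spanProb_nonneg q hq _ _)) (hT0 i))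
        (hsub n)
    rw [← Finset.mul_sum] at h1
    rw [← one_div, le_div_iff₀ hcpos]
    linarith
  have hdom := tendsto_tsum_of_dominated_convergence (𝓕 := Filter.atTop) (bound := T) hsumm hlim
    (Filter.Eventually.of_forall fun n i => by
      rw [Real.norm_of_nonneg (mul_nonneg (mul_nonneg (hΦ0 _) (spanProb_nonneg q hq _ _)) (hT0 i))]
      refine mul_le_of_le_one_left (hT0 i) ?_
      exact mul_le_one₀ (hΦ1 _) (spanProb_nonneg q hq _ _) (spanProb_le_one q hq _ _))
  have h1 : (fun n => ∑' i, Φ (n + d) * spanProb q n (g i.1) * T i) = fun _ => 1 :=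
    funext fun n => (hsub n).tsum_eq
  rw [h1] at hdom
  have h2 : 1 = ∑' i, c * T i := tendsto_nhds_unique tendsto_const_nhds hdom
  rw [tsum_mul_left] at h2
  have h3 : ∑' i, T i = c⁻¹ := eq_inv_of_mul_eq_one_right h2.symm
  rw [← h3]
  exact hsumm.hasSum


/-- A general principle: a family of nonnegative weights approximated by fibre frequencies. -/
theorem freq_principle {ι : Type} (f : ι → ℝ) (hf : ∀ i, 0 ≤ f i)
    (Ω : ℕ → Type) [∀ j, Finite (Ω j)] [∀ j, Nonempty (Ω j)] (cls : ∀ j, Ω j → ι) (good : ℕ → ι → Prop)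
    (hgood : ∀ i, ∃ j₀, ∀ j, j₀ ≤ j → good j i)
    (hfreq : ∀ j i, good j i → f i * Nat.card (Ω j) = Nat.card {v : Ω j // cls j v = i})
    (hbad : ∃ D : ℕ, ∀ T : ℕ, ∃ j, T * Nat.card {v : Ω j // ¬ good j (cls j v)} ≤ D * Nat.card (Ω j)) :
    HasSum f 1 := by
  classical
  have : ∀ j, Fintype (Ω j) := fun j => Fintype.ofFinite _
  have hcardpos : ∀ j, (0 : ℝ) < Nat.card (Ω j) := fun j => by exact_mod_cast Nat.card_pos
  have hsum : ∀ j (s : Finset ι), (∀ i ∈ s, good j i) →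
      (∑ i ∈ s, f i) * Nat.card (Ω j) = ((Finset.univ.filter fun v => cls j v ∈ s).card : ℝ) := by
    intro j s hs
    rw [← Finset.sum_card_fiberwise_eq_card_filter, Finset.sum_mul, Nat.cast_sum]
    refine Finset.sum_congr rfl fun i hi => ?_
    rw [hfreq j i (hs i hi), Nat.card_eq_fintype_card, Fintype.card_subtype]
  refine hasSum_of_isLUB_of_nonneg 1 hf ⟨?_, ?_⟩
  · rintro _ ⟨s, rfl⟩
    choose j₀ hj₀ using hgood
    set j := s.sup j₀
    have h1 := hsum j s fun i hi => hj₀ i j (Finset.le_sup hi)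
    have h2 : ((Finset.univ.filter fun v => cls j v ∈ s).card : ℝ) ≤ Nat.card (Ω j) := by
      rw [Nat.card_eq_fintype_card]; exact_mod_cast Finset.card_le_univ _
    rw [← h1] at h2
    exact (mul_le_iff_le_one_left (hcardpos j)).1 h2
  · intro b hb
    obtain ⟨D, hD⟩ := hbad
    refine le_of_forall_pos_le_add fun ε hε => ?_
    obtain ⟨T, hT⟩ := exists_nat_gt (D / ε)
    obtain ⟨j, hj⟩ := hD T
    set s : Finset ι := (Finset.univ.filter fun v => good j (cls j v)).image (cls j) with hs
    have hsg : ∀ i ∈ s, good j i := by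
      intro i hi
      obtain ⟨v, hv, rfl⟩ := Finset.mem_image.1 hi
      exact (Finset.mem_filter.1 hv).2
    have h1 := hsum j s hsg
    have h2 : (Finset.univ.filter fun v => cls j v ∈ s) = Finset.univ.filter fun v => good j (cls j v) := by
      ext v
      simp only [Finset.mem_filter, Finset.mem_univ, true_and]
      exact ⟨fun h => hsg _ h, fun h => Finset.mem_image.2 ⟨v, by simpa using h, rfl⟩⟩
    have h3 : b ≥ ∑ i ∈ s, f i := hb ⟨s, rfl⟩
    have h4 : ((Finset.univ.filter fun v => good j (cls j v)).card : ℝ) +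
        Nat.card {v : Ω j // ¬ good j (cls j v)} = Nat.card (Ω j) := by
      rw [Nat.card_eq_fintype_card, Nat.card_eq_fintype_card, Fintype.card_subtype]
      have := Finset.card_filter_add_card_filter_not (s := (Finset.univ : Finset (Ω j)))
        (fun v => good j (cls j v))
      rw [Finset.card_univ] at this
      exact_mod_cast this
    rw [h2] at h1
    have h5 : (T : ℝ) * Nat.card {v : Ω j // ¬ good j (cls j v)} ≤ D * Nat.card (Ω j) := by exact_mod_cast hj
    have hN := hcardpos j
    set N : ℝ := (Nat.card (Ω j) : ℝ)
    set B : ℝ := (Nat.card {v : Ω j // ¬ good j (cls j v)} : ℝ)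
    have hD0 : (0 : ℝ) ≤ D := Nat.cast_nonneg _
    have hTpos : (0 : ℝ) < T := lt_of_le_of_lt (by positivity) hT
    rw [div_lt_iff₀ hε] at hT
    have h6 : B ≤ ε * N := by
      have : T * B ≤ T * (ε * N) := by nlinarith
      exact le_of_mul_le_mul_left this hTpos
    have h7 : N ≤ (b + ε) * N := by nlinarith
    exact (le_mul_iff_one_le_left hN).1 h7

theorem hasSum_level (p : ℕ) [Fact p.Prime] (R : Type) [CommRing R] [IsLocalRing R]
    [Algebra ℤ_[p] R] (hinj : Function.Injective (algebraMap ℤ_[p] R))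
    [Module.Finite ℤ_[p] R] [Finite (ResidueField R)]
    (ι : Type) (Mod : ι → ModuleCat.{0} R)
    (hfin : ∀ i, Finite (Mod i))
    (hcomplete : ∀ (M : Type) [AddCommGroup M] [Module R M], Finite M →
      ∃ i, Nonempty (M ≃ₗ[R] Mod i))
    (hirr : ∀ i j, Nonempty ((Mod i : Type) ≃ₗ[R] Mod j) → i = j)
    (d n : ℕ) (hq : 2 ≤ Nat.card (ResidueField R)) :
    HasSum (fun i => spanProb (Nat.card (ResidueField R)) n (genRk R (Mod i)) *
      spanProb (Nat.card (ResidueField R)) (n + d) (n + dInv R (Mod i)) *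
      ((Nat.card (Mod i) : ℝ) ^ d * (numAut R (Mod i) : ℝ))⁻¹) 1 := by
  obtain ⟨hP, hPn⟩ := p_facts p R hinj
  have : IsNoetherianRing R := IsNoetherianRing.of_finite ℤ_[p] R
  have hV : ∀ j, Finite ((Fin n → R) ⧸ scaled n ((p : R) ^ (j + 1))) := fun j => finite_V p R n (j + 1)
  have hc : ∀ j (v : Fin (n + d) → ((Fin n → R) ⧸ scaled n ((p : R) ^ (j + 1)))),
      ∃ i, Nonempty ((_ ⧸ Submodule.span R (Set.range v)) ≃ₗ[R] Mod i) :=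
    fun j v => hcomplete _ (Quotient.finite _)
  choose cls hcls using hc
  have hiff : ∀ j v i, cls j v = i ↔ Nonempty ((_ ⧸ Submodule.span R (Set.range v)) ≃ₗ[R] Mod i) := by
    intro j v i
    constructor
    · rintro rfl; exact hcls j v
    · rintro ⟨e⟩
      obtain ⟨e'⟩ := hcls j v
      exact hirr _ _ ⟨e'.symm.trans e⟩
  refine freq_principle _ (fun i => ?_) (fun j => Fin (n + d) → ((Fin n → R) ⧸ scaled n ((p : R) ^ (j + 1))))
    cls (fun j i => ∀ x : Mod i, (p : R) ^ j • x = 0) (fun i => ?_) (fun j i hg => ?_) ?_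
  · have := spanProb_nonneg _ hq n (genRk R (Mod i))
    have := spanProb_nonneg _ hq (n + d) (n + dInv R (Mod i))
    positivity
  · have := hfin i
    exact killed_of_finite (p : R) hP (Mod i)
  · have := hfin i
    have h1 := count_main (p : R) hPn hP n (n + d) j (Mod i) hg
    have h2 : Nat.card {v // cls j v = i} =
        Nat.card {v : Fin (n + d) → ((Fin n → R) ⧸ scaled n ((p : R) ^ (j + 1))) //
          Nonempty ((_ ⧸ Submodule.span R (Set.range v)) ≃ₗ[R] Mod i)} :=
      Nat.card_congr (Equiv.subtypeEquivRight fun v => hiff j v i)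
    rw [h2, Nat.card_fun, Nat.card_fin]
    have hM : (Nat.card (Mod i) : ℝ) ≠ 0 := by exact_mod_cast Nat.card_pos.ne'
    have : Finite ((Mod i) ≃ₗ[R] (Mod i)) :=
      Finite.of_injective (fun e => (e : Mod i → Mod i)) DFunLike.coe_injective
    have hA : (numAut R (Mod i) : ℝ) ≠ 0 := by
      rw [numAut]; exact_mod_cast Nat.card_pos.ne'
    push_cast
    rw [pow_add (Nat.card (Mod i) : ℝ) n d, mul_assoc, mul_assoc (_ ^ n)] at h1
    have h3 := mul_ne_zero (pow_ne_zero n hM) (mul_ne_zero (pow_ne_zero d hM) hA)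
    have h4 : (Nat.card (Mod i) : ℝ) ^ d * (numAut R (Mod i) : ℝ) ≠ 0 := mul_ne_zero (pow_ne_zero d hM) hA
    apply mul_right_cancel₀ h3
    generalize (Nat.card (Mod i) : ℝ) ^ d * (numAut R (Mod i) : ℝ) = X at h1 h4 ⊢
    generalize (Nat.card (Mod i) : ℝ) ^ n = Y at *
    rw [mul_comm Y X, ← mul_assoc, mul_right_comm _ X⁻¹, mul_assoc _ X⁻¹ X, inv_mul_cancel₀ h4]
    linear_combination -h1
  · obtain ⟨D, hD⟩ := bad_small p R n (n + d) (by omega) hV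
    refine ⟨D, fun T => ?_⟩
    obtain ⟨j, hj⟩ := hD T
    refine ⟨j, ?_⟩
    refine le_trans (le_of_eq ?_) hj
    congr 1
    refine Nat.card_congr (Equiv.subtypeEquivRight fun v => not_congr ?_)
    obtain ⟨e⟩ := hcls j v
    constructor
    · intro h x
      apply e.injective
      rw [map_smul, h, map_zero]
    · intro h x
      apply e.symm.injective
      rw [map_smul, h, map_zero]

theorem statement12 (p : ℕ) [Fact p.Prime] (R : Type) [CommRing R] [IsLocalRing R]
    [Algebra ℤ_[p] R] (hinj : Function.Injective (algebraMap ℤ_[p] R))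
    [Module.Finite ℤ_[p] R] [Finite (ResidueField R)]
    -- `Mod : ι → ModuleCat R` is a complete irredundant family of representatives of the
    -- isomorphism classes of all finite `R`-modules:
    (ι : Type) (Mod : ι → ModuleCat.{0} R)
    (hfin : ∀ i, Finite (Mod i))
    (hcomplete : ∀ (M : Type) [AddCommGroup M] [Module R M], Finite M →
      ∃ i, Nonempty (M ≃ₗ[R] Mod i))
    (hirr : ∀ i j, Nonempty ((Mod i : Type) ≃ₗ[R] Mod j) → i = j)
    (d : ℕ) :
    HasSum
      (fun i : {i : ι // dInv R (Mod i) ≤ d} =>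
        (∏ j ∈ Finset.range (d - dInv R (Mod i.1)),
            (1 - ((Nat.card (ResidueField R) : ℝ))⁻¹ ^ (j + 1))⁻¹) /
          ((Nat.card (Mod i.1) : ℝ) ^ d * (numAut R (Mod i.1) : ℝ)))
      (cConst R)⁻¹ := by
  have hq : 2 ≤ Nat.card (ResidueField R) := Finite.one_lt_card
  simp only [div_eq_mul_inv]
  exact analytic (Nat.card (ResidueField R)) hq d (fun i => genRk R (Mod i)) (fun i => dInv R (Mod i))
    (fun i => ((Nat.card (Mod i) : ℝ) ^ d * (numAut R (Mod i) : ℝ))⁻¹) (fun i => by positivity)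
    (fun n => hasSum_level p R hinj ι Mod hfin hcomplete hirr d n hq)
end
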